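/- Fix r ≥ 2, n ≥ 2r, σ > 0, and suppose D^{(r)}θ* ≠ 0 and θ* satisfies the minimum length condition with constant c. Then, with λ* as defined in the context and k := k_r(θ*), there is a constant C_r(c) depending only on r and c such that for every λ ≥ λ*, R(θ̂^{(r)}_λ, θ*) ≤ C_r(c) σ² ( ((k+1)/n)·log(en/(k+1)) + (k+1)^{2r}/n + (λ − λ*)²·(k+1)^{2r}/n² ). -/

import Mathlib

open MeasureTheory ProbabilityTheory
open scoped BigOperators

noncomputable section

/-- Zero-padding of a finite vector to a sequence on `ℕ`. -/
def pad {n : ℕ} (θ : Fin n → ℝ) : ℕ → ℝ := fun t => if h : t < n then θ ⟨t, h⟩ else 0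

/-- First-order forward difference of a sequence. -/
def dseq (f : ℕ → ℝ) : ℕ → ℝ := fun t => f (t + 1) - f t

/-- `DD r θ t` is the `t`-th entry (0-indexed) of the `r`-th order difference `D^{(r)} θ`
of the vector `θ ∈ ℝ^n`; only the entries `t < n - r` are meaningful. -/
def DD (r : ℕ) {n : ℕ} (θ : Fin n → ℝ) : ℕ → ℝ := dseq^[r] (pad θ)

/-- The ℓ¹ norm `‖D^{(r)} θ‖₁`. -/
def Dl1 (r : ℕ) {n : ℕ} (θ : Fin n → ℝ) : ℝ := ∑ t ∈ Finset.range (n - r), |DD r θ t|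

/-- The number of nonzero entries `‖D^{(r)} θ‖₀`. -/
def Dl0 (r : ℕ) {n : ℕ} (θ : Fin n → ℝ) : ℕ :=
  ((Finset.range (n - r)).filter fun t => DD r θ t ≠ 0).card

/-- Squared Euclidean norm. -/
def sqnorm {n : ℕ} (x : Fin n → ℝ) : ℝ := ∑ i, x i ^ 2

/-- Euclidean norm. -/
def eunorm {n : ℕ} (x : Fin n → ℝ) : ℝ := Real.sqrt (sqnorm x)

/-- `V^{(r)}(θ) = n^{r-1} ‖D^{(r)} θ‖₁`. -/
def Vr (r : ℕ) {n : ℕ} (θ : Fin n → ℝ) : ℝ := (n : ℝ) ^ ((r : ℤ) - 1) * Dl1 r θ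

/-- The constraint set `K^{(r)}(V) = {θ : ‖D^{(r)} θ‖₁ ≤ V n^{1-r}}`. -/
def Kset (r n : ℕ) (V : ℝ) : Set (Fin n → ℝ) := {θ | Dl1 r θ ≤ V * (n : ℝ) ^ (1 - (r : ℤ))}

/-- `est` is a least-squares projection onto the set `K`. -/
def IsProjOn {n : ℕ} (est : (Fin n → ℝ) → Fin n → ℝ) (K : Set (Fin n → ℝ)) : Prop :=
  ∀ y, est y ∈ K ∧ ∀ θ ∈ K, sqnorm (y - est y) ≤ sqnorm (y - θ)

/-- `est` is the penalized trend filtering estimator of order `r` with noise level `σ`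
and tuning parameter `lam`: it minimizes `½‖y - θ‖² + σ n^{r-1} lam ‖D^{(r)} θ‖₁`. -/
def IsPenEst (r : ℕ) {n : ℕ} (σ lam : ℝ) (est : (Fin n → ℝ) → Fin n → ℝ) : Prop :=
  ∀ y θ, 1 / 2 * sqnorm (y - est y) + σ * (n : ℝ) ^ ((r : ℤ) - 1) * lam * Dl1 r (est y) ≤
    1 / 2 * sqnorm (y - θ) + σ * (n : ℝ) ^ ((r : ℤ) - 1) * lam * Dl1 r θ

/-- The Gaussian measure `N_n(0, σ² I_n)` on `ℝ^n`. -/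
def gaussVec (n : ℕ) (σ : ℝ) : Measure (Fin n → ℝ) :=
  Measure.pi fun _ => gaussianReal 0 (σ ^ 2).toNNReal

/-- The risk `R(θ̂, θ*) = (1/n) E ‖θ̂(θ* + ξ) - θ*‖²` for `ξ ∼ N_n(0, σ² I_n)`. -/
def risk {n : ℕ} (σ : ℝ) (est : (Fin n → ℝ) → Fin n → ℝ) (θs : Fin n → ℝ) : ℝ :=
  1 / (n : ℝ) * ∫ ξ, sqnorm (est (θs + ξ) - θs) ∂gaussVec n σ

/-- `j` (with signs `sg`) enumerates, in increasing order and paper (1-indexed) convention,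
exactly the `r`-th order knots of `θ ∈ ℝ^n`; an index `2 ≤ m ≤ n - r + 1` is a knot when
`(D^{(r-1)}θ)_{m-1} ≠ (D^{(r-1)}θ)_m` (1-indexed entries), and its sign is `+1` when
`(D^{(r-1)}θ)_{m-1} < (D^{(r-1)}θ)_m` and `-1` otherwise. -/
def IsKnotSeq (r n : ℕ) (θ : Fin n → ℝ) (k : ℕ) (j : Fin k → ℕ) (sg : Fin k → ℝ) : Prop :=
  StrictMono j ∧ (∀ i, 2 ≤ j i ∧ j i ≤ n - r + 1) ∧
    (∀ m : ℕ, 2 ≤ m → m ≤ n - r + 1 →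
      (DD (r - 1) θ (m - 2) ≠ DD (r - 1) θ (m - 1) ↔ ∃ i, j i = m)) ∧
    ∀ i, sg i = if DD (r - 1) θ (j i - 2) < DD (r - 1) θ (j i - 1) then 1 else -1

/-- Extended knot sequence: `jext 0 = j_0 = 1`, `jext i = j_i` for `1 ≤ i ≤ k`, and
`jext (k+1) = j_{k+1} = n - r + 2`. -/
def jext (n r k : ℕ) (j : Fin k → ℕ) : ℕ → ℕ := fun i =>
  if i = 0 then 1 else if h : i - 1 < k then j ⟨i - 1, h⟩ else n - r + 2

/-- Extended sign sequence: `sgext i = 𝔯_i` for `1 ≤ i ≤ k` and `0` otherwise. -/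
def sgext (k : ℕ) (sg : Fin k → ℝ) : ℕ → ℝ := fun i =>
  if h : 0 < i ∧ i - 1 < k then sg ⟨i - 1, h.2⟩ else 0

/-- The lengths `n_0 = j_1 + r - 2`, `n_i = j_{i+1} - j_i` (`1 ≤ i ≤ k-1`),
`n_k = n - r + 2 - j_k`. -/
def nlen (n r k : ℕ) (j : Fin k → ℕ) : ℕ → ℕ := fun i =>
  if i = 0 then jext n r k j 1 + r - 2 else jext n r k j (i + 1) - jext n r k j i

/-- `n_{i*} = min(n_i, n/(k+1))`. -/
def nstar (n r k : ℕ) (j : Fin k → ℕ) (i : ℕ) : ℝ :=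
  min (nlen n r k j i : ℝ) ((n : ℝ) / ((k : ℝ) + 1))

/-- `δ_r(θ)²` defined from the knot data of `θ`. -/
def deltaSq (n r k : ℕ) (j : Fin k → ℕ) (sg : Fin k → ℝ) : ℝ :=
  nstar n r k j 0 ^ (1 - 2 * (r : ℤ)) + nstar n r k j k ^ (1 - 2 * (r : ℤ)) +
    ∑ i ∈ Finset.Ico 1 k,
      if sgext k sg i ≠ sgext k sg (i + 1) then nstar n r k j i ^ (1 - 2 * (r : ℤ)) else 0

/-- `Δ_r(θ)` defined from the knot data of `θ`. -/
def DeltaR (n r k : ℕ) (j : Fin k → ℕ) (sg : Fin k → ℝ) : ℝ :=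
  ((k : ℝ) + 1) / (n : ℝ) * Real.log (Real.exp 1 * (n : ℝ) / ((k : ℝ) + 1)) +
    deltaSq n r k j sg / (n : ℝ) * ((n : ℝ) / ((k : ℝ) + 1)) ^ (2 * (r : ℤ) - 1) *
      Real.log (Real.exp 1 * (n : ℝ) / ((k : ℝ) + 1)) +
    (Real.sqrt (deltaSq n r k j sg) / Real.sqrt (n : ℝ)) ^ ((1 : ℝ) / (r : ℝ))

/-- The minimum length condition with constant `c`: `n_i ≥ c n/(k+1)` for every `0 ≤ i ≤ k`
with `𝔯_i ≠ 𝔯_{i+1}` (where `𝔯_0 = 𝔯_{k+1} = 0`). -/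
def MinLen (n r k : ℕ) (j : Fin k → ℕ) (sg : Fin k → ℝ) (c : ℝ) : Prop :=
  ∀ i ≤ k, sgext k sg i ≠ sgext k sg (i + 1) →
    c * (n : ℝ) / ((k : ℝ) + 1) ≤ (nlen n r k j i : ℝ)

/-- The subdifferential of `g` at `θ`. -/
def subdiff {n : ℕ} (g : (Fin n → ℝ) → ℝ) (θ : Fin n → ℝ) : Set (Fin n → ℝ) :=
  {v | ∀ y, g θ + ∑ i, v i * (y i - θ i) ≤ g y}

/-- `v` is the minimum-norm element of `S`. -/
def IsMinNormIn {n : ℕ} (v : Fin n → ℝ) (S : Set (Fin n → ℝ)) : Prop :=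
  v ∈ S ∧ ∀ w ∈ S, eunorm v ≤ eunorm w

/-- `c • S`. -/
def scaleSet {n : ℕ} (c : ℝ) (S : Set (Fin n → ℝ)) : Set (Fin n → ℝ) := (c • ·) '' S

/-- The cone generated by `S`: `⋃_{c ≥ 0} c • S`. -/
def coneOf {n : ℕ} (S : Set (Fin n → ℝ)) : Set (Fin n → ℝ) := ⋃ c ∈ Set.Ici (0 : ℝ), scaleSet c S

/-- Euclidean distance from a point to a set. -/
def distSet {n : ℕ} (z : Fin n → ℝ) (S : Set (Fin n → ℝ)) : ℝ :=
  sInf ((fun v => eunorm (z - v)) '' S)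

/-- Gaussian mean squared distance `D(S) = E dist²(Z, S)`, `Z ∼ N_n(0, I_n)`. -/
def gaussMSD {n : ℕ} (S : Set (Fin n → ℝ)) : ℝ := ∫ z, distSet z S ^ 2 ∂gaussVec n 1

/-- `lam z` is, for each `z`, the minimizer over `λ ≥ 0` of `dist(z, λ S)`. -/
def IsLamFun {n : ℕ} (S : Set (Fin n → ℝ)) (lam : (Fin n → ℝ) → ℝ) : Prop :=
  ∀ z, 0 ≤ lam z ∧ ∀ μ : ℝ, 0 ≤ μ → distSet z (scaleSet (lam z) S) ≤ distSet z (scaleSet μ S)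

/-- Euclidean covering number of `K` at scale `ε`. -/
def covN {n : ℕ} (ε : ℝ) (K : Set (Fin n → ℝ)) : ℕ :=
  sInf {m : ℕ | ∃ a : Fin m → Fin n → ℝ, ∀ x ∈ K, ∃ i, eunorm (x - a i) ≤ ε}

/-- `K` `t`-shatters the (finite) index set `A`. -/
def fatShatters {n : ℕ} (K : Set (Fin n → ℝ)) (t : ℝ) (A : Finset (Fin n)) : Prop :=
  ∃ h : Fin n → ℝ, ∀ S : Finset (Fin n), S ⊆ A →
    ∃ θ ∈ K, (∀ i ∈ S, θ i ≤ h i) ∧ ∀ i ∈ A, i ∉ S → h i + t ≤ θ i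

/-- The fat shattering dimension `v(K, t)`. -/
def fatDim {n : ℕ} (K : Set (Fin n → ℝ)) (t : ℝ) : ℕ :=
  sSup {m : ℕ | ∃ A : Finset (Fin n), A.card = m ∧ fatShatters K t A}

/-- The tangent cone of `K` at `θ`. -/
def tanCone {n : ℕ} (K : Set (Fin n → ℝ)) (θ : Fin n → ℝ) : Set (Fin n → ℝ) :=
  closure {w | ∃ t : ℝ, 0 ≤ t ∧ ∃ η ∈ K, w = t • (η - θ)}

/-- `V_{a,b}(f) = Σ_{m=a+1}^{b} |f_m - f_{m-1}|` for the (paper 1-indexed) sequence whose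
`m`-th entry is `f (m-1)`. -/
def Vab (f : ℕ → ℝ) (a b : ℕ) : ℝ := ∑ t ∈ Finset.Ico (a - 1) (b - 1), |f (t + 1) - f t|

/-- `Acoef r n v j = Σ_{i=j}^n C(r+i-j-1, r-1) v_i` (paper 1-indexed). -/
def Acoef (r n : ℕ) (v : Fin n → ℝ) (jj : ℕ) : ℝ :=
  ∑ i : Fin n, (if jj ≤ i.1 + 1 then ((r + (i.1 + 1) - jj - 1).choose (r - 1) : ℝ) else 0) * v i

/-- The class `C_r({a_i}, {s_i})`. -/
def Cras (r n : ℕ) (a s : ℕ → ℝ) : Set (Fin n → ℝ) :=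
  {θ | (∀ i < r - 1, a i ≤ DD i θ 0 ∧ DD i θ 0 ≤ a i + s i) ∧
    a (r - 1) ≤ DD (r - 1) θ 0 ∧
    (∀ t : ℕ, t + 1 ≤ n - r → DD (r - 1) θ t ≤ DD (r - 1) θ (t + 1)) ∧
    DD (r - 1) θ (n - r) ≤ a (r - 1) + s (r - 1)}

/-- The class `C_r(a, V) = {θ : a ≤ (D^{(r-1)}θ)_1 ≤ ⋯ ≤ (D^{(r-1)}θ)_{n-r+1} ≤ a + V}`. -/
def CrMono (r n : ℕ) (a V : ℝ) : Set (Fin n → ℝ) :=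
  {θ | a ≤ DD (r - 1) θ 0 ∧
    (∀ t : ℕ, t + 1 ≤ n - r → DD (r - 1) θ t ≤ DD (r - 1) θ (t + 1)) ∧
    DD (r - 1) θ (n - r) ≤ a + V}


lemma gv_eq (n : ℕ) : gaussVec n 1 = Measure.pi (fun _ : Fin n => gaussianReal 0 1) := by
  simp [gaussVec]

instance gv_prob (n : ℕ) (σ : ℝ) : IsProbabilityMeasure (gaussVec n σ) := by
  unfold gaussVec; infer_instance

lemma gv_map_toLp (n : ℕ) :
    (gaussVec n 1).map (WithLp.toLp 2) = stdGaussian (EuclideanSpace ℝ (Fin n)) := by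
  rw [gv_eq]; exact map_pi_eq_stdGaussian

lemma gv_eq_map (n : ℕ) :
    gaussVec n 1 = (stdGaussian (EuclideanSpace ℝ (Fin n))).map (EuclideanSpace.equiv (Fin n) ℝ) := by
  rw [← gv_map_toLp, Measure.map_map (by fun_prop) (by fun_prop)]
  have : (EuclideanSpace.equiv (Fin n) ℝ) ∘ (WithLp.toLp 2) = (id : (Fin n → ℝ) → (Fin n → ℝ)) := by
    ext x; rfl
  rw [this, Measure.map_id]

instance gv_gauss (n : ℕ) : IsGaussian (gaussVec n 1) := by
  rw [gv_eq_map]; infer_instance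

lemma gv_mean (n : ℕ) : (gaussVec n 1)[id] = 0 := by
  rw [gv_eq_map, integral_map (by fun_prop) (by fun_prop)]
  have := (EuclideanSpace.equiv (Fin n) ℝ).toContinuousLinearMap.integral_comp_id_comm
    (μ := stdGaussian (EuclideanSpace ℝ (Fin n))) IsGaussian.integrable_id
  rw [integral_id_stdGaussian] at this
  simpa using this

lemma gv_integrable_dual_sq (n : ℕ) (L : (Fin n → ℝ) →L[ℝ] ℝ) :
    Integrable (fun z => (L z) ^ 2) (gaussVec n 1) :=
  (L.comp_memLp' (IsGaussian.memLp_two_id (μ := gaussVec n 1))).integrable_sq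

def linF {n : ℕ} (a : Fin n → ℝ) : (Fin n → ℝ) →L[ℝ] ℝ :=
  ∑ i, a i • ContinuousLinearMap.proj (R := ℝ) (φ := fun _ : Fin n => ℝ) i

lemma linF_apply {n : ℕ} (a z : Fin n → ℝ) : linF a z = ∑ i, a i * z i := by
  simp [linF]

lemma gv_lin_integrable {n : ℕ} (a : Fin n → ℝ) :
    Integrable (fun z => (∑ i, a i * z i) ^ 2) (gaussVec n 1) := by
  simpa [linF_apply] using gv_integrable_dual_sq n (linF a)

lemma gv_lin_int {n : ℕ} (a : Fin n → ℝ) :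
    ∫ z, (∑ i, a i * z i) ^ 2 ∂(gaussVec n 1) = ∑ i, a i ^ 2 := by
  have h1 := variance_dual_stdGaussian (E := EuclideanSpace ℝ (Fin n)) (innerSL ℝ (WithLp.toLp 2 a))
  rw [variance_of_integral_eq_zero (by fun_prop) (integral_strongDual_stdGaussian _)] at h1
  rw [← gv_map_toLp, integral_map (by fun_prop) (by fun_prop)] at h1
  rw [innerSL_apply_norm, EuclideanSpace.real_norm_sq_eq] at h1
  rw [← h1]
  congr 1
  ext z
  simp [innerSL_apply_apply, PiLp.inner_apply, mul_comm]

lemma gv_ac (n : ℕ) : gaussVec n 1 ≪ (volume : Measure (Fin n → ℝ)) := by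
  rw [gv_eq]
  induction n with
  | zero =>
    rw [volume_pi]
    have : (fun i : Fin 0 => gaussianReal 0 1) = fun i : Fin 0 => (volume : Measure ℝ) := by
      ext i; exact i.elim0
    rw [this]
  | succ n ih =>
    have h1 := (measurePreserving_piFinSuccAbove (fun _ : Fin (n+1) => gaussianReal 0 1) 0)
    have h2 := (measurePreserving_piFinSuccAbove (fun _ : Fin (n+1) => (volume : Measure ℝ)) 0)
    rw [volume_pi, ← h1.symm.map_eq, ← h2.symm.map_eq]
    refine Measure.AbsolutelyContinuous.map ?_ (MeasurableEquiv.measurable _)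
    refine Measure.AbsolutelyContinuous.prod ?_ ?_
    · exact gaussianReal_absolutelyContinuous 0 (by simp)
    · simpa [volume_pi] using ih

lemma sqnorm_nonneg {n : ℕ} (x : Fin n → ℝ) : 0 ≤ sqnorm x :=
  Finset.sum_nonneg fun i _ => sq_nonneg _

lemma eunorm_eq {n : ℕ} (x : Fin n → ℝ) : eunorm x = ‖(WithLp.toLp 2 x : EuclideanSpace ℝ (Fin n))‖ := by
  rw [eunorm, sqnorm, EuclideanSpace.norm_eq]
  simp

lemma eunorm_nonneg {n : ℕ} (x : Fin n → ℝ) : 0 ≤ eunorm x := Real.sqrt_nonneg _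

lemma eunorm_sq {n : ℕ} (x : Fin n → ℝ) : eunorm x ^ 2 = sqnorm x := Real.sq_sqrt (sqnorm_nonneg x)

lemma eunorm_add_le {n : ℕ} (x y : Fin n → ℝ) : eunorm (x + y) ≤ eunorm x + eunorm y := by
  simp only [eunorm_eq, WithLp.toLp_add]; exact norm_add_le _ _

lemma eunorm_smul {n : ℕ} (c : ℝ) (x : Fin n → ℝ) : eunorm (c • x) = |c| * eunorm x := by
  simp only [eunorm_eq, WithLp.toLp_smul]; rw [norm_smul, Real.norm_eq_abs]

lemma eunorm_sub_comm {n : ℕ} (x y : Fin n → ℝ) : eunorm (x - y) = eunorm (y - x) := by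
  simp only [eunorm_eq, WithLp.toLp_sub]; exact norm_sub_rev _ _

lemma inner_le_eunorm {n : ℕ} (x y : Fin n → ℝ) : ∑ i, x i * y i ≤ eunorm x * eunorm y := by
  have := real_inner_le_norm (WithLp.toLp 2 x : EuclideanSpace ℝ (Fin n)) (WithLp.toLp 2 y)
  rw [← eunorm_eq, ← eunorm_eq] at this
  refine le_trans (le_of_eq ?_) this
  simp [PiLp.inner_apply, mul_comm]

lemma continuous_eunorm {n : ℕ} : Continuous (eunorm : (Fin n → ℝ) → ℝ) := by
  unfold eunorm sqnorm; fun_prop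

lemma continuous_sqnorm {n : ℕ} : Continuous (sqnorm : (Fin n → ℝ) → ℝ) := by
  unfold sqnorm; fun_prop

lemma gv_sqnorm_integrable (n : ℕ) : Integrable (fun z => sqnorm z) (gaussVec n 1) := by
  unfold sqnorm
  refine integrable_finsetSum _ fun i _ => ?_
  simpa using gv_integrable_dual_sq n (ContinuousLinearMap.proj (R := ℝ) (φ := fun _ : Fin n => ℝ) i)

/-- Euclidean Lipschitz. -/
def ELip {n : ℕ} (K : ℝ) (F : (Fin n → ℝ) → ℝ) : Prop :=
  ∀ x y, |F x - F y| ≤ K * eunorm (x - y)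

lemma eunorm_le_sup {n : ℕ} (x : Fin n → ℝ) : eunorm x ≤ Real.sqrt n * ‖x‖ := by
  rw [eunorm, ← Real.sqrt_sq (norm_nonneg x), ← Real.sqrt_mul (Nat.cast_nonneg n)]
  apply Real.sqrt_le_sqrt
  calc sqnorm x ≤ ∑ i : Fin n, ‖x‖ ^ 2 := Finset.sum_le_sum fun i _ => by
        have := norm_le_pi_norm x i
        rw [← sq_abs]; exact pow_le_pow_left₀ (abs_nonneg _) this 2
    _ = _ := by simp

lemma ELip.lipschitz {n : ℕ} {K : ℝ} {F : (Fin n → ℝ) → ℝ} (hK : 0 ≤ K) (h : ELip K F) :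
    LipschitzWith (Real.toNNReal (K * Real.sqrt n)) F := by
  refine LipschitzWith.of_dist_le_mul fun x y => ?_
  rw [Real.coe_toNNReal _ (by positivity), Real.dist_eq, dist_eq_norm, mul_assoc]
  exact (h x y).trans (mul_le_mul_of_nonneg_left (eunorm_le_sup _) hK)

lemma ELip.continuous {n : ℕ} {K : ℝ} {F : (Fin n → ℝ) → ℝ} (hK : 0 ≤ K) (h : ELip K F) :
    Continuous F := (h.lipschitz hK).continuous

def XR {n : ℕ} (t : ℝ) (p : (Fin n → ℝ) × (Fin n → ℝ)) : Fin n → ℝ :=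
  Real.cos t • p.1 + Real.sin t • p.2

lemma XR_cont {n : ℕ} (t : ℝ) : Continuous (XR (n := n) t) := by unfold XR; fun_prop

lemma XR_rot {n : ℕ} (a h : ℝ) (p : (Fin n → ℝ) × (Fin n → ℝ)) :
    XR h (ContinuousLinearMap.rotation a p) = XR (a + h) p := by
  simp only [XR, ContinuousLinearMap.rotation_apply, Real.cos_add, Real.sin_add]
  ext i
  simp only [Pi.add_apply, Pi.smul_apply, smul_eq_mul, Pi.neg_apply, neg_smul]
  ring

lemma XR_zero {n : ℕ} (p : (Fin n → ℝ) × (Fin n → ℝ)) : XR 0 p = p.1 := by simp [XR]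

lemma rot_fst {n : ℕ} (a : ℝ) (p : (Fin n → ℝ) × (Fin n → ℝ)) :
    (ContinuousLinearMap.rotation a p).1 = XR a p := by
  simp [XR, ContinuousLinearMap.rotation_apply]

lemma sqnorm_add_le {n : ℕ} (x y : Fin n → ℝ) : sqnorm (x + y) ≤ 2 * sqnorm x + 2 * sqnorm y := by
  simp only [sqnorm, Finset.mul_sum, ← Finset.sum_add_distrib]
  refine Finset.sum_le_sum fun i _ => ?_
  simp only [Pi.add_apply]
  nlinarith [sq_nonneg (x i - y i)]

lemma sqnorm_smul {n : ℕ} (c : ℝ) (x : Fin n → ℝ) : sqnorm (c • x) = c ^ 2 * sqnorm x := by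
  simp only [sqnorm, Finset.mul_sum, Pi.smul_apply, smul_eq_mul, mul_pow]

lemma ELip.sq_le {n : ℕ} {K : ℝ} {F : (Fin n → ℝ) → ℝ} (h : ELip K F) (x y : Fin n → ℝ) :
    (F x - F y) ^ 2 ≤ K ^ 2 * sqnorm (x - y) := by
  have := h x y
  rw [← sq_abs, ← eunorm_sq, ← mul_pow]
  exact pow_le_pow_left₀ (abs_nonneg _) this 2

lemma XR_bd {n : ℕ} {K : ℝ} {F : (Fin n → ℝ) → ℝ} (h : ELip K F) {t : ℝ} (ht0 : 0 ≤ t)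
    (ht : t ≤ 2) (p : (Fin n → ℝ) × (Fin n → ℝ)) :
    (F p.1 - F (XR t p)) ^ 2 ≤ t ^ 2 * (2 * K ^ 2 * (sqnorm p.1 + sqnorm p.2)) := by
  refine (h.sq_le _ _).trans ?_
  have e : p.1 - XR t p = (1 - Real.cos t) • p.1 + (- Real.sin t) • p.2 := by
    simp only [XR]; module
  have h1 : (1 - Real.cos t) ^ 2 ≤ t ^ 2 := by
    have := Real.one_sub_sq_div_two_le_cos (x := t)
    have h2 := Real.cos_le_one t
    apply pow_le_pow_left₀ (by linarith)
    nlinarith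
  have h2 : (- Real.sin t) ^ 2 ≤ t ^ 2 := by
    rw [neg_sq, ← sq_abs, ← sq_abs t]
    exact pow_le_pow_left₀ (abs_nonneg _) (Real.abs_sin_le_abs) 2
  have h3 : sqnorm (p.1 - XR t p) ≤ 2 * (t ^ 2 * sqnorm p.1) + 2 * (t ^ 2 * sqnorm p.2) := by
    rw [e]
    refine (sqnorm_add_le _ _).trans ?_
    rw [sqnorm_smul, sqnorm_smul]
    have := sqnorm_nonneg p.1
    have := sqnorm_nonneg p.2
    gcongr
  calc K ^ 2 * sqnorm (p.1 - XR t p) ≤ K ^ 2 * (2 * (t ^ 2 * sqnorm p.1) + 2 * (t ^ 2 * sqnorm p.2)) := by gcongr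
    _ = _ := by ring

lemma dom_integrable (n : ℕ) (K : ℝ) :
    Integrable (fun p : (Fin n → ℝ) × (Fin n → ℝ) => (K * (sqnorm p.1 + sqnorm p.2)))
      ((gaussVec n 1).prod (gaussVec n 1)) := by
  refine Integrable.const_mul (Integrable.add ?_ ?_) _
  · exact (gv_sqnorm_integrable n).comp_fst _
  · exact (gv_sqnorm_integrable n).comp_snd _

lemma G_integrable {n : ℕ} {K : ℝ} (hK : 0 ≤ K) {F : (Fin n → ℝ) → ℝ} (h : ELip K F) {t : ℝ} (ht0 : 0 ≤ t)
    (ht : t ≤ 2) :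
    Integrable (fun p => (F p.1 - F (XR t p)) ^ 2) ((gaussVec n 1).prod (gaussVec n 1)) := by
  have hc := h.continuous hK
  have := XR_cont (n := n) t
  refine Integrable.mono' ((dom_integrable n (2 * K ^ 2)).const_mul (t ^ 2))
    (Continuous.aestronglyMeasurable (by fun_prop)) (Filter.Eventually.of_forall fun p => ?_)
  rw [Real.norm_of_nonneg (sq_nonneg _)]
  exact XR_bd h ht0 ht p

lemma tele_sq (g : ℕ → ℝ) (N : ℕ) :
    (g 0 - g N) ^ 2 ≤ N * ∑ i ∈ Finset.range N, (g i - g (i + 1)) ^ 2 := by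
  have : g 0 - g N = ∑ i ∈ Finset.range N, (g i - g (i + 1)) := by
    rw [Finset.sum_range_sub']
  rw [this]
  simpa using sq_sum_le_card_mul_sum_sq (s := Finset.range N) (f := fun i => g i - g (i + 1))

lemma poin_N {n : ℕ} {K : ℝ} (hK : 0 ≤ K) {F : (Fin n → ℝ) → ℝ} (hF : ELip K F) (N : ℕ) :
    ∫ p, (F p.1 - F p.2) ^ 2 ∂((gaussVec n 1).prod (gaussVec n 1)) ≤
      ∫ p, ((N + 1 : ℝ) ^ 2 * (F p.1 - F (XR (Real.pi / 2 * (1 / (N + 1))) p)) ^ 2)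
        ∂((gaussVec n 1).prod (gaussVec n 1)) := by
  set h : ℝ := Real.pi / 2 * (1 / (N + 1)) with hh
  have hpi := Real.pi_pos
  have hpi4 := Real.pi_le_four
  have hN : (0 : ℝ) < N + 1 := by positivity
  have hh0 : 0 ≤ h := by positivity
  have hh2 : h ≤ 2 := by
    have : (1 : ℝ) / (N + 1) ≤ 1 := by
      rw [div_le_one hN]; linarith [Nat.cast_nonneg (α := ℝ) N]
    have h0 : (0 : ℝ) ≤ 1 / (N + 1) := by positivity
    calc h ≤ Real.pi / 2 * 1 := by rw [hh]; gcongr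
      _ ≤ 2 := by linarith
  have hNh : (N + 1 : ℝ) * h = Real.pi / 2 := by rw [hh]; field_simp
  have hc := hF.continuous hK
  have key : ∀ a : ℝ, Integrable (fun p => (F (XR a p) - F (XR (a + h) p)) ^ 2)
      ((gaussVec n 1).prod (gaussVec n 1)) ∧
      ∫ p, (F (XR a p) - F (XR (a + h) p)) ^ 2 ∂((gaussVec n 1).prod (gaussVec n 1)) =
      ∫ p, (F p.1 - F (XR h p)) ^ 2 ∂((gaussVec n 1).prod (gaussVec n 1)) := by
    intro a
    have hrot := IsGaussian.map_rotation_eq_self (μ := gaussVec n 1) (gv_mean n) a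
    have e : (fun p => (F (XR a p) - F (XR (a + h) p)) ^ 2) =
        (fun p => (F p.1 - F (XR h p)) ^ 2) ∘ (ContinuousLinearMap.rotation a) := by
      ext p; simp only [Function.comp, XR_rot, rot_fst]
    have hi := G_integrable hK hF hh0 hh2
    have hm : AEMeasurable (ContinuousLinearMap.rotation (E := Fin n → ℝ) a)
      ((gaussVec n 1).prod (gaussVec n 1)) := by fun_prop
    constructor
    · rw [e]
      rw [← hrot] at hi
      exact hi.comp_aemeasurable hm
    · conv_rhs => rw [← hrot]
      rw [integral_map hm (by rw [hrot]; exact hi.aestronglyMeasurable)]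
      rw [e]; rfl
  have step : ∀ p : (Fin n → ℝ) × (Fin n → ℝ), (F p.1 - F p.2) ^ 2 ≤
      (N + 1 : ℝ) * ∑ i ∈ Finset.range (N + 1), (F (XR (i * h) p) - F (XR (i * h + h) p)) ^ 2 := by
    intro p
    have := tele_sq (fun i : ℕ => F (XR (i * h) p)) (N + 1)
    simp only [Nat.cast_add, Nat.cast_one, Nat.cast_zero, zero_mul, XR_zero, hNh] at this
    have e2 : XR (Real.pi / 2) p = p.2 := by simp [XR]
    rw [e2] at this
    simpa [add_mul] using this
  have hIntA : Integrable (fun p => ∑ i ∈ Finset.range (N + 1), (F (XR (i * h) p) - F (XR (i * h + h) p)) ^ 2) ((gaussVec n 1).prod (gaussVec n 1)) :=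
    integrable_finsetSum _ fun i _ => (key _).1
  calc _ ≤ ∫ p, (N + 1 : ℝ) * ∑ i ∈ Finset.range (N + 1), (F (XR (i * h) p) - F (XR (i * h + h) p)) ^ 2 ∂((gaussVec n 1).prod (gaussVec n 1)) :=
        integral_mono_of_nonneg (Filter.Eventually.of_forall fun p => sq_nonneg _) (hIntA.const_mul _)
          (Filter.Eventually.of_forall step)
    _ = _ := by
        rw [integral_const_mul, integral_finsetSum _ fun i _ => (key _).1]
        simp only [(key _).2]
        rw [integral_const_mul]
        simp; ring

lemma fderiv_bd {n : ℕ} {K : ℝ} {F : (Fin n → ℝ) → ℝ} (hK : 0 ≤ K) (hF : ELip K F) (x : Fin n → ℝ)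
    (hd : DifferentiableAt ℝ F x) :
    ∫ y, (fderiv ℝ F x y) ^ 2 ∂gaussVec n 1 ≤ K ^ 2 := by
  set L := fderiv ℝ F x with hL
  set a : Fin n → ℝ := fun i => L (Pi.single i 1) with ha
  have hLa : ∀ y, L y = ∑ i, a i * y i := by
    intro y
    have : y = ∑ i, y i • (Pi.single i (1 : ℝ) : Fin n → ℝ) := by
      ext j; simp [Finset.sum_apply, Pi.single_apply]
    conv_lhs => rw [this]
    simp [ha, mul_comm]
  have hb : ∀ y, L y ≤ K * eunorm y := by
    intro y
    have h1 : HasDerivAt (fun t : ℝ => F (x + t • y)) (L y) 0 := by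
      have := hd.hasFDerivAt.hasLineDerivAt y
      simpa [HasLineDerivAt] using this
    have h2 := (hasDerivAt_iff_tendsto_slope_zero.1 h1)
    have h3 : Filter.Tendsto (fun t : ℝ => t⁻¹ • (F (x + (0 + t) • y) - F (x + (0:ℝ) • y))) (nhdsWithin 0 (Set.Ioi 0)) (nhds (L y)) :=
      h2.mono_left (nhdsWithin_mono _ (fun t ht => ne_of_gt ht))
    refine le_of_tendsto h3 ?_
    filter_upwards [self_mem_nhdsWithin] with t ht
    have ht : (0 : ℝ) < t := ht
    have := (le_abs_self _).trans (hF (x + t • y) x)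
    rw [add_sub_cancel_left, eunorm_smul, abs_of_pos ht] at this
    simp only [zero_add, zero_smul, add_zero, smul_eq_mul]
    rw [inv_mul_le_iff₀ ht]
    linarith
  have h1 : ∑ i, a i ^ 2 ≤ K ^ 2 := by
    have h2 := hb a
    rw [hLa] at h2
    have h3 : ∑ i, a i * a i = eunorm a ^ 2 := by
      rw [eunorm_sq]; simp [sqnorm, sq]
    rw [h3] at h2
    have h4 : eunorm a ≤ K := by
      by_contra hcon
      push Not at hcon
      have : 0 < eunorm a := lt_of_le_of_lt hK hcon
      nlinarith
    calc ∑ i, a i ^ 2 = eunorm a ^ 2 := by rw [eunorm_sq]; rfl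
      _ ≤ K ^ 2 := pow_le_pow_left₀ (eunorm_nonneg _) h4 2
  simp only [hLa]
  rw [gv_lin_int]
  exact h1

lemma poin_prod {n : ℕ} {K : ℝ} (hK : 0 ≤ K) {F : (Fin n → ℝ) → ℝ} (hF : ELip K F) :
    ∫ p, (F p.1 - F p.2) ^ 2 ∂((gaussVec n 1).prod (gaussVec n 1)) ≤ 4 * K ^ 2 := by
  have hpi := Real.pi_pos
  have hpi4 := Real.pi_le_four
  have hc := hF.continuous hK
  set lim : (Fin n → ℝ) × (Fin n → ℝ) → ℝ := fun p => (Real.pi / 2 * fderiv ℝ F p.1 p.2) ^ 2 with hlim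
  have hae0 : ∀ᵐ x ∂(gaussVec n 1), DifferentiableAt ℝ F x :=
    (gv_ac n).ae_le (hF.lipschitz hK).ae_differentiableAt
  have hae : ∀ᵐ p ∂((gaussVec n 1).prod (gaussVec n 1)), DifferentiableAt ℝ F p.1 :=
    Measure.quasiMeasurePreserving_fst.ae hae0
  have hT : Filter.Tendsto (fun N : ℕ => ∫ p, ((N + 1 : ℝ) ^ 2 * (F p.1 - F (XR (Real.pi / 2 * (1 / (N + 1))) p)) ^ 2)
        ∂((gaussVec n 1).prod (gaussVec n 1))) Filter.atTop
        (nhds (∫ p, lim p ∂((gaussVec n 1).prod (gaussVec n 1)))) := by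
    refine tendsto_integral_of_dominated_convergence _ (fun N => ?_) (dom_integrable n (8 * K ^ 2)) (fun N => ?_) ?_
    · have := XR_cont (n := n) (Real.pi / 2 * (1 / (N + 1)))
      exact Continuous.aestronglyMeasurable (by fun_prop)
    · refine Filter.Eventually.of_forall fun p => ?_
      have hN : (0 : ℝ) < N + 1 := by positivity
      have h1 : Real.pi / 2 * (1 / (N + 1 : ℝ)) ≤ 2 := by
        have : (1 : ℝ) / (N + 1) ≤ 1 := by
          rw [div_le_one hN]; linarith [Nat.cast_nonneg (α := ℝ) N]
        have h0 : (0 : ℝ) ≤ 1 / (N + 1) := by positivity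
        nlinarith
      have h2 := XR_bd hF (t := Real.pi / 2 * (1 / (N + 1 : ℝ))) (by positivity) h1 p
      rw [Real.norm_of_nonneg (by positivity)]
      have hs : 0 ≤ sqnorm p.1 + sqnorm p.2 := add_nonneg (sqnorm_nonneg _) (sqnorm_nonneg _)
      calc _ ≤ (N + 1 : ℝ) ^ 2 * ((Real.pi / 2 * (1 / (N + 1 : ℝ))) ^ 2 * (2 * K ^ 2 * (sqnorm p.1 + sqnorm p.2))) := by gcongr
        _ = (Real.pi / 2) ^ 2 * (2 * K ^ 2 * (sqnorm p.1 + sqnorm p.2)) := by field_simp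
        _ ≤ 2 ^ 2 * (2 * K ^ 2 * (sqnorm p.1 + sqnorm p.2)) := by
            gcongr; linarith
        _ = _ := by ring
    · filter_upwards [hae] with p hp
      have h1 : HasDerivAt (fun s : ℝ => F (XR (Real.pi / 2 * s) p)) (Real.pi / 2 * fderiv ℝ F p.1 p.2) 0 := by
        have hx : HasDerivAt (fun s : ℝ => XR (Real.pi / 2 * s) p) ((Real.pi / 2) • p.2) 0 := by
          have e1 : HasDerivAt (fun s : ℝ => Real.pi / 2 * s) (Real.pi / 2) 0 := by
            simpa using (hasDerivAt_id (0:ℝ)).const_mul (Real.pi / 2)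
          have e2 := (e1.cos.smul_const p.1).add (e1.sin.smul_const p.2)
          have e3 : (Real.pi / 2) • p.2 = (-Real.sin (Real.pi / 2 * 0) * (Real.pi / 2)) • p.1 + (Real.cos (Real.pi / 2 * 0) * (Real.pi / 2)) • p.2 := by simp
          rw [e3]
          exact e2
        have hp' : HasFDerivAt F (fderiv ℝ F p.1) (XR (Real.pi / 2 * 0) p) := by
          rw [mul_zero, XR_zero]; exact hp.hasFDerivAt
        have := hp'.comp_hasDerivAt (0 : ℝ) hx
        simpa [Function.comp_def] using this
      have h2 := hasDerivAt_iff_tendsto_slope_zero.1 h1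
      have h3 : Filter.Tendsto (fun N : ℕ => (1 : ℝ) / (N + 1)) Filter.atTop (nhdsWithin 0 {0}ᶜ) :=
        tendsto_nhdsWithin_iff.2 ⟨tendsto_one_div_add_atTop_nhds_zero_nat,
          Filter.Eventually.of_forall fun N => by
            have : (0 : ℝ) < 1 / (N + 1) := by positivity
            exact ne_of_gt this⟩
      have h4 := (h2.comp h3).pow 2
      refine h4.congr fun N => ?_
      simp only [Function.comp, zero_add, mul_zero, XR_zero, smul_eq_mul, one_div, inv_inv]
      ring
  refine (ge_of_tendsto' hT fun N => poin_N hK hF N).trans ?_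
  by_cases hi : Integrable lim ((gaussVec n 1).prod (gaussVec n 1))
  · rw [integral_prod _ hi]
    calc _ ≤ ∫ x, (4 * K ^ 2) ∂(gaussVec n 1) := by
          refine integral_mono_ae hi.integral_prod_left (integrable_const _) ?_
          filter_upwards [hae0] with x hx
          simp only [hlim, mul_pow]
          rw [integral_const_mul]
          have := fderiv_bd hK hF x hx
          have h0 : 0 ≤ ∫ y, (fderiv ℝ F x y) ^ 2 ∂gaussVec n 1 := integral_nonneg fun _ => sq_nonneg _
          have h5 : (Real.pi / 2) ^ 2 ≤ 4 := by nlinarith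
          nlinarith [sq_nonneg K]
      _ = _ := by simp
  · rw [integral_undef hi]; positivity

lemma ELip.memLp {n : ℕ} {K : ℝ} {F : (Fin n → ℝ) → ℝ} (hK : 0 ≤ K) (hF : ELip K F) :
    MemLp F 2 (gaussVec n 1) := by
  have hc := hF.continuous hK
  rw [memLp_two_iff_integrable_sq hc.aestronglyMeasurable]
  have h1 : Integrable (fun z => 2 * F 0 ^ 2 + 2 * K ^ 2 * sqnorm z) (gaussVec n 1) :=
    (integrable_const _).add ((gv_sqnorm_integrable n).const_mul _)
  refine h1.mono' (hc.pow 2).aestronglyMeasurable (Filter.Eventually.of_forall fun z => ?_)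
  rw [Real.norm_of_nonneg (sq_nonneg _)]
  have := hF.sq_le z 0
  rw [sub_zero] at this
  nlinarith [sq_nonneg (F z - 2 * F 0)]

lemma poincare {n : ℕ} {K : ℝ} {F : (Fin n → ℝ) → ℝ} (hK : 0 ≤ K) (hF : ELip K F) :
    ∫ x, (F x - ∫ y, F y ∂gaussVec n 1) ^ 2 ∂gaussVec n 1 ≤ 4 * K ^ 2 := by
  have hm := hF.memLp hK
  have hi : Integrable F (gaussVec n 1) := hm.integrable (by norm_num)
  have hsq := hm.integrable_sq
  have h := poin_prod hK hF
  set m := ∫ y, F y ∂gaussVec n 1 with hmdef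
  have e1 : Integrable (fun p : (Fin n → ℝ) × (Fin n → ℝ) => F p.1 ^ 2 + F p.2 ^ 2)
      ((gaussVec n 1).prod (gaussVec n 1)) := (hsq.comp_fst _).add (hsq.comp_snd _)
  have e2 : Integrable (fun p : (Fin n → ℝ) × (Fin n → ℝ) => F p.1 * F p.2)
      ((gaussVec n 1).prod (gaussVec n 1)) := hi.mul_prod hi
  have e3 : ∫ p, (F p.1 - F p.2) ^ 2 ∂((gaussVec n 1).prod (gaussVec n 1)) =
      2 * ∫ x, F x ^ 2 ∂gaussVec n 1 - 2 * m ^ 2 := by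
    have : ∀ p : (Fin n → ℝ) × (Fin n → ℝ), (F p.1 - F p.2) ^ 2 = (F p.1 ^ 2 + F p.2 ^ 2) - 2 * (F p.1 * F p.2) := by
      intro p; ring
    simp only [this]
    rw [integral_sub e1 (e2.const_mul _), integral_add (hsq.comp_fst _) (hsq.comp_snd _), integral_const_mul,
      integral_prod_mul, integral_fun_fst (f := fun x => F x ^ 2), integral_fun_snd (f := fun x => F x ^ 2)]
    simp
    ring
  have e4 : ∫ x, (F x - m) ^ 2 ∂gaussVec n 1 = ∫ x, F x ^ 2 ∂gaussVec n 1 - m ^ 2 := by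
    have : ∀ x, (F x - m) ^ 2 = F x ^ 2 - 2 * m * F x + m ^ 2 := by intro x; ring
    simp only [this]
    have e5 : Integrable (fun x => F x ^ 2 - 2 * m * F x) (gaussVec n 1) := hsq.sub (hi.const_mul _)
    rw [integral_add e5 (integrable_const _), integral_sub hsq (hi.const_mul _),
      integral_const_mul]
    simp
    ring
  rw [e3] at h
  rw [e4]
  nlinarith [sq_nonneg K]

lemma dseq_it_succ (l : ℕ) (f : ℕ → ℝ) (t : ℕ) :
    dseq^[l+1] f t = dseq^[l] f (t+1) - dseq^[l] f t := by
  rw [Function.iterate_succ_apply']; rfl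

lemma dseq_it_add (l : ℕ) (f g : ℕ → ℝ) (t : ℕ) :
    dseq^[l] (fun t => f t + g t) t = dseq^[l] f t + dseq^[l] g t := by
  induction l generalizing t with
  | zero => rfl
  | succ l ih => simp only [dseq_it_succ, ih]; ring

lemma dseq_it_smul (l : ℕ) (c : ℝ) (f : ℕ → ℝ) (t : ℕ) :
    dseq^[l] (fun t => c * f t) t = c * dseq^[l] f t := by
  induction l generalizing t with
  | zero => rfl
  | succ l ih => simp only [dseq_it_succ, ih]; ring

lemma dseq_it_sum {ι : Type*} (s : Finset ι) (l : ℕ) (f : ι → ℕ → ℝ) (t : ℕ) :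
    dseq^[l] (fun t => ∑ B ∈ s, f B t) t = ∑ B ∈ s, dseq^[l] (f B) t := by
  induction l generalizing t with
  | zero => rfl
  | succ l ih => simp only [dseq_it_succ, ih, Finset.sum_sub_distrib]

lemma dseq_it_shift (l : ℕ) (f : ℕ → ℝ) (t : ℕ) :
    dseq^[l] (fun t => f (t+1)) t = dseq^[l] f (t+1) := by
  induction l generalizing t with
  | zero => rfl
  | succ l ih => simp only [dseq_it_succ, ih]

lemma dseq_it_congr (l : ℕ) (f g : ℕ → ℝ) (t : ℕ) (h : ∀ i ≤ l, f (t+i) = g (t+i)) :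
    dseq^[l] f t = dseq^[l] g t := by
  induction l generalizing t with
  | zero => simpa using h 0 le_rfl
  | succ l ih =>
    rw [dseq_it_succ, dseq_it_succ, ih t (fun i hi => h i (by omega)), ih (t+1) (fun i hi => ?_)]
    have := h (i+1) (by omega)
    rwa [show t + 1 + i = t + (i+1) by ring]

lemma dseq_it_zero (l : ℕ) (t : ℕ) : dseq^[l] (fun _ => (0:ℝ)) t = 0 := by
  induction l generalizing t with
  | zero => rfl
  | succ l ih => rw [dseq_it_succ, ih, ih, sub_zero]

lemma dseq_it_eq_zero (l : ℕ) (f : ℕ → ℝ) (t : ℕ) (h : ∀ i ≤ l, f (t+i) = 0) :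
    dseq^[l] f t = 0 := by
  rw [dseq_it_congr l f (fun _ => 0) t h, dseq_it_zero]

/-- smoothness class -/
def Cl (r : ℕ) (A h : ℝ) (f : ℕ → ℝ) : Prop := ∀ l ≤ r, ∀ t, |dseq^[l] f t| ≤ A * h ^ l

lemma Cl.mul_aux (l : ℕ) : ∀ (A B h h' : ℝ) (f g : ℕ → ℝ), Cl l A h f → Cl l B h' g →
    ∀ t, |dseq^[l] (fun t => f t * g t) t| ≤ A * B * (h + h') ^ l := by
  induction l with
  | zero =>
    intro A B h h' f g hf hg t
    have h1 := hf 0 le_rfl t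
    have h2 := hg 0 le_rfl t
    simp only [Function.iterate_zero, id, pow_zero, mul_one] at *
    rw [abs_mul]
    exact mul_le_mul h1 h2 (abs_nonneg _) ((abs_nonneg _).trans h1)
  | succ l ih =>
    intro A B h h' f g hf hg t
    have e : dseq^[l+1] (fun t => f t * g t) t =
        dseq^[l] (fun t => f (t+1) * dseq g t) t + dseq^[l] (fun t => dseq f t * g t) t := by
      rw [← dseq_it_add, Function.iterate_succ_apply]
      refine congrFun (congrArg _ ?_) t
      ext t
      simp only [dseq]; ring
    rw [e]
    have h1 := ih A (B * h') h h' (fun t => f (t+1)) (dseq g)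
      (fun m hm t => by rw [dseq_it_shift]; exact hf m (by omega) _)
      (fun m hm t => by
        have := hg (m+1) (by omega) t
        rw [Function.iterate_succ_apply] at this
        refine this.trans (le_of_eq (by ring))) t
    have h2 := ih (A * h) B h h' (dseq f) g
      (fun m hm t => by
        have := hf (m+1) (by omega) t
        rw [Function.iterate_succ_apply] at this
        refine this.trans (le_of_eq (by ring)))
      (fun m hm t => hg m (by omega) _) t
    refine (abs_add_le _ _).trans ((add_le_add h1 h2).trans (le_of_eq (by ring)))

lemma Cl.mul {r : ℕ} {A B h h' : ℝ} {f g : ℕ → ℝ} (hf : Cl r A h f) (hg : Cl r B h' g) :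
    Cl r (A * B) (h + h') (fun t => f t * g t) := fun l hl t =>
  Cl.mul_aux l A B h h' f g (fun m hm => hf m (hm.trans hl)) (fun m hm => hg m (hm.trans hl)) t

lemma Cl.mono {r : ℕ} {A B h h' : ℝ} {f : ℕ → ℝ} (hf : Cl r A h f) (hA0 : 0 ≤ A) (hA : A ≤ B) (h0 : 0 ≤ h)
    (hh : h ≤ h') : Cl r B h' f := fun l hl t => (hf l hl t).trans (by have := hA0.trans hA; gcongr)

lemma Cl.affine {r : ℕ} {A h a b : ℝ} {f : ℕ → ℝ} (hf : Cl r A h f) (hh : 0 ≤ h) :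
    Cl r (|a| + |b| * A) h (fun t => a + b * f t) := by
  intro l hl t
  rw [dseq_it_add l (fun _ => a) (fun t => b * f t), dseq_it_smul]
  have h1 : |dseq^[l] (fun _ => a) t| ≤ |a| * h ^ l := by
    cases l with
    | zero => simp
    | succ l =>
      have : dseq^[l+1] (fun _ => a) t = 0 := by
        rw [Function.iterate_succ_apply]
        have : dseq (fun _ => a) = fun _ => 0 := by ext; simp [dseq]
        rw [this, dseq_it_zero]
      rw [this, abs_zero]; positivity
  calc _ ≤ |dseq^[l] (fun _ => a) t| + |b * dseq^[l] f t| := abs_add_le _ _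
    _ ≤ |a| * h ^ l + |b| * (A * h ^ l) := by
        rw [abs_mul]
        have := hf l hl t
        gcongr
    _ = _ := by ring

/-! ### sampled smooth functions -/
lemma fwd_bound (l : ℕ) : ∀ (f : ℝ → ℝ) (M : ℝ) (a : ℝ), ContDiff ℝ l f →
    (∀ x, |iteratedDeriv l f x| ≤ M) → ∀ x, |(fwdDiff a)^[l] f x| ≤ M * |a| ^ l := by
  induction l with
  | zero => intro f M a hf hM x; simpa using hM x
  | succ l ih =>
    intro f M a hf hM x
    rw [Function.iterate_succ_apply]
    have hf' : ContDiff ℝ l f := hf.of_le (by exact_mod_cast Nat.le_succ l)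
    have hfs : ContDiff ℝ l (fun x => f (x + a)) := hf'.comp (contDiff_id.add contDiff_const)
    have e : fwdDiff a f = (fun x => f (x + a)) - f := by ext x; simp [fwdDiff]
    have := ih (fwdDiff a f) (M * |a|) a (by rw [e]; exact hfs.sub hf') ?_ x
    · exact this.trans (le_of_eq (by ring))
    · intro y
      rw [e, iteratedDeriv_sub hfs.contDiffAt hf'.contDiffAt, iteratedDeriv_comp_add_const]
      have hd : Differentiable ℝ (iteratedDeriv l f) := hf.differentiable_iteratedDeriv l (by exact_mod_cast Nat.lt_succ_self l)
      have := Convex.norm_image_sub_le_of_norm_deriv_le (f := iteratedDeriv l f) (C := M) (s := Set.univ)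
        (x := y) (y := y + a) (fun x _ => hd x)
        (fun x _ => by rw [← iteratedDeriv_succ]; exact hM x) convex_univ trivial trivial
      simpa using this

lemma dseq_sample (l : ℕ) (f : ℝ → ℝ) (a b : ℝ) (t : ℕ) :
    dseq^[l] (fun t : ℕ => f (a * t + b)) t = (fwdDiff a)^[l] f (a * t + b) := by
  induction l generalizing t with
  | zero => rfl
  | succ l ih =>
    rw [dseq_it_succ, ih, ih, Function.iterate_succ_apply', fwdDiff]
    congr 2
    push_cast; ring_nf

lemma smooth_bd (l : ℕ) : ∃ M, 0 ≤ M ∧ ∀ x, |iteratedDeriv l Real.smoothTransition x| ≤ M := by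
  have hc : Continuous (iteratedDeriv l Real.smoothTransition) :=
    (Real.smoothTransition.contDiff (n := (l : ℕ∞))).continuous_iteratedDeriv l le_rfl
  obtain ⟨M, hM⟩ := (isCompact_Icc (a := (-1:ℝ)) (b := 2)).exists_bound_of_continuousOn hc.continuousOn
  have hcst : ∀ (c x : ℝ), |c| ≤ 1 → |iteratedDeriv l (fun _ : ℝ => c) x| ≤ 1 := by
    intro c x hc
    rw [iteratedDeriv_const]
    split_ifs <;> simp [hc]
  refine ⟨max M 1, le_max_of_le_right zero_le_one, fun x => ?_⟩
  by_cases h1 : x < -1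
  · have : Real.smoothTransition =ᶠ[nhds x] fun _ => 0 := by
      filter_upwards [Iio_mem_nhds h1] with y hy
      exact Real.smoothTransition.zero_of_nonpos (by have : y < -1 := hy; linarith)
    rw [this.iteratedDeriv_eq]
    exact (hcst 0 x (by simp)).trans (le_max_right _ _)
  · by_cases h2 : 2 < x
    · have : Real.smoothTransition =ᶠ[nhds x] fun _ => 1 := by
        filter_upwards [Ioi_mem_nhds h2] with y hy
        exact Real.smoothTransition.one_of_one_le (by have : 2 < y := hy; linarith)
      rw [this.iteratedDeriv_eq]
      exact (hcst 1 x (by simp)).trans (le_max_right _ _)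
    · exact (hM x ⟨by linarith, by linarith⟩).trans (le_max_left _ _)

lemma exists_CH (r : ℕ) : ∃ C : ℝ, 1 ≤ C ∧ ∀ a b h : ℝ, |a| ≤ h →
    Cl r C h (fun t : ℕ => Real.smoothTransition (a * t + b)) := by
  choose M hM0 hM using smooth_bd
  refine ⟨1 + ∑ l ∈ Finset.range (r+1), M l, ?_, ?_⟩
  · have := Finset.sum_nonneg (s := Finset.range (r+1)) (fun l _ => hM0 l)
    linarith
  · intro a b h hah l hl t
    rw [dseq_sample]
    have h1 := fwd_bound l Real.smoothTransition (M l) a (Real.smoothTransition.contDiff (n := (l : ℕ∞))) (hM l) (a * t + b)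
    refine h1.trans ?_
    have h2 : M l ≤ ∑ l ∈ Finset.range (r+1), M l :=
      Finset.single_le_sum (f := M) (fun l _ => hM0 l) (Finset.mem_range.2 (by omega))
    have := hM0 l
    refine mul_le_mul (by linarith) (pow_le_pow_left₀ (abs_nonneg _) hah l) (by positivity) (by linarith)

/-- sum of squares of the differences of a compactly supported sequence -/
lemma Cl.sum_sq {r : ℕ} {A h : ℝ} {f : ℕ → ℝ} (hf : Cl r A h f) (a b : ℕ)
    (hs : ∀ t, f t ≠ 0 → a ≤ t ∧ t < b) (n : ℕ) :
    ∑ t ∈ Finset.range n, (dseq^[r] f t) ^ 2 ≤ ((b - a : ℕ) + r : ℝ) * (A * h ^ r) ^ 2 := by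
  classical
  have h1 : ∀ t, t ∉ Finset.Ico (a - r) b → dseq^[r] f t = 0 := by
    intro t ht
    refine dseq_it_eq_zero r f t fun i hi => ?_
    by_contra hne
    have := hs _ hne
    simp only [Finset.mem_Ico] at ht
    omega
  have h2 : ∑ t ∈ Finset.range n, (dseq^[r] f t) ^ 2 ≤ ∑ t ∈ Finset.Ico (a - r) b, (dseq^[r] f t) ^ 2 := by
    have : ∑ t ∈ Finset.range n, (dseq^[r] f t) ^ 2 = ∑ t ∈ (Finset.range n).filter (· ∈ Finset.Ico (a - r) b), (dseq^[r] f t) ^ 2 := by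
      rw [Finset.sum_filter]
      refine Finset.sum_congr rfl fun t _ => ?_
      split_ifs with h
      · rfl
      · rw [h1 t h]; simp
    rw [this]
    refine Finset.sum_le_sum_of_subset_of_nonneg ?_ (fun _ _ _ => sq_nonneg _)
    intro t ht; exact (Finset.mem_filter.1 ht).2
  refine h2.trans ?_
  have h3 : ∀ t ∈ Finset.Ico (a - r) b, (dseq^[r] f t) ^ 2 ≤ (A * h ^ r) ^ 2 := by
    intro t _
    rw [← sq_abs]
    exact pow_le_pow_left₀ (abs_nonneg _) (hf r le_rfl t) 2
  refine (Finset.sum_le_card_nsmul _ _ _ h3).trans ?_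
  rw [nsmul_eq_mul]
  refine mul_le_mul_of_nonneg_right ?_ (sq_nonneg _)
  rw [Nat.card_Ico]
  exact_mod_cast (by omega : b - (a - r) ≤ b - a + r)

lemma overlap {ι : Type*} (s : Finset ι) (r N : ℕ) (f : ι → ℕ → ℝ)
    (hN : ∀ t, (by classical exact (s.filter (fun B => f B t ≠ 0)).card) ≤ N) (n : ℕ) :
    ∑ t ∈ Finset.range n, (∑ B ∈ s, dseq^[r] (f B) t) ^ 2 ≤
      ((r + 1) * N : ℝ) * ∑ B ∈ s, ∑ t ∈ Finset.range n, (dseq^[r] (f B) t) ^ 2 := by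
  classical
  rw [Finset.sum_comm, Finset.mul_sum]
  refine Finset.sum_le_sum fun t _ => ?_
  have h1 : ∑ B ∈ s, dseq^[r] (f B) t = ∑ B ∈ s.filter (fun B => dseq^[r] (f B) t ≠ 0), dseq^[r] (f B) t := by
    rw [Finset.sum_filter_ne_zero]
  have h2 : s.filter (fun B => dseq^[r] (f B) t ≠ 0) ⊆
      (Finset.range (r+1)).biUnion (fun i => s.filter (fun B => f B (t + i) ≠ 0)) := by
    intro B hB
    rw [Finset.mem_filter] at hB
    by_contra hcon
    apply hB.2
    refine dseq_it_eq_zero r _ t fun i hi => ?_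
    by_contra hne
    apply hcon
    simp only [Finset.mem_biUnion, Finset.mem_range, Finset.mem_filter]
    exact ⟨i, by omega, hB.1, hne⟩
  have h3 : (s.filter (fun B => dseq^[r] (f B) t ≠ 0)).card ≤ (r+1) * N := by
    refine (Finset.card_le_card h2).trans ?_
    refine (Finset.card_biUnion_le_card_mul _ _ N ?_).trans (by simp)
    intro i _
    convert hN (t + i)
  rw [h1]
  refine (sq_sum_le_card_mul_sum_sq).trans ?_
  have h4 : ∑ B ∈ s.filter (fun B => dseq^[r] (f B) t ≠ 0), (dseq^[r] (f B) t) ^ 2 ≤ ∑ B ∈ s, (dseq^[r] (f B) t) ^ 2 :=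
    Finset.sum_le_sum_of_subset_of_nonneg (Finset.filter_subset _ _) (fun _ _ _ => sq_nonneg _)
  have h5 : ((s.filter (fun B => dseq^[r] (f B) t ≠ 0)).card : ℝ) ≤ (r + 1) * N := by exact_mod_cast h3
  have h6 : 0 ≤ ∑ B ∈ s, (dseq^[r] (f B) t) ^ 2 := Finset.sum_nonneg fun _ _ => sq_nonneg _
  refine mul_le_mul h5 h4 (Finset.sum_nonneg fun _ _ => sq_nonneg _) (by positivity)

/-! ### summation by parts -/
lemma abel_one (W y : ℕ → ℝ) (n : ℕ) :
    ∑ i ∈ Finset.range n, dseq W i * y i = W n * y n - W 0 * y 0 -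
      ∑ i ∈ Finset.range n, W (i+1) * dseq y i := by
  induction n with
  | zero => simp
  | succ n ih => rw [Finset.sum_range_succ, Finset.sum_range_succ, ih]; simp only [dseq]; ring

lemma sum_parts (r : ℕ) : ∀ (n : ℕ) (U y : ℕ → ℝ), (∀ t < r, U t = 0) → (∀ t, n ≤ t → U t = 0) →
    ∑ i ∈ Finset.range n, dseq^[r] U i * y i =
      (-1) ^ r * ∑ t ∈ Finset.range (n - r), U (t + r) * dseq^[r] y t := by
  induction r with
  | zero => intro n U y _ _; simp
  | succ r ih =>
    intro n U y h0 hn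
    have h1 := abel_one (dseq^[r] U) y n
    have h2 : dseq^[r] U n = 0 := dseq_it_eq_zero r U n fun i _ => hn _ (by omega)
    have h3 : dseq^[r] U 0 = 0 := dseq_it_eq_zero r U 0 fun i hi => h0 _ (by omega)
    rw [h2, h3] at h1
    have h4 : ∑ i ∈ Finset.range n, dseq^[r] U (i+1) * dseq y i = ∑ i ∈ Finset.range (n-1), dseq^[r] (fun t => U (t+1)) i * dseq y i := by
      cases n with
      | zero => simp
      | succ n =>
        rw [Finset.sum_range_succ, h2]
        simp [dseq_it_shift]
    have h5 := ih (n-1) (fun t => U (t+1)) (dseq y) (fun t ht => h0 _ (by omega)) (fun t ht => hn _ (by omega))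
    rw [h4, h5] at h1
    rw [Function.iterate_succ_apply', h1, Function.iterate_succ_apply, show n - 1 - r = n - (r+1) by omega]
    simp only [add_assoc]
    ring

/-! ### summation operator -/
def sumS (f : ℕ → ℝ) : ℕ → ℝ := fun t => ∑ i ∈ Finset.range t, f i

lemma dseq_sumS (f : ℕ → ℝ) : dseq (sumS f) = f := by
  ext t; simp [dseq, sumS, Finset.sum_range_succ]

lemma dseq_sumS_it (r : ℕ) (f : ℕ → ℝ) : dseq^[r] (sumS^[r] f) = f := by
  induction r with
  | zero => rfl
  | succ r ih => rw [Function.iterate_succ_apply, Function.iterate_succ_apply', dseq_sumS, ih]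

lemma sumS_it_zero (r : ℕ) (f : ℕ → ℝ) (t : ℕ) (ht : t < r) : sumS^[r] f t = 0 := by
  induction r generalizing t with
  | zero => omega
  | succ r ih =>
    rw [Function.iterate_succ_apply', sumS]
    exact Finset.sum_eq_zero fun i hi => ih i (by have := Finset.mem_range.1 hi; omega)

def wJ (L : ℕ) : ℕ := Nat.log 2 L - 1
def wN (L : ℕ) : ℕ := 2 * Nat.log 2 L - 1
def wE (L b : ℕ) : ℕ := if b ≤ wJ L then b else 2 * wJ L - b
def wP (L b : ℕ) : ℕ := if b ≤ wJ L then 2 ^ b else L - 2 ^ (2 * wJ L - b + 1)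
def wQ (L b : ℕ) : ℕ := if b < wJ L then 2 ^ (b + 1) else L - 2 ^ (2 * wJ L - b)

lemma wN_pos {L b : ℕ} (h : b < wN L) : wN L = 2 * wJ L + 1 ∧ 2 ^ (wJ L + 1) ≤ L ∧ L < 2 ^ (wJ L + 2) := by
  unfold wN at h
  have h1 : 1 ≤ Nat.log 2 L := by omega
  have h0 : L ≠ 0 := by rintro rfl; simp at h1
  refine ⟨by unfold wN wJ; omega, ?_, ?_⟩
  · have := Nat.pow_log_le_self 2 h0
    rwa [show wJ L + 1 = Nat.log 2 L by unfold wJ; omega]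
  · have := Nat.lt_pow_succ_log_self (b := 2) (by norm_num) L
    rwa [show wJ L + 2 = (Nat.log 2 L).succ by unfold wJ; omega]

lemma pow2_mono {a b : ℕ} (h : a ≤ b) : (2:ℕ) ^ a ≤ 2 ^ b := Nat.pow_le_pow_right (by norm_num) h

lemma w_basic {L b : ℕ} (h : b < wN L) :
    2 ^ (wE L b) ≤ L ∧ 2 ^ (wE L b) ≤ wP L b ∧ wP L b ≤ wQ L b ∧ wQ L b + 2 ^ (wE L b) ≤ L ∧
      wQ L b - wP L b ≤ 2 * 2 ^ (wE L b) := by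
  obtain ⟨h1, h2, h3⟩ := wN_pos h
  rw [h1] at h
  have e1 : (2:ℕ) ^ (wJ L + 1) = 2 * 2 ^ wJ L := by ring
  have e2 : (2:ℕ) ^ (wJ L + 2) = 4 * 2 ^ wJ L := by ring
  rw [e1] at h2; rw [e2] at h3
  unfold wE wP wQ
  rcases lt_trichotomy b (wJ L) with hb | hb | hb
  · have h4 := pow2_mono (show b + 1 ≤ wJ L by omega)
    have e3 : (2:ℕ) ^ (b + 1) = 2 * 2 ^ b := by ring
    rw [if_pos hb.le, if_pos hb.le, if_pos hb]
    omega
  · rw [if_pos hb.le, if_pos hb.le, if_neg (by omega)]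
    have : 2 * wJ L - b = wJ L := by omega
    rw [this, hb]
    omega
  · rw [if_neg (by omega), if_neg (by omega), if_neg (by omega)]
    have h4 := pow2_mono (show 2 * wJ L - b + 1 ≤ wJ L by omega)
    have e3 : (2:ℕ) ^ (2 * wJ L - b + 1) = 2 * 2 ^ (2 * wJ L - b) := by ring
    omega

lemma w_cover {L y : ℕ} (h0 : 0 < y) (hL : y + 1 < L) : ∃ b < wN L, wP L b ≤ y ∧ y < wQ L b := by
  have hlog : 1 ≤ Nat.log 2 L := by
    apply Nat.log_pos <;> omega
  have hN : 0 < wN L := by unfold wN; omega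
  obtain ⟨h1, h2, h3⟩ := wN_pos hN
  rw [h1]
  by_cases c1 : y < 2 ^ wJ L
  · have a1 : 2 ^ Nat.log 2 y ≤ y := Nat.pow_log_le_self 2 (by omega)
    have a2 : y < 2 ^ (Nat.log 2 y + 1) := Nat.lt_pow_succ_log_self (by norm_num) y
    have a3 : Nat.log 2 y < wJ L := (Nat.pow_lt_pow_iff_right (by norm_num)).1 (a1.trans_lt c1)
    refine ⟨Nat.log 2 y, by omega, ?_⟩
    unfold wP wQ
    rw [if_pos a3.le, if_pos a3]
    exact ⟨a1, a2⟩
  · by_cases c2 : y < L - 2 ^ wJ L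
    · refine ⟨wJ L, by omega, ?_⟩
      unfold wP wQ
      rw [if_pos le_rfl, if_neg (lt_irrefl _), show 2 * wJ L - wJ L = wJ L by omega]
      omega
    · set d := L - y - 1 with hd
      have d1 : d < 2 ^ wJ L := by omega
      have a1 : 2 ^ Nat.log 2 d ≤ d := Nat.pow_log_le_self 2 (by omega)
      have a2 : d < 2 ^ (Nat.log 2 d + 1) := Nat.lt_pow_succ_log_self (by norm_num) d
      have a3 : Nat.log 2 d < wJ L := (Nat.pow_lt_pow_iff_right (by norm_num)).1 (a1.trans_lt d1)
      refine ⟨2 * wJ L - Nat.log 2 d, by omega, ?_⟩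
      unfold wP wQ
      rw [if_neg (by omega), if_neg (by omega), show 2 * wJ L - (2 * wJ L - Nat.log 2 d) = Nat.log 2 d by omega]
      omega

lemma card_le_three (A : Finset ℕ) (h : ∀ a ∈ A, ∀ b ∈ A, b ≤ a + 2) : A.card ≤ 3 := by
  rcases A.eq_empty_or_nonempty with rfl | hne
  · simp
  · have : A ⊆ Finset.Icc (A.min' hne) (A.min' hne + 2) := by
      intro b hb
      rw [Finset.mem_Icc]
      exact ⟨A.min'_le b hb, h _ (A.min'_mem hne) _ hb⟩
    refine (Finset.card_le_card this).trans ?_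
    rw [Nat.card_Icc]; omega

lemma w_overlap (L y : ℕ) :
    ((Finset.range (wN L)).filter (fun b => 2 * wP L b < 2 * y + 2 ^ wE L b ∧
      2 * y < 2 * wQ L b + 2 ^ wE L b)).card ≤ 7 := by
  classical
  set S := (Finset.range (wN L)).filter (fun b => 2 * wP L b < 2 * y + 2 ^ wE L b ∧
      2 * y < 2 * wQ L b + 2 ^ wE L b) with hS
  have hsub : S ⊆ (S.filter (· < wJ L)) ∪ {wJ L} ∪ (S.filter (wJ L < ·)) := by
    intro b hb
    simp only [Finset.mem_union, Finset.mem_filter, Finset.mem_singleton]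
    rcases lt_trichotomy b (wJ L) with h | h | h <;> simp [h, hb]
  have hl : (S.filter (· < wJ L)).card ≤ 3 := by
    apply card_le_three
    intro a ha b hb
    simp only [hS, Finset.mem_filter, Finset.mem_range] at ha hb
    obtain ⟨⟨_, a1, a2⟩, a3⟩ := ha
    obtain ⟨⟨_, b1, b2⟩, b3⟩ := hb
    by_contra hcon
    have h4 := pow2_mono (show a + 3 ≤ b by omega)
    unfold wP wE at b1
    unfold wQ wE at a2
    rw [if_pos b3.le, if_pos b3.le] at b1
    rw [if_pos a3, if_pos a3.le] at a2
    have e3 : (2:ℕ) ^ (a + 1) = 2 * 2 ^ a := by ring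
    have e4 : (2:ℕ) ^ (a + 3) = 8 * 2 ^ a := by ring
    omega
  have hr : (S.filter (wJ L < ·)).card ≤ 3 := by
    apply card_le_three
    intro a ha b hb
    simp only [hS, Finset.mem_filter, Finset.mem_range] at ha hb
    obtain ⟨⟨a0, a1, a2⟩, a3⟩ := ha
    obtain ⟨⟨b0, b1, b2⟩, b3⟩ := hb
    by_contra hcon
    obtain ⟨h1, h2, _⟩ := wN_pos a0
    rw [h1] at a0 b0
    have h4 := pow2_mono (show (2 * wJ L - b) + 3 ≤ 2 * wJ L - a by omega)
    have h5 := pow2_mono (show (2 * wJ L - b) + 1 ≤ wJ L + 1 by omega)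
    have h6 := pow2_mono (show (2 * wJ L - a) ≤ wJ L + 1 by omega)
    unfold wQ wE at a2
    unfold wP wE at b1
    rw [if_neg (by omega), if_neg (by omega)] at a2
    rw [if_neg (by omega), if_neg (by omega)] at b1
    have e3 : (2:ℕ) ^ (2 * wJ L - b + 1) = 2 * 2 ^ (2 * wJ L - b) := by ring
    have e4 : (2:ℕ) ^ (2 * wJ L - b + 3) = 8 * 2 ^ (2 * wJ L - b) := by ring
    omega
  refine (Finset.card_le_card hsub).trans ?_
  refine (Finset.card_union_le _ _).trans ?_
  have := Finset.card_union_le (S.filter (· < wJ L)) {wJ L}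
  rw [Finset.card_singleton] at this
  omega

lemma w_sum (L : ℕ) : ∑ b ∈ Finset.range (wN L), 2 ^ wE L b ≤ 2 * L := by
  by_cases hN : wN L = 0
  · rw [hN]; simp
  obtain ⟨h1, h2, h3⟩ := wN_pos (Nat.pos_of_ne_zero hN)
  rw [h1, show 2 * wJ L + 1 = (wJ L + 1) + wJ L by ring, Finset.sum_range_add]
  have e1 : ∑ x ∈ Finset.range (wJ L + 1), 2 ^ wE L x = ∑ x ∈ Finset.range (wJ L + 1), 2 ^ x := by
    refine Finset.sum_congr rfl fun x hx => ?_
    have := Finset.mem_range.1 hx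
    rw [wE, if_pos (by omega)]
  have e2 : ∑ x ∈ Finset.range (wJ L), 2 ^ wE L (wJ L + 1 + x) = ∑ x ∈ Finset.range (wJ L), 2 ^ (wJ L - 1 - x) := by
    refine Finset.sum_congr rfl fun x hx => ?_
    have := Finset.mem_range.1 hx
    rw [wE, if_neg (by omega)]
    congr 1; omega
  rw [e1, e2, Finset.sum_range_reflect (fun x => 2 ^ x), Nat.geomSum_eq le_rfl, Nat.geomSum_eq le_rfl]
  have e1 : (2:ℕ) ^ (wJ L + 1) = 2 * 2 ^ wJ L := by ring
  simp
  omega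

lemma wN_le (L : ℕ) (hL : 1 ≤ L) : (wN L : ℝ) ≤ 4 * Real.log L := by
  have h1 : (2:ℝ) ^ (Nat.log 2 L) ≤ L := by exact_mod_cast Nat.pow_log_le_self 2 (by omega)
  have h2 : Nat.log 2 L * Real.log 2 ≤ Real.log L := by
    rw [← Real.log_pow]
    exact Real.log_le_log (by positivity) h1
  have h3 : (wN L : ℝ) ≤ 2 * Nat.log 2 L := by
    unfold wN
    exact_mod_cast Nat.sub_le _ _
  have h4 := Real.log_two_gt_d9
  have h5 : (0:ℝ) ≤ Nat.log 2 L := Nat.cast_nonneg _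
  nlinarith

/-- total number of blocks -/
lemma wN_total (k n : ℕ) (L : ℕ → ℕ) (hL : ∀ i ≤ k, 1 ≤ L i) (hs : ∑ i ∈ Finset.range (k+1), L i = n) :
    (∑ i ∈ Finset.range (k+1), (wN (L i) : ℝ)) + (k + 1) ≤
      5 * ((k + 1 : ℝ) * Real.log (Real.exp 1 * n / (k + 1))) := by
  have hk : (0:ℝ) < k + 1 := by positivity
  have hn : (k + 1 : ℝ) ≤ n := by
    rw [← hs]
    push_cast
    calc (k + 1 : ℝ) = ∑ i ∈ Finset.range (k+1), (1:ℝ) := by simp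
      _ ≤ _ := Finset.sum_le_sum fun i hi => by
          exact_mod_cast hL i (by have := Finset.mem_range.1 hi; omega)
  have hn0 : (0:ℝ) < n := by linarith
  have hm : (0:ℝ) < (n:ℝ) / (k+1) := by positivity
  have hlog : Real.log (Real.exp 1 * n / (k + 1)) = 1 + Real.log (n / (k+1)) := by
    rw [mul_div_assoc, Real.log_mul (Real.exp_ne_zero _) hm.ne', Real.log_exp]
  have hlm : 0 ≤ Real.log ((n:ℝ) / (k+1)) := Real.log_nonneg (by rw [le_div_iff₀ hk]; linarith)
  have h1 : ∀ i ∈ Finset.range (k+1), (wN (L i) : ℝ) ≤ 4 * (Real.log ((n:ℝ) / (k+1)) + (L i : ℝ) / ((n:ℝ)/(k+1)) - 1) := by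
    intro i hi
    have hi := hL i (by have := Finset.mem_range.1 hi; omega)
    refine (wN_le _ hi).trans ?_
    have hLp : (0:ℝ) < L i := by exact_mod_cast hi
    have := Real.log_le_sub_one_of_pos (div_pos hLp hm)
    rw [Real.log_div hLp.ne' hm.ne'] at this
    linarith
  have h2 := Finset.sum_le_sum h1
  have h3 : ∑ i ∈ Finset.range (k+1), 4 * (Real.log ((n:ℝ) / (k+1)) + (L i : ℝ) / ((n:ℝ)/(k+1)) - 1) =
      4 * ((k+1) * Real.log ((n:ℝ) / (k+1))) := by
    rw [← Finset.mul_sum, Finset.sum_sub_distrib, Finset.sum_add_distrib, ← Finset.sum_div]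
    have : ∑ i ∈ Finset.range (k+1), (L i : ℝ) = n := by rw [← hs]; push_cast; rfl
    rw [this]
    simp
    field_simp
    ring
  rw [h3] at h2
  rw [hlog]
  nlinarith

lemma exists_proj {n : ℕ} {ι : Type} [Fintype ι] (φ : ι → (Fin n → ℝ) →ₗ[ℝ] ℝ) :
    ∃ P : (Fin n → ℝ) →ₗ[ℝ] (Fin n → ℝ), (∀ j z, φ j (z - P z) = 0) ∧
      (∀ a : Fin n → ℝ, ∃ b : Fin n → ℝ, ∑ i, b i ^ 2 ≤ ∑ i, a i ^ 2 ∧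
        ∀ z, ∑ i, a i * (z - P z) i = ∑ i, b i * z i) ∧
      Integrable (fun z => sqnorm (P z)) (gaussVec n 1) ∧
      ∫ z, sqnorm (P z) ∂gaussVec n 1 ≤ Fintype.card ι := by
  classical
  let E := EuclideanSpace ℝ (Fin n)
  let T : (Fin n → ℝ) ≃ₗ[ℝ] E := (WithLp.linearEquiv 2 ℝ (Fin n → ℝ)).symm
  have hin : ∀ a z : Fin n → ℝ, inner ℝ (T a) (T z) = ∑ i, a i * z i := by
    intro a z
    change inner ℝ (WithLp.toLp 2 a : EuclideanSpace ℝ (Fin n)) (WithLp.toLp 2 z) = _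
    simp [PiLp.inner_apply, mul_comm]
  have hTn : ∀ z : Fin n → ℝ, ‖T z‖ ^ 2 = sqnorm z := by
    intro z
    rw [← real_inner_self_eq_norm_sq, hin]; simp [sqnorm, sq]
  let rep : ι → E := fun j => T (fun i => φ j (Pi.single i 1))
  have hrep : ∀ j z, φ j z = inner ℝ (rep j) (T z) := by
    intro j z
    rw [hin]
    have : z = ∑ i, z i • (Pi.single i (1 : ℝ) : Fin n → ℝ) := by
      ext j; simp [Finset.sum_apply, Pi.single_apply]
    conv_lhs => rw [this]
    simp [mul_comm]
  let K : Submodule ℝ E := Submodule.span ℝ (Set.range rep)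
  have hKr : Module.finrank ℝ K ≤ Fintype.card ι := finrank_range_le_card rep
  let P : (Fin n → ℝ) →ₗ[ℝ] (Fin n → ℝ) :=
    T.symm.toLinearMap ∘ₗ K.starProjection.toLinearMap ∘ₗ T.toLinearMap
  have hTP : ∀ z, T (P z) = K.starProjection (T z) := by
    intro z; simp [P]
  have hsub : ∀ z, T (z - P z) = T z - K.starProjection (T z) := by
    intro z; rw [map_sub, hTP]
  have horth : ∀ z, T z - K.starProjection (T z) ∈ Kᗮ := fun z => K.sub_starProjection_mem_orthogonal _
  have hPn : ∀ z, sqnorm (P z) = ∑ b, (inner ℝ ((stdOrthonormalBasis ℝ K b : K) : E) (T z)) ^ 2 := by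
    intro z
    rw [← hTn, hTP]
    have h1 : K.starProjection (T z) = ((K.orthogonalProjectionOnto (T z) : K) : E) := rfl
    rw [h1, ← Submodule.coe_norm, ← (stdOrthonormalBasis ℝ K).sum_sq_norm_inner_right]
    refine Finset.sum_congr rfl fun b _ => ?_
    rw [Submodule.inner_orthogonalProjectionOnto_eq_of_mem_left, Real.norm_eq_abs, sq_abs]
  have hbin : ∀ b z, inner ℝ ((stdOrthonormalBasis ℝ K b : K) : E) (T z) =
      ∑ i, (T.symm ((stdOrthonormalBasis ℝ K b : K) : E)) i * z i := by
    intro b z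
    rw [← hin, T.apply_symm_apply]
  refine ⟨P, ?_, ?_, ?_, ?_⟩
  · intro j z
    rw [hrep, hsub]
    exact (Submodule.mem_orthogonal K _).1 (horth z) _ (Submodule.subset_span ⟨j, rfl⟩)
  · intro a
    refine ⟨a - P a, ?_, fun z => ?_⟩
    · have h1 : ‖T (a - P a)‖ ^ 2 ≤ ‖T a‖ ^ 2 := by
        have h2 : ‖T a‖ ^ 2 = ‖K.starProjection (T a)‖ ^ 2 + ‖T a - K.starProjection (T a)‖ ^ 2 := by
          have h3 : inner ℝ (K.starProjection (T a)) (T a - K.starProjection (T a)) = 0 :=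
            (Submodule.mem_orthogonal K _).1 (horth a) _ (K.starProjection_apply_mem _)
          have h4 := norm_add_sq_eq_norm_sq_add_norm_sq_of_inner_eq_zero _ _ h3
          rw [add_sub_cancel] at h4
          nlinarith
        rw [hsub, h2]
        nlinarith [sq_nonneg ‖K.starProjection (T a)‖]
      rw [hTn, hTn] at h1
      exact h1
    · rw [← hin, ← hin, hsub, hsub, inner_sub_left, inner_sub_right, Submodule.inner_starProjection_left_eq_right]
  · simp only [hPn, hbin]
    exact integrable_finsetSum _ fun b _ => gv_lin_integrable _
  · simp only [hPn, hbin]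
    rw [integral_finsetSum _ fun b _ => gv_lin_integrable _]
    simp only [gv_lin_int]
    have h1 : ∀ b, ∑ i, (T.symm ((stdOrthonormalBasis ℝ K b : K) : E)) i ^ 2 = 1 := by
      intro b
      have := hTn (T.symm ((stdOrthonormalBasis ℝ K b : K) : E))
      rw [T.apply_symm_apply, ← Submodule.coe_norm, (stdOrthonormalBasis ℝ K).norm_eq_one] at this
      rw [sqnorm] at this
      linarith
    simp only [h1]
    simp
    exact_mod_cast hKr

lemma pad_add {n : ℕ} (a b : Fin n → ℝ) (t : ℕ) : pad (a + b) t = pad a t + pad b t := by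
  unfold pad; split_ifs <;> simp
lemma pad_smul {n : ℕ} (c : ℝ) (a : Fin n → ℝ) (t : ℕ) : pad (c • a) t = c * pad a t := by
  unfold pad; split_ifs <;> simp

lemma sumS_it_add (l : ℕ) (f g : ℕ → ℝ) (t : ℕ) :
    sumS^[l] (fun t => f t + g t) t = sumS^[l] f t + sumS^[l] g t := by
  induction l generalizing t with
  | zero => rfl
  | succ l ih => simp only [Function.iterate_succ_apply', sumS, ← Finset.sum_add_distrib]; exact Finset.sum_congr rfl fun i _ => ih i
lemma sumS_it_smul (l : ℕ) (c : ℝ) (f : ℕ → ℝ) (t : ℕ) :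
    sumS^[l] (fun t => c * f t) t = c * sumS^[l] f t := by
  induction l generalizing t with
  | zero => rfl
  | succ l ih => simp only [Function.iterate_succ_apply', sumS, Finset.mul_sum]; exact Finset.sum_congr rfl fun i _ => ih i

def phiF {n : ℕ} (l p : ℕ) : (Fin n → ℝ) →ₗ[ℝ] ℝ where
  toFun R := sumS^[l] (pad R) p
  map_add' a b := by
    rw [← sumS_it_add]; exact congrFun (congrArg _ (funext (pad_add a b))) p
  map_smul' c a := by
    simp only [RingHom.id_apply, smul_eq_mul]
    rw [← sumS_it_smul]; exact congrFun (congrArg _ (funext (pad_smul c a))) p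

lemma sumS_diff (f : ℕ → ℝ) {p t : ℕ} (h : p ≤ t) : sumS f t = sumS f p + ∑ i ∈ Finset.Ico p t, f i := by
  unfold sumS; rw [Finset.sum_range_add_sum_Ico _ h]

/-- pointwise bound inside a block -/
lemma block_bd (R : ℕ → ℝ) (p q : ℕ) (w : ℝ) (hw : ((q - p : ℕ) : ℝ) ≤ w) (r : ℕ) (h : ∀ l, 1 ≤ l → l ≤ r + 2 → sumS^[l] R p = 0) :
    ∀ l ≤ r, ∀ t, p ≤ t → t < q → |sumS^[l + 2] R t| ≤ w ^ l * ∑ i ∈ Finset.Ico p q, |sumS R i| := by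
  have hw0 : 0 ≤ w := (Nat.cast_nonneg _).trans hw
  intro l
  induction l with
  | zero =>
    intro _ t hp hq
    rw [Function.iterate_succ_apply', sumS_diff _ hp, ← Function.iterate_succ_apply' sumS, h 2 (by omega) (by omega), zero_add,
      pow_zero, one_mul]
    refine (Finset.abs_sum_le_sum_abs _ _).trans ?_
    exact Finset.sum_le_sum_of_subset_of_nonneg (Finset.Ico_subset_Ico le_rfl hq.le) fun _ _ _ => abs_nonneg _
  | succ l ih =>
    intro hl t hp hq
    rw [show l + 1 + 2 = (l+2)+1 by ring, Function.iterate_succ_apply', sumS_diff _ hp,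
      ← Function.iterate_succ_apply' sumS, h (l+2+1) (by omega) (by omega), zero_add]
    refine (Finset.abs_sum_le_sum_abs _ _).trans ?_
    have h0 : 0 ≤ ∑ i ∈ Finset.Ico p q, |sumS R i| := Finset.sum_nonneg fun _ _ => abs_nonneg _
    have h1 : ∀ i ∈ Finset.Ico p t, |sumS^[l+2] R i| ≤ w ^ l * ∑ i ∈ Finset.Ico p q, |sumS R i| := by
      intro i hi
      rw [Finset.mem_Ico] at hi
      exact ih (by omega) i hi.1 (by omega)
    refine (Finset.sum_le_card_nsmul _ _ _ h1).trans ?_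
    rw [nsmul_eq_mul, Nat.card_Ico]
    have h2 : ((t - p : ℕ) : ℝ) ≤ w := le_trans (by exact_mod_cast (by omega : t - p ≤ q - p)) hw
    calc _ ≤ w * (w ^ l * ∑ i ∈ Finset.Ico p q, |sumS R i|) := by gcongr
      _ = _ := by ring

lemma block_sq (R : ℕ → ℝ) (p q : ℕ) (w : ℝ) (hw : ((q - p : ℕ) : ℝ) ≤ w) (r : ℕ) (hr : 2 ≤ r)
    (h : ∀ l, 1 ≤ l → l ≤ r → sumS^[l] R p = 0) (t : ℕ) (hp : p ≤ t) (hq : t < q) :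
    |sumS^[r] R t| ≤ Real.sqrt (w ^ (2 * r - 3) * ∑ i ∈ Finset.Ico p q, sumS R i ^ 2) := by
  obtain ⟨m, rfl⟩ : ∃ m, r = m + 2 := ⟨r - 2, by omega⟩
  have hw0 : 0 ≤ w := (Nat.cast_nonneg _).trans hw
  have h1 := block_bd R p q w hw m h m le_rfl t hp hq
  apply Real.le_sqrt_of_sq_le
  have h2 : (∑ i ∈ Finset.Ico p q, |sumS R i|) ^ 2 ≤ w * ∑ i ∈ Finset.Ico p q, sumS R i ^ 2 := by
    refine (sq_sum_le_card_mul_sum_sq).trans ?_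
    simp only [sq_abs]
    rw [Nat.card_Ico]
    have : 0 ≤ ∑ i ∈ Finset.Ico p q, sumS R i ^ 2 := Finset.sum_nonneg fun _ _ => sq_nonneg _
    gcongr
  rw [show 2 * (m+2) - 3 = 2 * m + 1 by omega]
  calc _ ≤ (w ^ m * ∑ i ∈ Finset.Ico p q, |sumS R i|) ^ 2 := pow_le_pow_left₀ (abs_nonneg _) h1 2
    _ = w ^ (2 * m) * (∑ i ∈ Finset.Ico p q, |sumS R i|) ^ 2 := by ring
    _ ≤ w ^ (2 * m) * (w * ∑ i ∈ Finset.Ico p q, sumS R i ^ 2) := by gcongr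
    _ = _ := by ring

lemma sumS_it_tail (R : ℕ → ℝ) (n r : ℕ) (hR : ∀ t, n ≤ t → R t = 0)
    (h : ∀ l, 1 ≤ l → l ≤ r → sumS^[l] R n = 0) (l : ℕ) (hl : l ≤ r) (t : ℕ) (ht : n ≤ t) : sumS^[l] R t = 0 := by
  induction l generalizing t with
  | zero => exact hR t ht
  | succ l ih =>
    rw [Function.iterate_succ_apply', sumS_diff _ ht, ← Function.iterate_succ_apply' sumS, h _ (by omega) hl, zero_add]
    exact Finset.sum_eq_zero fun i hi => ih (by omega) i (Finset.mem_Ico.1 hi).1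

/-- second moment of the partial sums of the residual -/
lemma resid_moment {n : ℕ} (P : (Fin n → ℝ) →ₗ[ℝ] (Fin n → ℝ))
    (hP : ∀ a : Fin n → ℝ, ∃ b : Fin n → ℝ, ∑ i, b i ^ 2 ≤ ∑ i, a i ^ 2 ∧
        ∀ z, ∑ i, a i * (z - P z) i = ∑ i, b i * z i) (p t : ℕ) (hpt : p ≤ t)
    (h0 : ∀ z, sumS (pad (z - P z)) p = 0) :
    Integrable (fun z => sumS (pad (z - P z)) t ^ 2) (gaussVec n 1) ∧
    ∫ z, sumS (pad (z - P z)) t ^ 2 ∂gaussVec n 1 ≤ ((t - p : ℕ) : ℝ) := by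
  obtain ⟨b, hb1, hb2⟩ := hP (fun i => if (p ≤ i.1 ∧ i.1 < t) then 1 else 0)
  have e : ∀ z, sumS (pad (z - P z)) t = ∑ i, b i * z i := by
    intro z
    rw [← hb2, sumS_diff _ hpt, h0, zero_add]
    have h1 : ∑ i : Fin n, (if (p ≤ i.1 ∧ i.1 < t) then (1:ℝ) else 0) * (z - P z) i =
        ∑ i ∈ Finset.range n, (if (p ≤ i ∧ i < t) then pad (z - P z) i else 0) := by
      rw [Finset.sum_range]
      refine Finset.sum_congr rfl fun i _ => ?_
      split_ifs
      · simp [pad]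
      · simp
    rw [h1, ← Finset.sum_filter]
    refine (Finset.sum_subset_zero_on_sdiff ?_ ?_ (fun _ _ => rfl)).symm
    · intro i hi; simp only [Finset.mem_filter, Finset.mem_range, Finset.mem_Ico] at *; omega
    · intro i hi
      simp only [Finset.mem_filter, Finset.mem_range, Finset.mem_sdiff, Finset.mem_Ico] at hi
      unfold pad; rw [dif_neg (by omega)]
  simp only [e]
  refine ⟨gv_lin_integrable b, ?_⟩
  rw [gv_lin_int]
  refine hb1.trans ?_
  have h2 : ∑ i : Fin n, (if (p ≤ i.1 ∧ i.1 < t) then (1:ℝ) else 0) ^ 2 =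
        ∑ i ∈ Finset.range n, (if (p ≤ i ∧ i < t) then (1:ℝ) else 0) := by
      rw [Finset.sum_range]
      refine Finset.sum_congr rfl fun i _ => ?_
      split_ifs <;> simp
  rw [h2, ← Finset.sum_filter, Finset.sum_const, nsmul_eq_mul, mul_one]
  have h3 : (Finset.range n).filter (fun i => p ≤ i ∧ i < t) ⊆ Finset.Ico p t := by
    intro i hi; simp only [Finset.mem_filter, Finset.mem_Ico] at *; omega
  have := Finset.card_le_card h3
  rw [Nat.card_Ico] at this
  exact_mod_cast this

structure KD (r n k : ℕ) (c : ℝ) (τ : ℕ → ℕ) (s : ℕ → ℝ) : Prop where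
  hr : 2 ≤ r
  hc0 : 0 < c
  h0 : τ 0 = 0
  hn : τ (k+1) = n
  hlt : ∀ i ≤ k, τ i < τ (i+1)
  h1 : r ≤ τ 1
  s0 : s 0 = 0
  sk : s (k+1) = 0
  sb : ∀ i, |s i| ≤ 1
  ml : ∀ i ≤ k, s i ≠ s (i+1) → c * n / (k+1) ≤ ((τ (i+1) - τ i : ℕ) : ℝ)

structure GoodU (r n k : ℕ) (τ : ℕ → ℕ) (s : ℕ → ℝ) (μ : ℝ) (U : ℕ → ℝ) : Prop where
  z0 : ∀ t < r, U t = 0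
  zn : ∀ t, n ≤ t → U t = 0
  bd : ∀ t, |U t| ≤ μ
  kn : ∀ i, 1 ≤ i → i ≤ k → U (τ i) = μ * s i

def aI (r : ℕ) (τ : ℕ → ℕ) (i : ℕ) : ℕ := if i = 0 then r - 1 else τ i
def HI (r : ℕ) (τ : ℕ → ℕ) (i t : ℕ) : ℝ :=
  Real.smoothTransition (1 / ((τ (i+1) : ℝ) - aI r τ i) * t + (- (aI r τ i : ℝ) / ((τ (i+1) : ℝ) - aI r τ i)))
def uI (r : ℕ) (τ : ℕ → ℕ) (s : ℕ → ℝ) (i t : ℕ) : ℝ := s i + (s (i+1) - s i) * HI r τ i t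
def u0 (r k : ℕ) (τ : ℕ → ℕ) (s : ℕ → ℝ) (t : ℕ) : ℝ :=
  ∑ i ∈ Finset.range (k+1), (s (i+1) - s i) * HI r τ i t

namespace KD
variable {r n k : ℕ} {c : ℝ} {τ : ℕ → ℕ} {s : ℕ → ℝ}

lemma mono (h : KD r n k c τ s) {i j : ℕ} (hij : i ≤ j) (hj : j ≤ k+1) : τ i ≤ τ j := by
  induction j, hij using Nat.le_induction with
  | base => exact le_rfl
  | succ j hij ih => exact (ih (by omega)).trans (h.hlt j (by omega)).le

lemma a_ge (h : KD r n k c τ s) (i : ℕ) : τ i ≤ aI r τ i := by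
  unfold aI; split_ifs with hi
  · subst hi; rw [h.h0]; omega
  · exact le_rfl

lemma a_lt (h : KD r n k c τ s) {i : ℕ} (hi : i ≤ k) : aI r τ i < τ (i+1) := by
  unfold aI; split_ifs with h0
  · subst h0; have := h.h1; have := h.hr; simp only [zero_add]; omega
  · exact h.hlt i hi

lemma L_pos (h : KD r n k c τ s) {i : ℕ} (hi : i ≤ k) : (1:ℝ) ≤ (τ (i+1) : ℝ) - aI r τ i := by
  have := h.a_lt hi
  have : (aI r τ i : ℝ) + 1 ≤ τ (i+1) := by exact_mod_cast this
  linarith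

/-- modified length is comparable with the gap length -/
lemma L_ge (h : KD r n k c τ s) {i : ℕ} (hi : i ≤ k) :
    ((τ (i+1) - τ i : ℕ) : ℝ) ≤ r * ((τ (i+1) : ℝ) - aI r τ i) := by
  have h2 := h.hlt i hi
  rw [Nat.cast_sub h2.le]
  have hr : (2:ℝ) ≤ r := by exact_mod_cast h.hr
  by_cases h0 : i = 0
  · subst h0
    have e : aI r τ 0 = r - 1 := rfl
    rw [e, h.h0, Nat.cast_sub (by have := h.hr; omega)]
    have : (r:ℝ) ≤ τ (0+1) := by exact_mod_cast h.h1
    push_cast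
    nlinarith
  · have e : aI r τ i = τ i := by unfold aI; rw [if_neg h0]
    rw [e]
    have : (τ i : ℝ) < τ (i+1) := by exact_mod_cast h2
    nlinarith

lemma HI_zero (h : KD r n k c τ s) {i t : ℕ} (hi : i ≤ k) (ht : t ≤ aI r τ i) : HI r τ i t = 0 := by
  apply Real.smoothTransition.zero_of_nonpos
  have h1 := h.L_pos hi
  have : (t:ℝ) ≤ aI r τ i := by exact_mod_cast ht
  have h2 : 1 / ((τ (i+1) : ℝ) - aI r τ i) * t + (- (aI r τ i : ℝ) / ((τ (i+1) : ℝ) - aI r τ i)) = ((t:ℝ) - aI r τ i) / ((τ (i+1) : ℝ) - aI r τ i) := by ring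
  rw [h2]
  exact div_nonpos_of_nonpos_of_nonneg (by linarith) (by linarith)

lemma HI_one (h : KD r n k c τ s) {i t : ℕ} (hi : i ≤ k) (ht : τ (i+1) ≤ t) : HI r τ i t = 1 := by
  apply Real.smoothTransition.one_of_one_le
  have h1 := h.L_pos hi
  have : (τ (i+1):ℝ) ≤ t := by exact_mod_cast ht
  have h2 : 1 / ((τ (i+1) : ℝ) - aI r τ i) * t + (- (aI r τ i : ℝ) / ((τ (i+1) : ℝ) - aI r τ i)) = ((t:ℝ) - aI r τ i) / ((τ (i+1) : ℝ) - aI r τ i) := by ring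
  rw [h2, le_div_iff₀ (by linarith)]
  linarith

lemma u0_eq (h : KD r n k c τ s) {i t : ℕ} (hi : i ≤ k) (h1 : τ i ≤ t) (h2 : t ≤ τ (i+1)) :
    u0 r k τ s t = uI r τ s i t := by
  unfold u0 uI
  rw [← Finset.sum_range_add_sum_Ico _ (show i + 1 ≤ k + 1 by omega), Finset.sum_range_succ]
  have e1 : ∑ x ∈ Finset.range i, (s (x+1) - s x) * HI r τ x t = s i := by
    have : ∑ x ∈ Finset.range i, (s (x+1) - s x) * HI r τ x t = ∑ x ∈ Finset.range i, (s (x+1) - s x) := by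
      refine Finset.sum_congr rfl fun x hx => ?_
      have hx := Finset.mem_range.1 hx
      rw [h.HI_one (by omega) ((h.mono (show x+1 ≤ i by omega) (by omega)).trans h1), mul_one]
    rw [this, Finset.sum_range_sub, h.s0, sub_zero]
  have e2 : ∑ x ∈ Finset.Ico (i+1) (k+1), (s (x+1) - s x) * HI r τ x t = 0 := by
    refine Finset.sum_eq_zero fun x hx => ?_
    have hx := Finset.mem_Ico.1 hx
    rw [h.HI_zero (by omega) ((h2.trans (h.mono hx.1 (by omega))).trans (h.a_ge x)), mul_zero]
  rw [e1, e2, add_zero]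

lemma locate (h : KD r n k c τ s) {t : ℕ} (ht : t < n) : ∃ i ≤ k, τ i ≤ t ∧ t < τ (i+1) := by
  have hex : ∃ i, t < τ (i+1) := ⟨k, by rw [h.hn]; exact ht⟩
  classical
  refine ⟨Nat.find hex, Nat.find_min' hex (by rw [h.hn]; exact ht), ?_, Nat.find_spec hex⟩
  by_cases h0 : Nat.find hex = 0
  · rw [h0, h.h0]; omega
  · have := Nat.find_min hex (m := Nat.find hex - 1) (by omega)
    rw [Nat.sub_add_cancel (by omega)] at this
    omega

lemma gap_unique (h : KD r n k c τ s) {t i j : ℕ} (hi : i ≤ k) (hj : j ≤ k) (h1 : τ i ≤ t) (h2 : t < τ (i+1))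
    (h3 : τ j ≤ t) (h4 : t < τ (j+1)) : i = j := by
  rcases lt_trichotomy i j with hij | hij | hij
  · have := h.mono (show i + 1 ≤ j by omega) (by omega); omega
  · exact hij
  · have := h.mono (show j + 1 ≤ i by omega) (by omega); omega

lemma uI_bd (h : KD r n k c τ s) (i t : ℕ) : |uI r τ s i t| ≤ 1 := by
  unfold uI HI
  set y := Real.smoothTransition _
  have y0 : 0 ≤ y := Real.smoothTransition.nonneg _
  have y1 : y ≤ 1 := Real.smoothTransition.le_one _
  have a := abs_le.1 (h.sb i)
  have b := abs_le.1 (h.sb (i+1))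
  rw [abs_le]
  constructor <;> nlinarith

lemma u0_tail (h : KD r n k c τ s) {t : ℕ} (ht : n ≤ t) : u0 r k τ s t = 0 := by
  unfold u0
  have : ∑ x ∈ Finset.range (k+1), (s (x+1) - s x) * HI r τ x t = ∑ x ∈ Finset.range (k+1), (s (x+1) - s x) := by
    refine Finset.sum_congr rfl fun x hx => ?_
    have hx := Finset.mem_range.1 hx
    rw [h.HI_one (by omega) ((h.mono (show x+1 ≤ k+1 by omega) le_rfl).trans (by rw [h.hn]; exact ht)), mul_one]
  rw [this, Finset.sum_range_sub, h.s0, h.sk, sub_zero]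

lemma u0_good (h : KD r n k c τ s) : GoodU r n k τ s 1 (u0 r k τ s) where
  z0 := by
    intro t ht
    have h1 := h.h1
    have h2 := h.hr
    rw [h.u0_eq (i := 0) (by omega) (by rw [h.h0]; omega) (by simp only [zero_add]; omega)]
    unfold uI
    rw [h.HI_zero (by omega) (by unfold aI; simp; omega), h.s0]; simp
  zn := fun t ht => h.u0_tail ht
  bd := by
    intro t
    by_cases ht : t < n
    · obtain ⟨i, hi, h1, h2⟩ := h.locate ht
      rw [h.u0_eq hi h1 h2.le]; exact h.uI_bd i t
    · rw [h.u0_tail (by omega)]; simp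
  kn := by
    intro i h1 hi
    rw [h.u0_eq hi le_rfl (h.hlt i hi).le]
    unfold uI
    rw [h.HI_zero hi (h.a_ge i)]; ring

lemma n_pos (h : KD r n k c τ s) : 0 < n := by
  have h1 := h.h1
  have h2 := h.mono (show 1 ≤ k + 1 by omega) le_rfl
  have := h.hr
  rw [h.hn] at h2; omega

lemma u0_energy (h : KD r n k c τ s) {CH : ℝ} (hCH1 : 1 ≤ CH) (hCH : ∀ a b h : ℝ, |a| ≤ h →
    Cl r CH h (fun t : ℕ => Real.smoothTransition (a * t + b))) :
    ∑ t ∈ Finset.range n, (dseq^[r] (u0 r k τ s) t) ^ 2 ≤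
      (r * (r * 4 * CH ^ 2 * (r / c) ^ (2 * r - 1))) * ((k+1) * ((k + 1) / n : ℝ) ^ (2 * r - 1)) := by
  have hr2 := h.hr
  obtain ⟨q, rfl⟩ : ∃ q, r = q + 1 := ⟨r - 1, by omega⟩
  set f : ℕ → ℕ → ℝ := fun i t => (s (i+1) - s i) * dseq (HI (q+1) τ i) t with hf
  have hn0 : (0:ℝ) < n := by exact_mod_cast h.n_pos
  have e1 : ∀ t, dseq^[q+1] (u0 (q+1) k τ s) t = ∑ i ∈ Finset.range (k+1), dseq^[q] (f i) t := by
    intro t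
    rw [← dseq_it_sum, Function.iterate_succ_apply]
    refine congrFun (congrArg _ ?_) t
    ext t
    simp only [u0, dseq, hf, ← Finset.sum_sub_distrib]
    exact Finset.sum_congr rfl fun i _ => by ring
  have hsupp : ∀ i ≤ k, ∀ t, f i t ≠ 0 → aI (q+1) τ i ≤ t ∧ t < τ (i+1) := by
    intro i hi t ht
    by_contra hcon
    apply ht
    simp only [hf, dseq]
    by_cases hc : aI (q+1) τ i ≤ t
    · have : τ (i+1) ≤ t := by omega
      rw [h.HI_one hi this, h.HI_one hi (by omega)]; ring
    · rw [h.HI_zero hi (by omega), h.HI_zero hi (by omega)]; ring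
  have hov := overlap (Finset.range (k+1)) q 1 f (by
    intro t
    rw [Finset.card_le_one]
    intro i hi j hj
    simp only [Finset.mem_filter, Finset.mem_range] at hi hj
    have hi2 := hsupp i (by omega) t hi.2
    have hj2 := hsupp j (by omega) t hj.2
    have := h.a_ge i
    have := h.a_ge j
    exact h.gap_unique (t := t) (by omega) (by omega) (by omega) hi2.2 (by omega) hj2.2) n
  simp only [e1]
  refine hov.trans ?_
  have hterm : ∀ i ∈ Finset.range (k+1), ∑ t ∈ Finset.range n, (dseq^[q] (f i) t) ^ 2 ≤
      (q+1 : ℕ) * 4 * CH ^ 2 * ((q+1 : ℕ) / c) ^ (2 * (q+1) - 1) * ((k + 1) / n : ℝ) ^ (2 * (q+1) - 1) := by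
    intro i hi
    have hi : i ≤ k := by have := Finset.mem_range.1 hi; omega
    have hc0 := h.hc0
    by_cases hs : s i = s (i+1)
    · have : f i = fun _ => 0 := by ext t; simp [hf, hs]
      simp only [this, dseq_it_zero]
      simp
      positivity
    · set L : ℝ := (τ (i+1) : ℝ) - aI (q+1) τ i with hL
      have hL1 : 1 ≤ L := h.L_pos hi
      have hcl : Cl (q+1) CH (1/L) (HI (q+1) τ i) := hCH _ _ _ (by rw [abs_of_nonneg (by positivity)])
      have hcl2 : Cl q (2 * (CH * (1 / L))) (1/L) (f i) := by
        intro l hl t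
        simp only [hf]
        rw [dseq_it_smul, abs_mul]
        have h1 := hcl (l+1) (by omega) t
        rw [Function.iterate_succ_apply] at h1
        have h2 : |s (i+1) - s i| ≤ 2 := by
          have a := abs_le.1 (h.sb i)
          have b := abs_le.1 (h.sb (i+1))
          rw [abs_le]; constructor <;> linarith
        calc _ ≤ 2 * (CH * (1/L) ^ (l+1)) := mul_le_mul h2 h1 (abs_nonneg _) (by norm_num)
          _ = _ := by ring
      refine (hcl2.sum_sq (aI (q+1) τ i) (τ (i+1)) (hsupp i hi) n).trans ?_
      rw [Nat.cast_sub (h.a_lt hi).le, ← hL]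
      have hm := h.ml i hi hs
      have hLg := h.L_ge hi
      rw [← hL] at hLg
      have hinv : 1 / L ≤ ((q+1 : ℕ) / c) * ((k + 1) / n : ℝ) := by
        rw [div_le_iff₀ (by linarith)]
        have h3 := hm.trans hLg
        rw [div_le_iff₀ (by positivity)] at h3
        have e : ((q+1 : ℕ) / c) * ((k + 1) / n : ℝ) * L = ((q+1 : ℕ) * L * (k+1)) / (c * n) := by field_simp
        rw [e, le_div_iff₀ (by positivity), one_mul]
        exact h3
      have e : 2 * (q+1) - 1 = 2 * q + 1 := by omega
      rw [e]
      have hL0 : L ≠ 0 := by positivity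
      calc (L + q) * (2 * (CH * (1/L)) * (1/L)^q) ^ 2
          ≤ ((q+1 : ℕ) * L) * (2 * (CH * (1/L)) * (1/L)^q) ^ 2 := by
            gcongr
            push_cast
            nlinarith [Nat.cast_nonneg (α := ℝ) q]
        _ = (q+1 : ℕ) * 4 * CH ^ 2 * ((1/L)^q) ^ 2 * (L * (1/L) * (1/L)) := by ring
        _ = (q+1 : ℕ) * 4 * CH ^ 2 * (1/L)^ (2 * q + 1) := by
            rw [mul_one_div_cancel hL0]; ring
        _ ≤ (q+1 : ℕ) * 4 * CH ^ 2 * (((q+1 : ℕ) / c) * ((k + 1) / n : ℝ)) ^ (2 * q + 1) := by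
            gcongr
        _ = _ := by rw [mul_pow]; ring
  have hsum := Finset.sum_le_sum hterm
  rw [Finset.sum_const, Finset.card_range, nsmul_eq_mul] at hsum
  calc _ ≤ ((q + 1) * (1:ℕ) : ℝ) * (((k+1 : ℕ) : ℝ) * ((q+1 : ℕ) * 4 * CH ^ 2 * ((q+1 : ℕ) / c) ^ (2 * (q+1) - 1) * ((k + 1) / n : ℝ) ^ (2 * (q+1) - 1))) := by
        gcongr
    _ = _ := by push_cast; ring

end KD

def Lg (τ : ℕ → ℕ) (i : ℕ) : ℕ := τ (i+1) - τ i
abbrev BI := (_ : ℕ) × ℕ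
def Bl (k : ℕ) (τ : ℕ → ℕ) : Finset BI :=
  (Finset.range (k+1)).sigma (fun i => Finset.range (wN (Lg τ i)))
def bp (τ : ℕ → ℕ) (B : BI) : ℕ := τ B.1 + wP (Lg τ B.1) B.2
def bq (τ : ℕ → ℕ) (B : BI) : ℕ := τ B.1 + wQ (Lg τ B.1) B.2
def bW (τ : ℕ → ℕ) (B : BI) : ℕ := 2 ^ wE (Lg τ B.1) B.2
def psi (τ : ℕ → ℕ) (B : BI) (t : ℕ) : ℝ :=
  Real.smoothTransition ((2 / (bW τ B : ℝ)) * t + (1 - 2 * bp τ B / (bW τ B : ℝ))) *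
  Real.smoothTransition ((- 2 / (bW τ B : ℝ)) * t + (1 + 2 * bq τ B / (bW τ B : ℝ)))

lemma bW_pos (τ : ℕ → ℕ) (B : BI) : 0 < bW τ B := by unfold bW; positivity
lemma bW_pos' (τ : ℕ → ℕ) (B : BI) : (1:ℝ) ≤ bW τ B := by exact_mod_cast bW_pos τ B

lemma psi_nonneg (τ : ℕ → ℕ) (B : BI) (t : ℕ) : 0 ≤ psi τ B t :=
  mul_nonneg (Real.smoothTransition.nonneg _) (Real.smoothTransition.nonneg _)
lemma psi_le_one (τ : ℕ → ℕ) (B : BI) (t : ℕ) : psi τ B t ≤ 1 :=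
  mul_le_one₀ (Real.smoothTransition.le_one _) (Real.smoothTransition.nonneg _) (Real.smoothTransition.le_one _)

lemma psi_one (τ : ℕ → ℕ) (B : BI) (t : ℕ) (h1 : bp τ B ≤ t) (h2 : t < bq τ B) : psi τ B t = 1 := by
  have hW := bW_pos' τ B
  have h1' : (bp τ B : ℝ) ≤ t := by exact_mod_cast h1
  have h2' : (t : ℝ) ≤ bq τ B := by exact_mod_cast h2.le
  unfold psi
  rw [Real.smoothTransition.one_of_one_le, Real.smoothTransition.one_of_one_le, one_mul]
  · have : (- 2 / (bW τ B : ℝ)) * t + (1 + 2 * bq τ B / (bW τ B : ℝ)) = 1 + 2 * (bq τ B - t) / bW τ B := by ring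
    rw [this]
    have : 0 ≤ 2 * ((bq τ B : ℝ) - t) / bW τ B := div_nonneg (by linarith) (by linarith)
    linarith
  · have : (2 / (bW τ B : ℝ)) * t + (1 - 2 * bp τ B / (bW τ B : ℝ)) = 1 + 2 * (t - bp τ B) / bW τ B := by ring
    rw [this]
    have : 0 ≤ 2 * ((t : ℝ) - bp τ B) / bW τ B := div_nonneg (by linarith) (by linarith)
    linarith

lemma psi_supp (τ : ℕ → ℕ) (B : BI) (t : ℕ) (h : psi τ B t ≠ 0) :
    2 * bp τ B < 2 * t + bW τ B ∧ 2 * t < 2 * bq τ B + bW τ B := by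
  have hW := bW_pos' τ B
  have hW0 : (0:ℝ) < bW τ B := by linarith
  unfold psi at h
  constructor
  · by_contra hcon
    apply h
    rw [Real.smoothTransition.zero_of_nonpos, zero_mul]
    have : (2 / (bW τ B : ℝ)) * t + (1 - 2 * bp τ B / (bW τ B : ℝ)) = (2 * t + bW τ B - 2 * bp τ B) / bW τ B := by field_simp; ring
    rw [this]
    have h3 : (2 * t + bW τ B : ℝ) ≤ 2 * bp τ B := by exact_mod_cast not_lt.1 hcon
    exact div_nonpos_of_nonpos_of_nonneg (by linarith) hW0.le
  · by_contra hcon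
    apply h
    rw [mul_comm, Real.smoothTransition.zero_of_nonpos, zero_mul]
    have : (-2 / (bW τ B : ℝ)) * t + (1 + 2 * bq τ B / (bW τ B : ℝ)) = (2 * bq τ B + bW τ B - 2 * t) / bW τ B := by field_simp; ring
    rw [this]
    have h3 : (2 * bq τ B + bW τ B : ℝ) ≤ 2 * t := by exact_mod_cast not_lt.1 hcon
    exact div_nonpos_of_nonpos_of_nonneg (by linarith) hW0.le

namespace KD
variable {r n k : ℕ} {c : ℝ} {τ : ℕ → ℕ} {s : ℕ → ℝ}

lemma mem_Bl {B : BI} (hB : B ∈ Bl k τ) : B.1 ≤ k ∧ B.2 < wN (Lg τ B.1) := by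
  unfold Bl at hB
  rw [Finset.mem_sigma, Finset.mem_range, Finset.mem_range] at hB
  exact ⟨by omega, hB.2⟩

lemma B_basic (h : KD r n k c τ s) {B : BI} (hB : B ∈ Bl k τ) :
    bW τ B ≤ Lg τ B.1 ∧ τ B.1 + bW τ B ≤ bp τ B ∧ bp τ B ≤ bq τ B ∧ bq τ B + bW τ B ≤ τ (B.1+1) ∧
      bq τ B - bp τ B ≤ 2 * bW τ B := by
  obtain ⟨h1, h2⟩ := mem_Bl hB
  obtain ⟨w1, w2, w3, w4, w5⟩ := w_basic h2
  have := h.hlt _ h1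
  unfold bW bp bq
  have : τ B.1 + Lg τ B.1 = τ (B.1 + 1) := by unfold Lg; omega
  omega

lemma psi_gap (h : KD r n k c τ s) {B : BI} (hB : B ∈ Bl k τ) {t : ℕ} (ht : psi τ B t ≠ 0) :
    τ B.1 < t ∧ t < τ (B.1+1) := by
  have h1 := h.B_basic hB
  have h2 := psi_supp τ B t ht
  have := bW_pos τ B
  omega

lemma psi_overlap (h : KD r n k c τ s) (t : ℕ) :
    (by classical exact ((Bl k τ).filter (fun B => psi τ B t ≠ 0)).card) ≤ 7 := by
  classical
  by_cases hne : ((Bl k τ).filter (fun B => psi τ B t ≠ 0)).Nonempty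
  · obtain ⟨B0, hB0⟩ := hne
    rw [Finset.mem_filter] at hB0
    have g0 := h.psi_gap hB0.1 hB0.2
    have m0 := mem_Bl hB0.1
    have hsub : (Bl k τ).filter (fun B => psi τ B t ≠ 0) ⊆
        ((Finset.range (wN (Lg τ B0.1))).filter (fun b => 2 * wP (Lg τ B0.1) b < 2 * (t - τ B0.1) + 2 ^ wE (Lg τ B0.1) b ∧
      2 * (t - τ B0.1) < 2 * wQ (Lg τ B0.1) b + 2 ^ wE (Lg τ B0.1) b)).image (fun b => (⟨B0.1, b⟩ : BI)) := by
      intro B hB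
      rw [Finset.mem_filter] at hB
      have g1 := h.psi_gap hB.1 hB.2
      have m1 := mem_Bl hB.1
      have e : B.1 = B0.1 := h.gap_unique (t := t) m1.1 m0.1 g1.1.le g1.2 g0.1.le g0.2
      have hs := psi_supp τ B t hB.2
      unfold bp bq bW at hs
      obtain ⟨i, b⟩ := B
      simp only at e hs m1 g1
      subst e
      rw [Finset.mem_image]
      refine ⟨b, ?_, rfl⟩
      rw [Finset.mem_filter, Finset.mem_range]
      refine ⟨m1.2, ?_⟩
      omega
    exact ((Finset.card_le_card hsub).trans Finset.card_image_le).trans (w_overlap _ _)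
  · rw [Finset.not_nonempty_iff_eq_empty] at hne
    convert Nat.zero_le 7
    rw [Finset.card_eq_zero]
    convert hne

lemma cover (h : KD r n k c τ s) {t : ℕ} (ht : t < n) :
    (∃ i ≤ k, t = τ i) ∨ (∃ i ≤ k, t = τ (i+1) - 1) ∨ ∃ B ∈ Bl k τ, bp τ B ≤ t ∧ t < bq τ B := by
  obtain ⟨i, hi, h1, h2⟩ := h.locate ht
  by_cases c1 : t = τ i
  · exact Or.inl ⟨i, hi, c1⟩
  by_cases c2 : t = τ (i+1) - 1
  · exact Or.inr (Or.inl ⟨i, hi, c2⟩)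
  right; right
  obtain ⟨b, hb, hb1, hb2⟩ := w_cover (L := Lg τ i) (y := t - τ i) (by omega) (by unfold Lg; omega)
  refine ⟨⟨i, b⟩, ?_, ?_⟩
  · unfold Bl; rw [Finset.mem_sigma, Finset.mem_range, Finset.mem_range]; exact ⟨by simp; omega, hb⟩
  · unfold bp bq; simp only; omega

lemma card_Bl : ((Bl k τ).card : ℝ) = ∑ i ∈ Finset.range (k+1), (wN (Lg τ i) : ℝ) := by
  unfold Bl; rw [Finset.card_sigma]; simp

lemma sum_Lg (h : KD r n k c τ s) : ∑ i ∈ Finset.range (k+1), Lg τ i = n := by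
  have : ∀ m ≤ k + 1, ∑ i ∈ Finset.range m, Lg τ i = τ m := by
    intro m
    induction m with
    | zero => intro _; simp [h.h0]
    | succ m ih =>
      intro hm
      rw [Finset.sum_range_succ, ih (by omega)]
      have := h.hlt m (by omega)
      unfold Lg; omega
  rw [this _ le_rfl, h.hn]

lemma card_bd (h : KD r n k c τ s) : ((Bl k τ).card : ℝ) + (k + 1) ≤
    5 * ((k + 1 : ℝ) * Real.log (Real.exp 1 * n / (k + 1))) := by
  rw [card_Bl]
  exact wN_total k n (Lg τ) (fun i hi => by have := h.hlt i hi; unfold Lg; omega) h.sum_Lg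

lemma sum_bW (h : KD r n k c τ s) : ∑ B ∈ Bl k τ, (bW τ B : ℝ) ≤ 2 * n := by
  have : ∑ B ∈ Bl k τ, bW τ B ≤ 2 * n := by
    unfold Bl
    rw [Finset.sum_sigma]
    calc _ ≤ ∑ i ∈ Finset.range (k+1), 2 * Lg τ i := Finset.sum_le_sum fun i _ => w_sum (Lg τ i)
      _ = _ := by rw [← Finset.mul_sum, h.sum_Lg]
  exact_mod_cast this

lemma bW_le_n (h : KD r n k c τ s) {B : BI} (hB : B ∈ Bl k τ) : (bW τ B : ℝ) ≤ n := by
  have h1 := h.B_basic hB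
  have h2 := h.mono (show B.1 + 1 ≤ k + 1 by have := (mem_Bl hB).1; omega) le_rfl
  rw [h.hn] at h2
  have : bW τ B ≤ n := by omega
  exact_mod_cast this

def fB (r : ℕ) (τ : ℕ → ℕ) (s : ℕ → ℝ) (B : BI) (t : ℕ) : ℝ := uI r τ s B.1 t * psi τ B t

lemma fB_energy (h : KD r n k c τ s) {CH : ℝ} (hCH1 : 1 ≤ CH) (hCH : ∀ a b h : ℝ, |a| ≤ h →
    Cl r CH h (fun t : ℕ => Real.smoothTransition (a * t + b))) {B : BI} (hB : B ∈ Bl k τ) :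
    ∑ t ∈ Finset.range n, (dseq^[r] (fB r τ s B) t) ^ 2 ≤
      ((4 + r) * ((1 + 2 * CH) * (CH * CH) * (r + 4) ^ r) ^ 2) * ((bW τ B : ℝ) * (1 / (bW τ B : ℝ)) ^ (2 * r)) := by
  have hW := bW_pos' τ B
  set W : ℝ := ((bW τ B : ℕ) : ℝ) with hWdef
  have hb := h.B_basic hB
  have hi := (mem_Bl hB).1
  have hL := h.L_pos hi
  have hLg := h.L_ge hi
  set L' : ℝ := (τ (B.1+1) : ℝ) - aI r τ B.1 with hL'
  have hWL : W ≤ r * L' := by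
    refine le_trans ?_ hLg
    rw [hWdef]; exact_mod_cast hb.1
  have c1 : Cl r CH (1 / L') (HI r τ B.1) := hCH _ _ _ (by rw [abs_of_nonneg (by positivity)])
  have c2 : Cl r (|s B.1| + |s (B.1+1) - s B.1| * CH) (1 / L') (uI r τ s B.1) := c1.affine (by positivity)
  have a := abs_le.1 (h.sb B.1)
  have b := abs_le.1 (h.sb (B.1+1))
  have hd : |s (B.1+1) - s B.1| ≤ 2 := by rw [abs_le]; constructor <;> linarith
  have c3 : Cl r (1 + 2 * CH) (r / W) (uI r τ s B.1) := by
    refine c2.mono (by positivity) ?_ (by positivity) ?_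
    · have := h.sb B.1
      nlinarith [abs_nonneg (s (B.1+1) - s B.1)]
    · rw [div_le_div_iff₀ (by positivity) (by positivity)]; linarith
  have c4 : Cl r (CH * CH) (2 / W + 2 / W) (psi τ B) := by
    refine Cl.mul (hCH _ _ _ ?_) (hCH _ _ _ ?_)
    · rw [abs_of_nonneg (by positivity)]
    · rw [neg_div, abs_neg, abs_of_nonneg (by positivity)]
  have c5 : Cl r ((1 + 2 * CH) * (CH * CH)) (r / W + (2 / W + 2 / W)) (fB r τ s B) := c3.mul c4
  have c6 := c5.sum_sq (bp τ B - bW τ B) (bq τ B + bW τ B) (by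
    intro t ht
    have : psi τ B t ≠ 0 := right_ne_zero_of_mul ht
    have := psi_supp τ B t this
    omega) n
  refine c6.trans ?_
  have e1 : (((bq τ B + bW τ B) - (bp τ B - bW τ B) : ℕ) : ℝ) ≤ 4 * W := by
    rw [hWdef]
    exact_mod_cast (by omega : (bq τ B + bW τ B) - (bp τ B - bW τ B) ≤ 4 * bW τ B)
  have e2 : (r / W + (2 / W + 2 / W)) = (r + 4) * (1 / W) := by ring
  rw [e2]
  have hr0 : (0:ℝ) ≤ r := Nat.cast_nonneg _
  calc _ ≤ ((4 + r) * W) * ((1 + 2 * CH) * (CH * CH) * ((r + 4) * (1 / W)) ^ r) ^ 2 := by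
        gcongr
        nlinarith
    _ = _ := by rw [mul_pow ((r:ℝ)+4)]; ring

end KD

def cB (r : ℕ) (τ : ℕ → ℕ) (R : ℕ → ℝ) (B : BI) : ℝ :=
  (2 * (bW τ B : ℝ)) ^ (2 * r - 3) * ∑ t ∈ Finset.Ico (bp τ B) (bq τ B), sumS R t ^ 2

lemma cB_nonneg (r : ℕ) (τ : ℕ → ℕ) (R : ℕ → ℝ) (B : BI) : 0 ≤ cB r τ R B :=
  mul_nonneg (by positivity) (Finset.sum_nonneg fun _ _ => sq_nonneg _)

namespace KD
variable {r n k : ℕ} {c : ℝ} {τ : ℕ → ℕ} {s : ℕ → ℝ}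

lemma u0_psi (h : KD r n k c τ s) {B : BI} (hB : B ∈ Bl k τ) (t : ℕ) :
    u0 r k τ s t * psi τ B t = fB r τ s B t := by
  unfold fB
  by_cases hp : psi τ B t = 0
  · rw [hp, mul_zero, mul_zero]
  · have g := h.psi_gap hB hp
    rw [h.u0_eq (mem_Bl hB).1 g.1.le g.2.le]

lemma psi_tau (h : KD r n k c τ s) {B : BI} (hB : B ∈ Bl k τ) {i : ℕ} (hi : i ≤ k + 1) : psi τ B (τ i) = 0 := by
  by_contra hp
  have g := h.psi_gap hB hp
  have hb := (mem_Bl hB).1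
  rcases Nat.lt_or_ge B.1 i with h1 | h1
  · have := h.mono (show B.1 + 1 ≤ i by omega) hi
    omega
  · have := h.mono h1 (by omega)
    omega

/-- the deterministic part of the construction -/
lemma constr (h : KD r n k c τ s) (R : ℕ → ℝ) (hR : ∀ t, n ≤ t → R t = 0)
    (hτ : ∀ i ≤ k + 1, ∀ l, 1 ≤ l → l ≤ r → sumS^[l] R (τ i) = 0)
    (hτ' : ∀ i ≤ k, ∀ l, 1 ≤ l → l ≤ r → sumS^[l] R (τ (i+1) - 1) = 0)
    (hb : ∀ B ∈ Bl k τ, ∀ l, 1 ≤ l → l ≤ r → sumS^[l] R (bp τ B) = 0) :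
    ∃ U, GoodU r n k τ s (Real.sqrt (7 * ∑ B ∈ Bl k τ, cB r τ R B)) U ∧
      ∀ t, (-1) ^ r * dseq^[r] U t = R t + (-1) ^ r * (Real.sqrt (7 * ∑ B ∈ Bl k τ, cB r τ R B) * dseq^[r] (u0 r k τ s) t
        - ∑ B ∈ Bl k τ, dseq^[r] (fun t => Real.sqrt (cB r τ R B) * fB r τ s B t) t) := by
  classical
  have hr := h.hr
  set μ := Real.sqrt (7 * ∑ B ∈ Bl k τ, cB r τ R B) with hμ
  set Ψ : ℕ → ℝ := fun t => ∑ B ∈ Bl k τ, Real.sqrt (cB r τ R B) * psi τ B t with hΨ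
  set x := sumS^[r] R with hx
  have hg := h.u0_good
  have hΨμ : ∀ t, Ψ t ≤ μ := by
    intro t
    apply Real.le_sqrt_of_sq_le
    have e1 : Ψ t = ∑ B ∈ (Bl k τ).filter (fun B => psi τ B t ≠ 0), Real.sqrt (cB r τ R B) * psi τ B t := by
      rw [Finset.sum_filter_of_ne]
      intro B _ hB; exact right_ne_zero_of_mul hB
    rw [e1]
    refine (sq_sum_le_card_mul_sum_sq).trans ?_
    have e2 : ∑ B ∈ (Bl k τ).filter (fun B => psi τ B t ≠ 0), (Real.sqrt (cB r τ R B) * psi τ B t) ^ 2 ≤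
        ∑ B ∈ Bl k τ, cB r τ R B := by
      refine (Finset.sum_le_sum_of_subset_of_nonneg (Finset.filter_subset _ _) (fun _ _ _ => sq_nonneg _)).trans ?_
      refine Finset.sum_le_sum fun B _ => ?_
      rw [mul_pow, Real.sq_sqrt (cB_nonneg _ _ _ _)]
      have h1 := psi_nonneg τ B t
      have h2 := psi_le_one τ B t
      exact mul_le_of_le_one_right (cB_nonneg _ _ _ _) (pow_le_one₀ h1 h2)
    have e3 : (((Bl k τ).filter (fun B => psi τ B t ≠ 0)).card : ℝ) ≤ 7 := by
      have := h.psi_overlap t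
      exact_mod_cast (by convert this)
    exact mul_le_mul e3 e2 (Finset.sum_nonneg fun _ _ => sq_nonneg _) (by norm_num)
  have hΨ0 : ∀ t, 0 ≤ Ψ t := fun t => Finset.sum_nonneg fun B _ => mul_nonneg (Real.sqrt_nonneg _) (psi_nonneg _ _ _)
  have hxt : ∀ t, n ≤ t → x t = 0 := by
    intro t ht
    refine sumS_it_tail R n r hR ?_ r le_rfl t ht
    have := hτ (k+1) le_rfl
    rwa [h.hn] at this
  have hxb : ∀ t, |x t| ≤ Ψ t := by
    intro t
    rcases Nat.lt_or_ge t n with ht | ht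
    · rcases h.cover ht with ⟨i, hi, rfl⟩ | ⟨i, hi, rfl⟩ | ⟨B, hB, h1, h2⟩
      · rw [hx, hτ i (by omega) r (by omega) le_rfl, abs_zero]; exact hΨ0 _
      · rw [hx, hτ' i hi r (by omega) le_rfl, abs_zero]; exact hΨ0 _
      · have hbb := h.B_basic hB
        have := block_sq R (bp τ B) (bq τ B) (2 * bW τ B) (by exact_mod_cast hbb.2.2.2.2) r hr (hb B hB) t h1 h2
        refine this.trans ?_
        have e : Real.sqrt (cB r τ R B) * psi τ B t ≤ Ψ t :=
          Finset.single_le_sum (f := fun B => Real.sqrt (cB r τ R B) * psi τ B t)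
            (fun B _ => mul_nonneg (Real.sqrt_nonneg _) (psi_nonneg _ _ _)) hB
        rw [psi_one τ B t h1 h2, mul_one] at e
        exact e
    · rw [hxt t ht, abs_zero]; exact hΨ0 _
  refine ⟨fun t => u0 r k τ s t * (μ - Ψ t) + (-1) ^ r * x t, ⟨?_, ?_, ?_, ?_⟩, ?_⟩
  · intro t ht
    simp only [hg.z0 t ht, hx, sumS_it_zero r R t ht]; simp
  · intro t ht
    simp only [hg.zn t ht, hxt t ht]; simp
  · intro t
    have h1 := hg.bd t
    have h2 := hxb t
    have h3 := hΨμ t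
    refine (abs_add_le _ _).trans ?_
    rw [abs_mul, abs_mul, abs_pow, abs_neg, abs_one, one_pow, one_mul, abs_of_nonneg (sub_nonneg.2 h3)]
    nlinarith [sub_nonneg.2 h3]
  · intro i h1 h2
    have e1 : x (τ i) = 0 := hτ i (by omega) r (by omega) le_rfl
    have e2 : Ψ (τ i) = 0 := Finset.sum_eq_zero fun B hB => by rw [h.psi_tau hB (by omega), mul_zero]
    simp only [e1, e2, hg.kn i h1 h2]; ring
  · intro t
    have e : (fun t => u0 r k τ s t * (μ - Ψ t) + (-1) ^ r * x t) =
        fun t => (μ * u0 r k τ s t + (-1) * (∑ B ∈ Bl k τ, Real.sqrt (cB r τ R B) * fB r τ s B t)) + (-1) ^ r * x t := by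
      funext t
      have : ∑ B ∈ Bl k τ, Real.sqrt (cB r τ R B) * fB r τ s B t = u0 r k τ s t * Ψ t := by
        rw [hΨ, Finset.mul_sum]
        refine Finset.sum_congr rfl fun B hB => ?_
        rw [← h.u0_psi hB]; ring
      rw [this]; ring
    rw [e, dseq_it_add, dseq_it_add, dseq_it_smul, dseq_it_smul, dseq_it_smul, dseq_it_sum, hx, dseq_sumS_it]
    have : ((-1:ℝ)^r) * (-1)^r = 1 := by rw [← mul_pow]; simp
    linear_combination (R t) * this

lemma cB_int (h : KD r n k c τ s) (P : (Fin n → ℝ) →ₗ[ℝ] (Fin n → ℝ))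
    (hP : ∀ a : Fin n → ℝ, ∃ b : Fin n → ℝ, ∑ i, b i ^ 2 ≤ ∑ i, a i ^ 2 ∧
        ∀ z, ∑ i, a i * (z - P z) i = ∑ i, b i * z i) {B : BI} (hB : B ∈ Bl k τ)
    (h0 : ∀ z, sumS (pad (z - P z)) (bp τ B) = 0) :
    Integrable (fun z => cB r τ (pad (z - P z)) B) (gaussVec n 1) ∧
    ∫ z, cB r τ (pad (z - P z)) B ∂gaussVec n 1 ≤ (2 * (bW τ B : ℝ)) ^ (2 * r - 1) := by
  have hr := h.hr
  have hbb := h.B_basic hB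
  have hm := fun t (ht : t ∈ Finset.Ico (bp τ B) (bq τ B)) =>
    resid_moment P hP (bp τ B) t (Finset.mem_Ico.1 ht).1 h0
  have hI : Integrable (fun z => ∑ t ∈ Finset.Ico (bp τ B) (bq τ B), sumS (pad (z - P z)) t ^ 2) (gaussVec n 1) :=
    integrable_finsetSum _ fun t ht => (hm t ht).1
  refine ⟨hI.const_mul _, ?_⟩
  unfold cB
  rw [integral_const_mul, integral_finsetSum _ fun t ht => (hm t ht).1]
  have h1 : ∑ t ∈ Finset.Ico (bp τ B) (bq τ B), ∫ z, sumS (pad (z - P z)) t ^ 2 ∂gaussVec n 1 ≤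
      (2 * (bW τ B : ℝ)) * (2 * (bW τ B : ℝ)) := by
    refine (Finset.sum_le_card_nsmul _ _ (2 * (bW τ B : ℝ)) (fun t ht => (hm t ht).2.trans ?_)).trans ?_
    · have := Finset.mem_Ico.1 ht
      exact_mod_cast (by omega : t - bp τ B ≤ 2 * bW τ B)
    · rw [Nat.card_Ico, nsmul_eq_mul]
      have : ((bq τ B - bp τ B : ℕ) : ℝ) ≤ 2 * bW τ B := by exact_mod_cast hbb.2.2.2.2
      gcongr
  calc _ ≤ (2 * (bW τ B : ℝ)) ^ (2 * r - 3) * ((2 * (bW τ B : ℝ)) * (2 * (bW τ B : ℝ))) := by gcongr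
    _ = _ := by
      obtain ⟨m, rfl⟩ : ∃ m, r = m + 2 := ⟨r - 2, by omega⟩
      rw [show 2 * (m+2) - 3 = 2*m+1 by omega, show 2 * (m+2) - 1 = 2*m+3 by omega]; ring

lemma sum_W (h : KD r n k c τ s) : ∑ B ∈ Bl k τ, (2 * (bW τ B : ℝ)) ^ (2 * r - 1) ≤ 2 * (2 * (n:ℝ)) ^ (2 * r - 1) := by
  have hr := h.hr
  obtain ⟨m, hm⟩ : ∃ m, 2 * r - 1 = m + 1 := ⟨2 * r - 2, by omega⟩
  rw [hm]
  calc _ ≤ ∑ B ∈ Bl k τ, (2 * (n:ℝ)) ^ m * 2 * (bW τ B : ℝ) := by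
        refine Finset.sum_le_sum fun B hB => ?_
        have := h.bW_le_n hB
        rw [pow_succ]
        have : (2 * (bW τ B : ℝ)) ^ m ≤ (2 * (n:ℝ)) ^ m := by gcongr
        nlinarith [bW_pos' τ B]
    _ ≤ (2 * (n:ℝ)) ^ m * 2 * (2 * n) := by
        rw [← Finset.mul_sum]; gcongr; exact h.sum_bW
    _ = _ := by ring

end KD

lemma three_sq (a b d : ℝ) : (a - (b - d)) ^ 2 ≤ 3 * (a ^ 2 + b ^ 2 + d ^ 2) := by
  nlinarith [sq_nonneg (a + b), sq_nonneg (a - d), sq_nonneg (b + d)]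

lemma pad_tail {n : ℕ} (z : Fin n → ℝ) (t : ℕ) (ht : n ≤ t) : pad z t = 0 := by
  unfold pad; rw [dif_neg (by omega)]
lemma pad_fin {n : ℕ} (z : Fin n → ℝ) (i : Fin n) : pad z i = z i := by
  unfold pad; rw [dif_pos i.2]

namespace KD
variable {r n k : ℕ} {c : ℝ} {τ : ℕ → ℕ} {s : ℕ → ℝ}

abbrev IX (r k : ℕ) (τ : ℕ → ℕ) : Type := Fin r × (Fin (k+2) ⊕ (Fin (k+1) ⊕ {B : BI // B ∈ Bl k τ}))
def pt (τ : ℕ → ℕ) (k : ℕ) : (Fin (k+2) ⊕ (Fin (k+1) ⊕ {B : BI // B ∈ Bl k τ})) → ℕ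
  | Sum.inl i => τ i
  | Sum.inr (Sum.inl i) => τ (i+1) - 1
  | Sum.inr (Sum.inr B) => bp τ B.1

lemma core (h : KD r n k c τ s) {CH : ℝ} (hCH1 : 1 ≤ CH) (hCH : ∀ a b h : ℝ, |a| ≤ h →
    Cl r CH h (fun t : ℕ => Real.smoothTransition (a * t + b))) :
    ∃ Q : (Fin n → ℝ) → ℝ, Integrable Q (gaussVec n 1) ∧
      (∀ z, ∃ μ U, 0 ≤ μ ∧ GoodU r n k τ s μ U ∧ ∑ i : Fin n, (z i - (-1) ^ r * dseq^[r] U i) ^ 2 ≤ Q z) ∧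
      ∫ z, Q z ∂gaussVec n 1 ≤
        3 * (15 * r * ((k + 1 : ℝ) * Real.log (Real.exp 1 * n / (k + 1)))
          + 14 * 2 ^ (2 * r - 1) * (r * (r * 4 * CH ^ 2 * (r / c) ^ (2 * r - 1))) * (k + 1 : ℝ) ^ (2 * r)
          + 35 * (r + 1) * 2 ^ (2 * r - 1) * ((4 + r) * ((1 + 2 * CH) * (CH * CH) * (r + 4) ^ r) ^ 2) *
              ((k + 1 : ℝ) * Real.log (Real.exp 1 * n / (k + 1)))) := by
  classical
  have hr := h.hr
  have hc0 := h.hc0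
  have hn := h.n_pos
  set K0 : ℝ := (r * (r * 4 * CH ^ 2 * (r / c) ^ (2 * r - 1))) with hK0
  set K1 : ℝ := ((4 + r) * ((1 + 2 * CH) * (CH * CH) * (r + 4) ^ r) ^ 2) with hK1
  have hK0p : 0 ≤ K0 := by positivity
  have hK1p : 0 ≤ K1 := by positivity
  obtain ⟨P, hP1, hP2, hP3, hP4⟩ := exists_proj (n := n) (ι := IX r k τ) (fun x => phiF (x.1.1 + 1) (pt τ k x.2))
  have hz : ∀ x : (Fin (k+2) ⊕ (Fin (k+1) ⊕ {B : BI // B ∈ Bl k τ})), ∀ z : Fin n → ℝ, ∀ l, 1 ≤ l → l ≤ r →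
      sumS^[l] (pad (z - P z)) (pt τ k x) = 0 := by
    intro x z l h1 h2
    have := hP1 (⟨⟨l - 1, by omega⟩, x⟩) z
    simp only at this
    rw [show l - 1 + 1 = l by omega] at this
    exact this
  have hcard : ((Fintype.card (IX r k τ) : ℕ) : ℝ) ≤ 15 * r * ((k + 1 : ℝ) * Real.log (Real.exp 1 * n / (k + 1))) := by
    rw [Fintype.card_prod, Fintype.card_sum, Fintype.card_sum, Fintype.card_fin, Fintype.card_fin, Fintype.card_fin,
      Fintype.card_coe]
    have := h.card_bd
    have hr0 : (0:ℝ) ≤ r := Nat.cast_nonneg r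
    push_cast
    have hB0 : (0:ℝ) ≤ (Bl k τ).card := Nat.cast_nonneg _
    have hk0 : (0:ℝ) ≤ k := Nat.cast_nonneg _
    calc _ ≤ (r:ℝ) * (3 * ((Bl k τ).card + (k+1))) := by gcongr; linarith
      _ ≤ (r:ℝ) * (3 * (5 * ((k + 1 : ℝ) * Real.log (Real.exp 1 * n / (k + 1))))) := by gcongr
      _ = _ := by ring
  have hcBi := fun B (hB : B ∈ Bl k τ) => h.cB_int P hP2 hB (fun z => by
    have := hz (Sum.inr (Sum.inr ⟨B, hB⟩)) z 1 le_rfl (by omega)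
    exact this)
  set E0 := ∑ t ∈ Finset.range n, (dseq^[r] (u0 r k τ s) t) ^ 2 with hE0
  set EB : BI → ℝ := fun B => ∑ t ∈ Finset.range n, (dseq^[r] (fB r τ s B) t) ^ 2 with hEB
  have hE0' : E0 ≤ K0 * ((k+1) * ((k + 1) / n : ℝ) ^ (2 * r - 1)) := h.u0_energy hCH1 hCH
  have hE00 : 0 ≤ E0 := Finset.sum_nonneg fun _ _ => sq_nonneg _
  have hEB' : ∀ B ∈ Bl k τ, EB B ≤ K1 * ((bW τ B : ℝ) * (1 / (bW τ B : ℝ)) ^ (2 * r)) :=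
    fun B hB => h.fB_energy hCH1 hCH hB
  have hEB0 : ∀ B, 0 ≤ EB B := fun B => Finset.sum_nonneg fun _ _ => sq_nonneg _
  have I1 : Integrable (fun z => ∑ B ∈ Bl k τ, cB r τ (pad (z - P z)) B) (gaussVec n 1) :=
    integrable_finsetSum _ fun B hB => (hcBi B hB).1
  have I2 : Integrable (fun z => ∑ B ∈ Bl k τ, cB r τ (pad (z - P z)) B * EB B) (gaussVec n 1) :=
    integrable_finsetSum _ fun B hB => (hcBi B hB).1.mul_const _
  have J1 : Integrable (fun z => (7 * E0) * ∑ B ∈ Bl k τ, cB r τ (pad (z - P z)) B) (gaussVec n 1) := I1.const_mul _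
  have J2 : Integrable (fun z => ((r + 1) * 7 : ℝ) * ∑ B ∈ Bl k τ, cB r τ (pad (z - P z)) B * EB B) (gaussVec n 1) :=
    I2.const_mul _
  have J3 : Integrable (fun z => sqnorm (P z) + (7 * E0) * ∑ B ∈ Bl k τ, cB r τ (pad (z - P z)) B) (gaussVec n 1) :=
    hP3.add J1
  refine ⟨fun z => 3 * (sqnorm (P z) + (7 * E0) * (∑ B ∈ Bl k τ, cB r τ (pad (z - P z)) B) +
    ((r + 1) * 7 : ℝ) * ∑ B ∈ Bl k τ, cB r τ (pad (z - P z)) B * EB B), ?_, ?_, ?_⟩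
  · exact (J3.add J2).const_mul 3
  · intro z
    set R := pad (z - P z) with hR
    obtain ⟨U, hU, hU2⟩ := h.constr R (fun t ht => pad_tail _ t ht)
      (fun i hi l h1 h2 => hz (Sum.inl ⟨i, by omega⟩) z l h1 h2)
      (fun i hi l h1 h2 => hz (Sum.inr (Sum.inl ⟨i, by omega⟩)) z l h1 h2)
      (fun B hB l h1 h2 => hz (Sum.inr (Sum.inr ⟨B, hB⟩)) z l h1 h2)
    set μ := Real.sqrt (7 * ∑ B ∈ Bl k τ, cB r τ R B) with hμ
    have hM0 : 0 ≤ ∑ B ∈ Bl k τ, cB r τ R B := Finset.sum_nonneg fun _ _ => cB_nonneg _ _ _ _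
    refine ⟨μ, U, Real.sqrt_nonneg _, hU, ?_⟩
    set S : ℕ → ℝ := fun t => ∑ B ∈ Bl k τ, dseq^[r] (fun t => Real.sqrt (cB r τ R B) * fB r τ s B t) t with hS
    have e1 : ∑ i : Fin n, (z i - (-1) ^ r * dseq^[r] U i) ^ 2 ≤
        ∑ i : Fin n, 3 * ((P z i) ^ 2 + (μ * dseq^[r] (u0 r k τ s) i) ^ 2 + (S i) ^ 2) := by
      refine Finset.sum_le_sum fun i _ => ?_
      have e : z i - (-1) ^ r * dseq^[r] U i = P z i - ((-1) ^ r * (μ * dseq^[r] (u0 r k τ s) i) - (-1) ^ r * S i) := by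
        rw [hU2 i, hR, pad_fin, Pi.sub_apply]; ring
      rw [e]
      refine (three_sq _ _ _).trans (le_of_eq ?_)
      rw [mul_pow ((-1:ℝ)^r), mul_pow ((-1:ℝ)^r), ← pow_mul, mul_comm r 2, pow_mul]; simp
    refine e1.trans ?_
    rw [← Finset.mul_sum, Finset.sum_add_distrib, Finset.sum_add_distrib]
    have e2 : ∑ i : Fin n, (μ * dseq^[r] (u0 r k τ s) i) ^ 2 = (7 * E0) * (∑ B ∈ Bl k τ, cB r τ R B) := by
      rw [Fin.sum_univ_eq_sum_range (fun i => (μ * dseq^[r] (u0 r k τ s) i) ^ 2)]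
      simp only [mul_pow]
      rw [← Finset.mul_sum, hμ, Real.sq_sqrt (by positivity)]; ring
    have e3 : ∑ i : Fin n, (S i) ^ 2 ≤ ((r + 1) * 7 : ℝ) * ∑ B ∈ Bl k τ, cB r τ R B * EB B := by
      rw [Fin.sum_univ_eq_sum_range (fun i => (S i) ^ 2)]
      refine (overlap (Bl k τ) r 7 (fun B t => Real.sqrt (cB r τ R B) * fB r τ s B t) ?_ n).trans (le_of_eq ?_)
      · intro t
        refine le_trans (Finset.card_le_card ?_) (h.psi_overlap t)
        intro B hB
        rw [Finset.mem_filter] at hB ⊢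
        exact ⟨hB.1, right_ne_zero_of_mul (right_ne_zero_of_mul hB.2)⟩
      · push_cast
        congr 1
        refine Finset.sum_congr rfl fun B _ => ?_
        rw [hEB, Finset.mul_sum]
        refine Finset.sum_congr rfl fun t _ => ?_
        rw [dseq_it_smul, mul_pow, Real.sq_sqrt (cB_nonneg _ _ _ _)]
    have e4 : ∑ i : Fin n, (P z i) ^ 2 = sqnorm (P z) := rfl
    rw [e2, e4]
    linarith
  · rw [integral_const_mul, integral_add J3 J2, integral_add hP3 J1, integral_const_mul, integral_const_mul,
      integral_finsetSum _ (fun B hB => (hcBi B hB).1), integral_finsetSum _ (fun B hB => (hcBi B hB).1.mul_const _)]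
    have t1 := hP4.trans hcard
    have hn' : (0:ℝ) < n := by exact_mod_cast hn
    have t2 : 7 * E0 * ∑ B ∈ Bl k τ, ∫ z, cB r τ (pad (z - P z)) B ∂gaussVec n 1 ≤
        14 * 2 ^ (2 * r - 1) * K0 * (k + 1 : ℝ) ^ (2 * r) := by
      calc _ ≤ 7 * (K0 * ((k+1) * ((k + 1) / n : ℝ) ^ (2 * r - 1))) * (2 * (2 * (n:ℝ)) ^ (2 * r - 1)) := by
            have : ∑ B ∈ Bl k τ, ∫ z, cB r τ (pad (z - P z)) B ∂gaussVec n 1 ≤ 2 * (2 * (n:ℝ)) ^ (2 * r - 1) :=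
              (Finset.sum_le_sum fun B hB => (hcBi B hB).2).trans h.sum_W
            have h0 : 0 ≤ ∑ B ∈ Bl k τ, ∫ z, cB r τ (pad (z - P z)) B ∂gaussVec n 1 :=
              Finset.sum_nonneg fun B _ => integral_nonneg fun z => cB_nonneg _ _ _ _
            gcongr
        _ = _ := by
            obtain ⟨m, rfl⟩ : ∃ m, r = m + 1 := ⟨r - 1, by omega⟩
            rw [show 2 * (m+1) - 1 = 2*m+1 by omega, show 2 * (m+1) = 2*m+1+1 by omega, div_pow, mul_pow]
            field_simp
            ring
    have t3 : ((r + 1) * 7 : ℝ) * ∑ B ∈ Bl k τ, ∫ z, cB r τ (pad (z - P z)) B * EB B ∂gaussVec n 1 ≤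
        35 * (r + 1) * 2 ^ (2 * r - 1) * K1 * ((k + 1 : ℝ) * Real.log (Real.exp 1 * n / (k + 1))) := by
      have : ∀ B ∈ Bl k τ, ∫ z, cB r τ (pad (z - P z)) B * EB B ∂gaussVec n 1 ≤ 2 ^ (2 * r - 1) * K1 := by
        intro B hB
        rw [integral_mul_const]
        have hW := bW_pos' τ B
        calc _ ≤ (2 * (bW τ B : ℝ)) ^ (2 * r - 1) * (K1 * ((bW τ B : ℝ) * (1 / (bW τ B : ℝ)) ^ (2 * r))) :=
              mul_le_mul (hcBi B hB).2 (hEB' B hB) (hEB0 B) (by positivity)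
          _ = _ := by
            have hW0 : (0:ℝ) < bW τ B := by linarith
            obtain ⟨m, rfl⟩ : ∃ m, r = m + 1 := ⟨r - 1, by omega⟩
            rw [show 2 * (m+1) - 1 = 2*m+1 by omega, show 2 * (m+1) = 2*m+1+1 by omega, one_div, inv_pow, mul_pow]
            field_simp
            ring
      have h2 := Finset.sum_le_card_nsmul _ _ _ this
      rw [nsmul_eq_mul] at h2
      have h3 := h.card_bd
      have hk0 : (0:ℝ) ≤ k := Nat.cast_nonneg _
      have h4 : ((Bl k τ).card : ℝ) ≤ 5 * ((k + 1 : ℝ) * Real.log (Real.exp 1 * n / (k + 1))) := by linarith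
      calc _ ≤ ((r + 1) * 7 : ℝ) * ((5 * ((k + 1 : ℝ) * Real.log (Real.exp 1 * n / (k + 1)))) * (2 ^ (2 * r - 1) * K1)) := by
            refine mul_le_mul_of_nonneg_left (h2.trans ?_) (by positivity)
            exact mul_le_mul_of_nonneg_right h4 (by positivity)
        _ = _ := by ring
    linarith

end KD

/-- The core construction with a constant depending only on `r` and `c`. -/
lemma core_exists (r : ℕ) (c : ℝ) (hc : 0 < c) : ∃ C : ℝ, 0 < C ∧ ∀ (n k : ℕ) (τ : ℕ → ℕ) (s : ℕ → ℝ), KD r n k c τ s →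
    (∃ Q : (Fin n → ℝ) → ℝ, Integrable Q (gaussVec n 1) ∧
      (∀ z, ∃ μ U, 0 ≤ μ ∧ GoodU r n k τ s μ U ∧ ∑ i : Fin n, (z i - (-1) ^ r * dseq^[r] U i) ^ 2 ≤ Q z) ∧
      ∫ z, Q z ∂gaussVec n 1 ≤ C * ((k + 1 : ℝ) * Real.log (Real.exp 1 * n / (k + 1)) + (k + 1 : ℝ) ^ (2 * r))) ∧
    ∃ U, GoodU r n k τ s 1 U ∧
      ∑ i : Fin n, ((-1) ^ r * dseq^[r] U i) ^ 2 ≤ C * ((k+1) * ((k + 1) / n : ℝ) ^ (2 * r - 1)) := by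
  obtain ⟨CH, hCH1, hCH⟩ := exists_CH r
  set K0 : ℝ := (r * (r * 4 * CH ^ 2 * (r / c) ^ (2 * r - 1))) with hK0
  set K1 : ℝ := ((4 + r) * ((1 + 2 * CH) * (CH * CH) * (r + 4) ^ r) ^ 2) with hK1
  have hK0p : 0 ≤ K0 := by positivity
  have hK1p : 0 ≤ K1 := by positivity
  have hA : (0:ℝ) ≤ 3 * (15 * r + 35 * (r + 1) * 2 ^ (2 * r - 1) * K1) := by positivity
  have hB : (0:ℝ) ≤ 3 * (14 * 2 ^ (2 * r - 1) * K0) := by positivity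
  refine ⟨3 * (15 * r + 35 * (r + 1) * 2 ^ (2 * r - 1) * K1) + 3 * (14 * 2 ^ (2 * r - 1) * K0) + K0 + 1, by positivity, ?_⟩
  intro n k τ s h
  have hX : 0 ≤ (k + 1 : ℝ) * Real.log (Real.exp 1 * n / (k + 1)) := by
    have := h.card_bd
    have h0 : (0:ℝ) ≤ (Bl k τ).card := Nat.cast_nonneg _
    have h1 : (0:ℝ) ≤ k := Nat.cast_nonneg _
    linarith
  have hY : 0 ≤ (k + 1 : ℝ) ^ (2 * r) := by positivity
  refine ⟨?_, u0 r k τ s, h.u0_good, ?_⟩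
  · obtain ⟨Q, h1, h2, h3⟩ := h.core hCH1 hCH
    refine ⟨Q, h1, h2, h3.trans ?_⟩
    set X := (k + 1 : ℝ) * Real.log (Real.exp 1 * n / (k + 1))
    set Y := (k + 1 : ℝ) ^ (2 * r)
    have a1 := mul_nonneg hA hY
    have a2 := mul_nonneg hB hX
    have a3 := mul_nonneg hK0p hX
    have a4 := mul_nonneg hK0p hY
    nlinarith
  · have := h.u0_energy hCH1 hCH
    rw [Fin.sum_univ_eq_sum_range (fun i => ((-1) ^ r * dseq^[r] (u0 r k τ s) i) ^ 2)]
    have e : ∀ i, ((-1) ^ r * dseq^[r] (u0 r k τ s) i) ^ 2 = (dseq^[r] (u0 r k τ s) i) ^ 2 := by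
      intro i
      rw [mul_pow ((-1:ℝ)^r), ← pow_mul, mul_comm r 2, pow_mul]; simp
    simp only [e]
    refine this.trans ?_
    have hp : (0:ℝ) ≤ ((k+1) * ((k + 1) / n : ℝ) ^ (2 * r - 1)) := by positivity
    refine mul_le_mul_of_nonneg_right ?_ hp
    linarith

def tauK (n r k : ℕ) (j : Fin k → ℕ) (i : ℕ) : ℕ := if i = 0 then 0 else jext n r k j i + r - 2

lemma jext_last (n r k : ℕ) (j : Fin k → ℕ) : jext n r k j (k+1) = n - r + 2 := by
  unfold jext; rw [if_neg (by omega), dif_neg (by omega)]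
lemma jext_mid (n r k : ℕ) (j : Fin k → ℕ) (i : ℕ) (h : i < k) : jext n r k j (i+1) = j ⟨i, h⟩ := by
  unfold jext; rw [if_neg (by omega), dif_pos (by omega)]; rfl
lemma sgext_mid (k : ℕ) (sg : Fin k → ℝ) (i : ℕ) (h : i < k) : sgext k sg (i+1) = sg ⟨i, h⟩ := by
  unfold sgext; rw [dif_pos ⟨by omega, by omega⟩]; rfl

lemma kd_of_knots {r n k : ℕ} (hr : 2 ≤ r) (hn : 2 * r ≤ n) {c : ℝ} (hc : 0 < c) {θ : Fin n → ℝ}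
    {j : Fin k → ℕ} {sg : Fin k → ℝ} (hK : IsKnotSeq r n θ k j sg) (hM : MinLen n r k j sg c) :
    KD r n k c (tauK n r k j) (sgext k sg) := by
  obtain ⟨hj, hj2, hj3, hj4⟩ := hK
  have hge : ∀ i, 2 ≤ jext n r k j (i+1) := by
    intro i
    by_cases h : i < k
    · rw [jext_mid _ _ _ _ _ h]; exact (hj2 _).1
    · unfold jext; rw [if_neg (by omega), dif_neg (by omega)]; omega
  have hst : ∀ i, i + 1 ≤ k → jext n r k j (i+1) < jext n r k j (i+1+1) := by
    intro i hi
    rw [jext_mid _ _ _ _ _ (by omega : i < k)]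
    by_cases h : i + 1 < k
    · rw [jext_mid _ _ _ _ _ h]; exact hj (by simp [Fin.lt_def])
    · have : i + 1 = k := by omega
      rw [this, jext_last]
      have := (hj2 ⟨i, by omega⟩).2
      omega
  have hlen : ∀ i ≤ k, nlen n r k j i = tauK n r k j (i+1) - tauK n r k j i := by
    intro i hi
    unfold nlen tauK
    rcases i with _ | i
    · simp
    · rw [if_neg (by omega), if_neg (by omega), if_neg (by omega)]
      have := hge i
      have := hst i hi
      omega
  refine ⟨hr, hc, by simp [tauK], ?_, ?_, ?_, by simp [sgext], by simp [sgext], ?_, ?_⟩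
  · unfold tauK; rw [if_neg (by omega), jext_last]; omega
  · intro i hi
    unfold tauK
    rcases i with _ | i
    · have := hge 0
      simp only [if_true]; rw [if_neg (by omega)]; omega
    · rw [if_neg (by omega), if_neg (by omega)]
      have := hge i
      have := hst i hi
      omega
  · unfold tauK; rw [if_neg (by omega)]; have : 2 ≤ jext n r k j 1 := hge 0; omega
  · intro i
    unfold sgext
    split_ifs with h
    · rw [hj4]; split_ifs <;> simp
    · simp
  · intro i hi h
    rw [← hlen i hi]; exact hM i hi h

lemma sum_fin_parts {r n : ℕ} (U : ℕ → ℝ) (h0 : ∀ t < r, U t = 0) (h1 : ∀ t, n ≤ t → U t = 0) (y : Fin n → ℝ) :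
    ∑ i : Fin n, ((-1) ^ r * dseq^[r] U i) * y i = ∑ t ∈ Finset.range (n - r), U (t + r) * DD r y t := by
  have e : ∑ i : Fin n, ((-1) ^ r * dseq^[r] U i) * y i = (-1) ^ r * ∑ i ∈ Finset.range n, dseq^[r] U i * pad y i := by
    rw [Finset.mul_sum, ← Fin.sum_univ_eq_sum_range (fun i => (-1) ^ r * (dseq^[r] U i * pad y i))]
    refine Finset.sum_congr rfl fun i _ => ?_
    rw [pad_fin]; ring
  rw [e, sum_parts r n U (pad y) h0 h1, ← mul_assoc, ← mul_pow]
  simp [DD]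

lemma good_subdiff {r n k : ℕ} (hr : 2 ≤ r) {θ : Fin n → ℝ}
    {j : Fin k → ℕ} {sg : Fin k → ℝ} (hK : IsKnotSeq r n θ k j sg) {U : ℕ → ℝ}
    (hU : GoodU r n k (tauK n r k j) (sgext k sg) 1 U) :
    (fun i : Fin n => (-1) ^ r * dseq^[r] U i) ∈ subdiff (fun α => Dl1 r α) θ := by
  obtain ⟨hj, hj2, hj3, hj4⟩ := hK
  intro y
  have e : ∑ i : Fin n, ((-1) ^ r * dseq^[r] U i) * (y i - θ i) =
      ∑ i : Fin n, ((-1) ^ r * dseq^[r] U i) * y i - ∑ i : Fin n, ((-1) ^ r * dseq^[r] U i) * θ i := by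
    rw [← Finset.sum_sub_distrib]; exact Finset.sum_congr rfl fun i _ => by ring
  rw [e, sum_fin_parts U hU.z0 hU.zn, sum_fin_parts U hU.z0 hU.zn]
  have e1 : ∑ t ∈ Finset.range (n - r), U (t + r) * DD r y t ≤ Dl1 r y := by
    refine Finset.sum_le_sum fun t _ => ?_
    refine (le_abs_self _).trans ?_
    rw [abs_mul]
    exact mul_le_of_le_one_left (abs_nonneg _) (hU.bd _)
  have e2 : ∑ t ∈ Finset.range (n - r), U (t + r) * DD r θ t = Dl1 r θ := by
    refine Finset.sum_congr rfl fun t ht => ?_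
    have ht := Finset.mem_range.1 ht
    by_cases h0 : DD r θ t = 0
    · rw [h0]; simp
    have hd : DD r θ t = DD (r-1) θ (t+1) - DD (r-1) θ t := by
      unfold DD
      obtain ⟨m, rfl⟩ : ∃ m, r = m + 1 := ⟨r - 1, by omega⟩
      rw [dseq_it_succ]; rfl
    have hk := (hj3 (t+2) (by omega) (by omega)).1 (by
      simp only [Nat.add_sub_cancel, show t + 2 - 1 = t + 1 by omega]
      intro hc; apply h0; rw [hd, hc, sub_self])
    obtain ⟨i, hi⟩ := hk
    have h3 := hU.kn (i+1) (by omega) (by omega)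
    have h4 : tauK n r k j (i+1) = t + r := by
      unfold tauK; rw [if_neg (by omega), jext_mid _ _ _ _ _ i.2, hi]; omega
    rw [h4, sgext_mid _ _ _ i.2, hj4, hi] at h3
    rw [h3, hd]
    simp only [Nat.add_sub_cancel, show t + 2 - 1 = t + 1 by omega]
    split_ifs with hlt
    · rw [abs_of_pos (by linarith)]; ring
    · rw [abs_of_nonpos (by linarith)]; ring
  rw [e2]
  linarith

/-! ### dual facts -/

lemma DD_add (r : ℕ) {n : ℕ} (a b : Fin n → ℝ) (t : ℕ) : DD r (a + b) t = DD r a t + DD r b t := by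
  unfold DD
  rw [← dseq_it_add]; exact congrFun (congrArg _ (funext (pad_add a b))) t
lemma DD_smul (r : ℕ) {n : ℕ} (c : ℝ) (a : Fin n → ℝ) (t : ℕ) : DD r (c • a) t = c * DD r a t := by
  unfold DD
  rw [← dseq_it_smul]; exact congrFun (congrArg _ (funext (pad_smul c a))) t
lemma Dl1_add (r : ℕ) {n : ℕ} (a b : Fin n → ℝ) : Dl1 r (a + b) ≤ Dl1 r a + Dl1 r b := by
  unfold Dl1; rw [← Finset.sum_add_distrib]
  exact Finset.sum_le_sum fun t _ => by rw [DD_add]; exact abs_add_le _ _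
lemma Dl1_smul (r : ℕ) {n : ℕ} (c : ℝ) (a : Fin n → ℝ) : Dl1 r (c • a) = |c| * Dl1 r a := by
  unfold Dl1; rw [Finset.mul_sum]
  exact Finset.sum_congr rfl fun t _ => by rw [DD_smul, abs_mul]
lemma Dl1_nonneg (r : ℕ) {n : ℕ} (a : Fin n → ℝ) : 0 ≤ Dl1 r a := Finset.sum_nonneg fun _ _ => abs_nonneg _

lemma sub_eq {r n : ℕ} {θ v : Fin n → ℝ} (hv : v ∈ subdiff (fun α => Dl1 r α) θ) : ∑ i, v i * θ i = Dl1 r θ := by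
  have h1 := hv 0
  have h2 := hv ((2:ℝ) • θ)
  simp only at h1 h2
  rw [Dl1_smul, abs_of_pos (by norm_num)] at h2
  have e0 : Dl1 r (0 : Fin n → ℝ) = 0 := by
    have := Dl1_smul r 0 (0 : Fin n → ℝ); simpa using this
  rw [e0] at h1
  have a1 : ∑ i, v i * ((0 : Fin n → ℝ) i - θ i) = - ∑ i, v i * θ i := by
    rw [← Finset.sum_neg_distrib]; exact Finset.sum_congr rfl fun i _ => by simp
  have a2 : ∑ i, v i * (((2:ℝ) • θ) i - θ i) = ∑ i, v i * θ i := by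
    exact Finset.sum_congr rfl fun i _ => by simp only [Pi.smul_apply, smul_eq_mul]; ring
  rw [a1] at h1; rw [a2] at h2
  linarith

lemma sub_le {r n : ℕ} {θ v : Fin n → ℝ} (hv : v ∈ subdiff (fun α => Dl1 r α) θ) (y : Fin n → ℝ) :
    ∑ i, v i * y i ≤ Dl1 r y := by
  have h := hv (θ + y)
  have h2 := Dl1_add r θ y
  simp only [Pi.add_apply, add_sub_cancel_left] at h
  linarith

lemma exists_dual (r n : ℕ) (hr : 1 ≤ r) (θ : Fin n → ℝ) : ∃ y : Fin n → ℝ,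
    (∀ v ∈ subdiff (fun α => Dl1 r α) θ, ∑ i, v i * y i = Dl1 r θ) ∧ ∀ i, |y i| ≤ (n:ℝ) ^ (r - 1) * Dl1 r θ := by
  set g : ℕ → ℝ := fun t => if t < n - r then DD r θ t else 0 with hg
  have hb : ∀ l : ℕ, ∀ t ≤ n, |sumS^[l+1] g t| ≤ (n:ℝ) ^ l * Dl1 r θ := by
    intro l
    induction l with
    | zero =>
      intro t _
      simp only [zero_add, Function.iterate_one, pow_zero, one_mul]
      unfold sumS Dl1
      refine (Finset.abs_sum_le_sum_abs _ _).trans ?_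
      have e : ∀ i, |g i| = if i < n - r then |DD r θ i| else 0 := by
        intro i; rw [hg]; simp only; split_ifs <;> simp
      simp only [e]
      rw [← Finset.sum_filter]
      refine Finset.sum_le_sum_of_subset_of_nonneg ?_ (fun _ _ _ => abs_nonneg _)
      intro i hi
      exact Finset.mem_range.2 (Finset.mem_filter.1 hi).2
    | succ l ih =>
      intro t ht
      rw [Function.iterate_succ_apply', sumS]
      refine (Finset.abs_sum_le_sum_abs _ _).trans ?_
      refine (Finset.sum_le_card_nsmul _ _ ((n:ℝ) ^ l * Dl1 r θ) (fun i hi => ih i (by have := Finset.mem_range.1 hi; omega))).trans ?_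
      rw [Finset.card_range, nsmul_eq_mul]
      have : (t:ℝ) ≤ n := by exact_mod_cast ht
      have h0 := Dl1_nonneg r θ
      calc _ ≤ (n:ℝ) * ((n:ℝ) ^ l * Dl1 r θ) := by gcongr
        _ = _ := by ring
  refine ⟨fun i => sumS^[r] g i, ?_, ?_⟩
  · intro v hv
    set y : Fin n → ℝ := fun i => sumS^[r] g i with hy
    have hDD : ∀ t < n - r, DD r y t = DD r θ t := by
      intro t ht
      have : DD r y t = dseq^[r] (sumS^[r] g) t := by
        refine dseq_it_congr r _ _ t fun i hi => ?_
        unfold pad; rw [dif_pos (by omega)]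
      rw [this, dseq_sumS_it, hg]; simp only; rw [if_pos ht]
    have hz : ∀ a : ℝ, Dl1 r (a • (y + (-1:ℝ) • θ)) = 0 := by
      intro a
      rw [Dl1_smul]
      have : Dl1 r (y + (-1:ℝ) • θ) = 0 := by
        refine Finset.sum_eq_zero fun t ht => ?_
        rw [DD_add, DD_smul, hDD t (Finset.mem_range.1 ht)]; simp
      rw [this, mul_zero]
    have k1 := sub_le hv ((1:ℝ) • (y + (-1:ℝ) • θ))
    have k2 := sub_le hv ((-1:ℝ) • (y + (-1:ℝ) • θ))
    rw [hz] at k1 k2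
    have k3 := sub_eq hv
    have e1 : ∑ i, v i * ((1:ℝ) • (y + (-1:ℝ) • θ)) i = ∑ i, v i * y i - ∑ i, v i * θ i := by
      rw [← Finset.sum_sub_distrib]
      exact Finset.sum_congr rfl fun i _ => by simp only [Pi.smul_apply, Pi.add_apply, smul_eq_mul]; ring
    have e2 : ∑ i, v i * ((-1:ℝ) • (y + (-1:ℝ) • θ)) i = -(∑ i, v i * y i - ∑ i, v i * θ i) := by
      rw [← Finset.sum_sub_distrib, ← Finset.sum_neg_distrib]
      exact Finset.sum_congr rfl fun i _ => by simp only [Pi.smul_apply, Pi.add_apply, smul_eq_mul]; ring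
    rw [e1] at k1; rw [e2] at k2
    linarith
  · intro i
    obtain ⟨l, rfl⟩ : ∃ l, r = l + 1 := ⟨r - 1, by omega⟩
    exact hb l i i.2.le

/-! ### probabilistic comparison -/

lemma prob_main {n : ℕ} {v w μ : ℝ} (hv : 0 < v) (hw : 0 ≤ w) {lam F Q : (Fin n → ℝ) → ℝ}
    (hlam : ELip (1 / v) lam) (hF : ELip 1 F) (hF0 : ∀ z, 0 ≤ F z) (hQ : Integrable Q (gaussVec n 1))
    (hμ : (∫ z, lam z ∂gaussVec n 1) + 2 / v ≤ μ)
    (hFd : ∀ z, lam z ≤ μ → ∃ d, 0 ≤ d ∧ d ^ 2 ≤ Q z ∧ F z ≤ d + (μ - lam z) * w) (hQ0 : ∀ z, 0 ≤ Q z) :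
    Integrable (fun z => F z ^ 2) (gaussVec n 1) ∧
    ∫ z, F z ^ 2 ∂gaussVec n 1 ≤ 56 + 12 * ∫ z, Q z ∂gaussVec n 1 +
      36 * (w ^ 2 * (μ - ((∫ z, lam z ∂gaussVec n 1) + 2 / v)) ^ 2) + 288 * (w ^ 2 / v ^ 2) := by
  set γ := gaussVec n 1 with hγ
  have hv1 : 0 ≤ 1 / v := by positivity
  have mF := hF.memLp zero_le_one
  have ml := hlam.memLp hv1
  have pF := poincare zero_le_one hF
  have pl := poincare hv1 hlam
  set a := ∫ z, F z ∂γ with ha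
  set m := ∫ z, lam z ∂γ with hm
  have ia : 0 ≤ a := integral_nonneg hF0
  have iF1 : Integrable F γ := mF.integrable (by norm_num)
  have il1 : Integrable lam γ := ml.integrable (by norm_num)
  have mFa : MemLp (fun z => F z - a) 2 γ := mF.sub (memLp_const a)
  have mla : ∀ b : ℝ, MemLp (fun z => lam z - b) 2 γ := fun b => ml.sub (memLp_const b)
  have iF2 : Integrable (fun z => F z ^ 2) γ := mF.integrable_sq
  have iFa2 : Integrable (fun z => (F z - a) ^ 2) γ := mFa.integrable_sq
  have ilb2 : ∀ b, Integrable (fun z => (lam z - b) ^ 2) γ := fun b => (mla b).integrable_sq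
  have hx0 : ∫ z, (lam z - m) ∂γ = 0 := by
    rw [integral_sub il1 (integrable_const _), integral_const]; simp [hm]
  have hFx0 : ∫ z, (F z - a) ∂γ = 0 := by
    rw [integral_sub iF1 (integrable_const _), integral_const]; simp [ha]
  -- shifted second moment
  have hsh : ∀ b : ℝ, ∫ z, (lam z - b) ^ 2 ∂γ ≤ 4 / v ^ 2 + (m - b) ^ 2 := by
    intro b
    have e : (fun z => (lam z - b) ^ 2) = fun z => (lam z - m) ^ 2 + (2 * (m - b) * (lam z - m) + (m - b) ^ 2) := by
      funext z; ring
    have i1 : Integrable (fun z => 2 * (m - b) * (lam z - m)) γ := ((mla m).integrable (by norm_num)).const_mul _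
    have i2 : Integrable (fun z => 2 * (m - b) * (lam z - m) + (m - b) ^ 2) γ := i1.add (integrable_const _)
    rw [e, integral_add (ilb2 m) i2, integral_add i1 (integrable_const _), integral_const_mul, hx0, integral_const]
    simp only [mul_zero, zero_add, probReal_univ, one_smul]
    have : 4 * (1 / v) ^ 2 = 4 / v ^ 2 := by rw [one_div, inv_pow]; ring
    linarith
  have hFsq : ∫ z, F z ^ 2 ∂γ ≤ 4 + a ^ 2 := by
    have e : (fun z => F z ^ 2) = fun z => (F z - a) ^ 2 + (2 * a * (F z - a) + a ^ 2) := by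
      funext z; ring
    have i1 : Integrable (fun z => 2 * a * (F z - a)) γ := (mFa.integrable (by norm_num)).const_mul _
    have i2 : Integrable (fun z => 2 * a * (F z - a) + a ^ 2) γ := i1.add (integrable_const _)
    rw [e, integral_add iFa2 i2, integral_add i1 (integrable_const _), integral_const_mul, hFx0, integral_const]
    simp only [mul_zero, zero_add, probReal_univ, one_smul]
    linarith
  -- pointwise inequality
  have hpt : ∀ z, a ^ 2 - a ^ 2 * (v ^ 2 / 16) * (lam z - (m - 2 / v)) ^ 2 ≤
      3 * ((F z - a) ^ 2 + Q z + w ^ 2 * (lam z - μ) ^ 2) := by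
    intro z
    have hR : 0 ≤ 3 * ((F z - a) ^ 2 + Q z + w ^ 2 * (lam z - μ) ^ 2) := by
      have := hQ0 z; positivity
    by_cases hA : lam z ≤ μ
    · obtain ⟨d, hd0, hd, hFz⟩ := hFd z hA
      have h1 : a ≤ |F z - a| + d + (μ - lam z) * w := by
        have := neg_abs_le (F z - a); linarith
      have h2 : 0 ≤ (μ - lam z) * w := mul_nonneg (by linarith) hw
      have h3 : a ^ 2 ≤ (|F z - a| + d + (μ - lam z) * w) ^ 2 := pow_le_pow_left₀ ia h1 2
      have h4 : (|F z - a| + d + (μ - lam z) * w) ^ 2 ≤ 3 * (|F z - a| ^ 2 + d ^ 2 + ((μ - lam z) * w) ^ 2) := by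
        nlinarith [sq_nonneg (|F z - a| - d), sq_nonneg (|F z - a| - (μ - lam z) * w), sq_nonneg (d - (μ - lam z) * w)]
      rw [sq_abs] at h4
      have h5 : ((μ - lam z) * w) ^ 2 = w ^ 2 * (lam z - μ) ^ 2 := by ring
      have h6 : 0 ≤ a ^ 2 * (v ^ 2 / 16) * (lam z - (m - 2 / v)) ^ 2 := by positivity
      linarith
    · refine le_trans ?_ hR
      have h1 : 4 / v ≤ lam z - (m - 2 / v) := by
        have : 4 / v = 2 / v + 2 / v := by ring
        rw [this]; linarith
      have h2 : (4 / v) ^ 2 ≤ (lam z - (m - 2 / v)) ^ 2 := pow_le_pow_left₀ (by positivity) h1 2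
      have h3 : v ^ 2 / 16 * (4 / v) ^ 2 = 1 := by field_simp; norm_num
      have h4 : 1 ≤ v ^ 2 / 16 * (lam z - (m - 2 / v)) ^ 2 := by
        rw [← h3]; exact mul_le_mul_of_nonneg_left h2 (by positivity)
      nlinarith [sq_nonneg a]
  have J1 : Integrable (fun z => a ^ 2 * (v ^ 2 / 16) * (lam z - (m - 2 / v)) ^ 2) γ := (ilb2 _).const_mul _
  have J2 : Integrable (fun z => (F z - a) ^ 2 + Q z) γ := iFa2.add hQ
  have J3 : Integrable (fun z => w ^ 2 * (lam z - μ) ^ 2) γ := (ilb2 _).const_mul _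
  have J0 : Integrable (fun z => a ^ 2 - a ^ 2 * (v ^ 2 / 16) * (lam z - (m - 2 / v)) ^ 2) γ :=
    (integrable_const (a ^ 2)).sub J1
  have J4 : Integrable (fun z => (F z - a) ^ 2 + Q z + w ^ 2 * (lam z - μ) ^ 2) γ := J2.add J3
  have hIntA := integral_mono J0 (J4.const_mul 3) hpt
  rw [integral_const_mul] at hIntA
  have E1 : ∫ z, (a ^ 2 - a ^ 2 * (v ^ 2 / 16) * (lam z - (m - 2 / v)) ^ 2) ∂γ =
     a ^ 2 - a ^ 2 * (v ^ 2 / 16) * ∫ z, (lam z - (m - 2 / v)) ^ 2 ∂γ := by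
    rw [integral_sub (integrable_const (a ^ 2)) J1, integral_const_mul, integral_const]
    simp only [probReal_univ, one_smul]
  have E2 : ∫ z, ((F z - a) ^ 2 + Q z + w ^ 2 * (lam z - μ) ^ 2) ∂γ =
     ∫ z, (F z - a) ^ 2 ∂γ + ∫ z, Q z ∂γ + w ^ 2 * ∫ z, (lam z - μ) ^ 2 ∂γ := by
    rw [integral_add J2 J3, integral_add iFa2 hQ, integral_const_mul]
  have hIntB : a ^ 2 - a ^ 2 * (v ^ 2 / 16) * ∫ z, (lam z - (m - 2 / v)) ^ 2 ∂γ ≤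
      3 * (∫ z, (F z - a) ^ 2 ∂γ + ∫ z, Q z ∂γ + w ^ 2 * ∫ z, (lam z - μ) ^ 2 ∂γ) := by
    rw [← E1, ← E2]; exact hIntA
  have b1 := hsh (m - 2 / v)
  have b2 := hsh μ
  have b3 : a ^ 2 * (v ^ 2 / 16) * ∫ z, (lam z - (m - 2 / v)) ^ 2 ∂γ ≤ a ^ 2 / 2 := by
    calc _ ≤ a ^ 2 * (v ^ 2 / 16) * (4 / v ^ 2 + (m - (m - 2 / v)) ^ 2) :=
          mul_le_mul_of_nonneg_left b1 (by positivity)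
      _ = _ := by field_simp; ring
  have b4 : w ^ 2 * ∫ z, (lam z - μ) ^ 2 ∂γ ≤ w ^ 2 * (2 * (μ - (m + 2 / v)) ^ 2) + 12 * (w ^ 2 / v ^ 2) := by
    have : (m - μ) ^ 2 ≤ 2 * (μ - (m + 2 / v)) ^ 2 + 2 * (2 / v) ^ 2 := by
      nlinarith [sq_nonneg ((μ - (m + 2 / v)) - 2 / v)]
    calc _ ≤ w ^ 2 * (4 / v ^ 2 + (2 * (μ - (m + 2 / v)) ^ 2 + 2 * (2 / v) ^ 2)) :=
          mul_le_mul_of_nonneg_left (by linarith) (by positivity)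
      _ = _ := by field_simp; ring
  refine ⟨iF2, hFsq.trans ?_⟩
  have b5 : ∫ z, (F z - a) ^ 2 ∂γ ≤ 4 := by linarith
  have p1 : 0 ≤ w ^ 2 * (μ - (m + 2 / v)) ^ 2 := by positivity
  have p2 : 0 ≤ w ^ 2 / v ^ 2 := by positivity
  have p3 : 0 ≤ ∫ z, Q z ∂γ := integral_nonneg hQ0
  linarith

/-! ### convex geometry -/

lemma dist_le {n : ℕ} {S : Set (Fin n → ℝ)} {w : Fin n → ℝ} (hw : w ∈ S) (μ : ℝ) (z : Fin n → ℝ) :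
    distSet z (scaleSet μ S) ≤ eunorm (z - μ • w) := by
  refine csInf_le ⟨0, ?_⟩ ⟨μ • w, ⟨w, hw, rfl⟩, rfl⟩
  rintro _ ⟨x, _, rfl⟩; exact eunorm_nonneg _

lemma abs_le_eunorm {n : ℕ} (x : Fin n → ℝ) (i : Fin n) : |x i| ≤ eunorm x := by
  rw [eunorm]
  apply Real.le_sqrt_of_sq_le
  rw [sq_abs]
  exact Finset.single_le_sum (f := fun i => x i ^ 2) (fun _ _ => sq_nonneg _) (Finset.mem_univ i)

lemma exists_near {n : ℕ} {S : Set (Fin n → ℝ)} (hc : IsClosed S) (hne : S.Nonempty) {μ : ℝ} (hμ : 0 ≤ μ)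
    (z : Fin n → ℝ) : ∃ v ∈ S, eunorm (z - μ • v) = distSet z (scaleSet μ S) := by
  have key : ∃ v ∈ S, ∀ w ∈ S, eunorm (z - μ • v) ≤ eunorm (z - μ • w) := by
    obtain ⟨v1, hv1⟩ := hne
    rcases hμ.eq_or_lt with rfl | hμ
    · exact ⟨v1, hv1, fun w _ => by simp⟩
    have hcont : Continuous (fun v : Fin n → ℝ => eunorm (z - μ • v)) := continuous_eunorm.comp (by fun_prop)
    set M := eunorm (z - μ • v1) with hM
    have hK : IsCompact (S ∩ {v | eunorm (z - μ • v) ≤ M}) := by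
      refine Metric.isCompact_of_isClosed_isBounded (hc.inter (isClosed_le hcont continuous_const)) ?_
      refine (Metric.isBounded_closedBall (x := (0 : Fin n → ℝ)) (r := (eunorm z + M) / μ)).subset ?_
      rintro v ⟨_, hv⟩
      rw [mem_closedBall_zero_iff, pi_norm_le_iff_of_nonneg (div_nonneg (add_nonneg (eunorm_nonneg _) (eunorm_nonneg _)) hμ.le)]
      intro i
      rw [Real.norm_eq_abs, le_div_iff₀ hμ]
      have h1 := abs_le_eunorm (z - μ • v) i
      have h2 := abs_le_eunorm z i
      simp only [Set.mem_ofPred_eq] at hv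
      have h3 : |v i| * μ = |z i - (z - μ • v) i| := by
        simp only [Pi.sub_apply, Pi.smul_apply, smul_eq_mul, sub_sub_cancel, abs_mul, abs_of_pos hμ]; ring
      rw [h3]
      refine (abs_sub _ _).trans ?_
      linarith
    obtain ⟨v, hv, hmin⟩ := hK.exists_isMinOn ⟨v1, hv1, le_refl M⟩ hcont.continuousOn
    refine ⟨v, hv.1, fun w hw => ?_⟩
    by_cases hwM : eunorm (z - μ • w) ≤ M
    · exact hmin ⟨hw, hwM⟩
    · exact hv.2.trans (not_le.1 hwM).le
  obtain ⟨v, hv, hmin⟩ := key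
  refine ⟨v, hv, le_antisymm ?_ (dist_le hv μ z)⟩
  refine le_csInf ⟨_, ⟨μ • v, ⟨v, hv, rfl⟩, rfl⟩⟩ ?_
  rintro _ ⟨_, ⟨w, hw, rfl⟩, rfl⟩
  exact hmin w hw

lemma dS_nonneg {n : ℕ} (S : Set (Fin n → ℝ)) (z : Fin n → ℝ) : 0 ≤ distSet z S := by
  apply Real.sInf_nonneg; rintro _ ⟨x, _, rfl⟩; exact eunorm_nonneg _

lemma dist_lip {n : ℕ} {S : Set (Fin n → ℝ)} (hc : IsClosed S) (hne : S.Nonempty) {μ : ℝ} (hμ : 0 ≤ μ) :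
    ELip 1 (fun z => distSet z (scaleSet μ S)) := by
  have key : ∀ x y, distSet x (scaleSet μ S) - distSet y (scaleSet μ S) ≤ eunorm (x - y) := by
    intro x y
    obtain ⟨v, hv, h⟩ := exists_near hc hne hμ y
    have h1 := dist_le hv μ x
    have h2 := eunorm_add_le (x - y) (y - μ • v)
    rw [sub_add_sub_cancel] at h2
    linarith
  intro x y
  rw [one_mul, abs_le]
  have h1 := key x y
  have h2 := key y x
  rw [eunorm_sub_comm] at h2
  constructor <;> linarith

lemma sqnorm_sub_smul {n : ℕ} (x y : Fin n → ℝ) (t : ℝ) :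
    sqnorm (x - t • y) = sqnorm x - 2 * t * (∑ i, x i * y i) + t ^ 2 * sqnorm y := by
  unfold sqnorm
  rw [Finset.mul_sum, Finset.mul_sum, ← Finset.sum_sub_distrib, ← Finset.sum_add_distrib]
  refine Finset.sum_congr rfl fun i _ => ?_
  simp only [Pi.sub_apply, Pi.smul_apply, smul_eq_mul]; ring

lemma nonpos_of_quad {a b : ℝ} (h : ∀ t : ℝ, 0 < t → t ≤ 1 → 2 * t * a ≤ t ^ 2 * b) : a ≤ 0 := by
  by_contra hcon
  have ha : 0 < a := not_le.1 hcon
  have h1 := h 1 one_pos le_rfl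
  have hb : 0 < b := by linarith
  have h2 := h (a / b) (by positivity) (by rw [div_le_one hb]; linarith)
  have e1 : 2 * (a / b) * a = 2 * (a ^ 2 / b) := by ring
  have e2 : (a / b) ^ 2 * b = a ^ 2 / b := by field_simp
  rw [e1, e2] at h2
  have : 0 < a ^ 2 / b := by positivity
  linarith

/-- variational inequality for the cone projection -/
lemma cone_var {n : ℕ} {S : Set (Fin n → ℝ)} (hconv : Convex ℝ S) {z v : Fin n → ℝ} {l : ℝ} (hl : 0 ≤ l) (hv : v ∈ S)
    (hmin : ∀ μ : ℝ, 0 ≤ μ → ∀ w ∈ S, eunorm (z - l • v) ≤ eunorm (z - μ • w)) {μ : ℝ} (hμ : 0 ≤ μ) {w : Fin n → ℝ}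
    (hw : w ∈ S) : ∑ i, (z - l • v) i * (μ • w - l • v) i ≤ 0 := by
  refine nonpos_of_quad (b := sqnorm (μ • w - l • v)) fun t ht0 ht1 => ?_
  obtain ⟨μ', hμ', w', hw', he⟩ : ∃ μ' : ℝ, 0 ≤ μ' ∧ ∃ w' ∈ S, l • v + t • (μ • w - l • v) = μ' • w' := by
    have h1 : 0 ≤ (1 - t) * l := mul_nonneg (by linarith) hl
    have h2 : 0 ≤ t * μ := mul_nonneg ht0.le hμ
    rcases (add_nonneg h1 h2).eq_or_lt with h0 | h0
    · refine ⟨0, le_rfl, v, hv, ?_⟩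
      have a1 : (1 - t) * l = 0 := by linarith
      have a2 : t * μ = 0 := by linarith
      ext i
      simp only [Pi.add_apply, Pi.sub_apply, Pi.smul_apply, smul_eq_mul]
      linear_combination (v i) * a1 + (w i) * a2
    · obtain ⟨D, hD⟩ : ∃ D, D = (1 - t) * l + t * μ := ⟨_, rfl⟩
      rw [← hD] at h0
      have hD0 : D ≠ 0 := h0.ne'
      refine ⟨D, h0.le, (((1 - t) * l) / D) • v + ((t * μ) / D) • w,
        hconv hv hw (by positivity) (by positivity) (by rw [← add_div, ← hD, div_self hD0]), ?_⟩
      ext i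
      simp only [Pi.add_apply, Pi.sub_apply, Pi.smul_apply, smul_eq_mul]
      have e1 : D * ((1 - t) * l / D * v i + t * μ / D * w i) = (1 - t) * l * v i + t * μ * w i := by
        field_simp
      rw [e1]; ring
  have h := hmin μ' hμ' w' hw'
  rw [← he, ← sub_sub] at h
  have h2 := pow_le_pow_left₀ (eunorm_nonneg _) h 2
  rw [eunorm_sq, eunorm_sq, sqnorm_sub_smul (z - l • v) (μ • w - l • v) t] at h2
  linarith

lemma lam_near {n : ℕ} {S : Set (Fin n → ℝ)} (hc : IsClosed S) (hne : S.Nonempty) {lam : (Fin n → ℝ) → ℝ}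
    (hlam : IsLamFun S lam) (z : Fin n → ℝ) : ∃ v ∈ S, ∀ μ : ℝ, 0 ≤ μ → ∀ w ∈ S,
      eunorm (z - lam z • v) ≤ eunorm (z - μ • w) := by
  obtain ⟨v, hv, h⟩ := exists_near hc hne (hlam z).1 z
  exact ⟨v, hv, fun μ hμ w hw => by rw [h]; exact ((hlam z).2 μ hμ).trans (dist_le hw μ z)⟩

lemma lam_lip {n : ℕ} {S : Set (Fin n → ℝ)} (hc : IsClosed S) (hne : S.Nonempty) (hconv : Convex ℝ S)
    {lam : (Fin n → ℝ) → ℝ} (hlam : IsLamFun S lam) {v0 : Fin n → ℝ} (h0 : 0 < eunorm v0)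
    (hv0 : ∀ v ∈ S, ∑ i, v i * v0 i = eunorm v0 ^ 2) : ELip (1 / eunorm v0) lam := by
  have key : ∀ x y, lam x - lam y ≤ 1 / eunorm v0 * eunorm (x - y) := by
    intro x y
    obtain ⟨v, hv, hvm⟩ := lam_near hc hne hlam x
    obtain ⟨w, hw, hwm⟩ := lam_near hc hne hlam y
    have i1 := cone_var hconv (hlam x).1 hv hvm (hlam y).1 hw
    have i2 := cone_var hconv (hlam y).1 hw hwm (hlam x).1 hv
    set p := lam x • v with hp
    set q := lam y • w with hq
    have hpq : sqnorm (p - q) ≤ ∑ i, (x - y) i * (p - q) i := by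
      have : sqnorm (p - q) - ∑ i, (x - y) i * (p - q) i =
          (∑ i, (x - p) i * (q - p) i) + ∑ i, (y - q) i * (p - q) i := by
        unfold sqnorm
        rw [← Finset.sum_sub_distrib, ← Finset.sum_add_distrib]
        refine Finset.sum_congr rfl fun i _ => ?_
        simp only [Pi.sub_apply]; ring
      linarith
    have h1 := hpq.trans (inner_le_eunorm _ _)
    rw [← eunorm_sq] at h1
    have h2 : eunorm (p - q) ≤ eunorm (x - y) := by
      by_contra hcon
      have hcon := not_le.1 hcon
      have := eunorm_nonneg (x - y)
      nlinarith
    have h3 : (lam x - lam y) * eunorm v0 ^ 2 = ∑ i, (p - q) i * v0 i := by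
      have e : ∑ i, (p - q) i * v0 i = lam x * (∑ i, v i * v0 i) - lam y * ∑ i, w i * v0 i := by
        rw [Finset.mul_sum, Finset.mul_sum, ← Finset.sum_sub_distrib]
        refine Finset.sum_congr rfl fun i _ => ?_
        simp only [hp, hq, Pi.sub_apply, Pi.smul_apply, smul_eq_mul]; ring
      rw [e, hv0 v hv, hv0 w hw]; ring
    have h4 := inner_le_eunorm (p - q) v0
    rw [← h3] at h4
    have h5 : (lam x - lam y) * eunorm v0 ≤ eunorm (x - y) := by
      have : (lam x - lam y) * eunorm v0 ≤ eunorm (p - q) := by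
        refine le_of_mul_le_mul_right ?_ h0
        nlinarith
      linarith
    rw [one_div, inv_mul_eq_div, le_div_iff₀ h0]
    exact h5
  intro x y
  rw [abs_le]
  have h1 := key x y
  have h2 := key y x
  rw [eunorm_sub_comm] at h2
  constructor <;> linarith

lemma subdiff_closed {n : ℕ} (g : (Fin n → ℝ) → ℝ) (θ : Fin n → ℝ) : IsClosed (subdiff g θ) := by
  unfold subdiff
  rw [Set.ofPred_forall]
  exact isClosed_iInter fun y => isClosed_le (by fun_prop) continuous_const

lemma subdiff_convex {n : ℕ} (g : (Fin n → ℝ) → ℝ) (θ : Fin n → ℝ) : Convex ℝ (subdiff g θ) := by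
  intro v hv w hw a b ha hb hab y
  have h1 := hv y
  have h2 := hw y
  have e : ∑ i, (a • v + b • w) i * (y i - θ i) = a * (∑ i, v i * (y i - θ i)) + b * ∑ i, w i * (y i - θ i) := by
    rw [Finset.mul_sum, Finset.mul_sum, ← Finset.sum_add_distrib]
    refine Finset.sum_congr rfl fun i _ => ?_
    simp only [Pi.add_apply, Pi.smul_apply, smul_eq_mul]; ring
  rw [e]
  have hb' : b = 1 - a := by linarith
  have := mul_le_mul_of_nonneg_left h1 ha
  have := mul_le_mul_of_nonneg_left h2 hb
  subst hb'
  nlinarith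

lemma aff_const {n : ℕ} {S : Set (Fin n → ℝ)} {y : Fin n → ℝ} {a : ℝ} (h : ∀ v ∈ S, ∑ i, v i * y i = a)
    {v : Fin n → ℝ} (hv : v ∈ (affineSpan ℝ S : Set (Fin n → ℝ))) : ∑ i, v i * y i = a := by
  let T : AffineSubspace ℝ (Fin n → ℝ) :=
    { carrier := {v | ∑ i, v i * y i = a}
      smul_vsub_vadd_mem' := by
        intro c p1 p2 p3 h1 h2 h3
        simp only [Set.mem_ofPred_eq] at *
        have : ∑ i, (c • (p1 -ᵥ p2) +ᵥ p3) i * y i =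
            c * (∑ i, p1 i * y i - ∑ i, p2 i * y i) + ∑ i, p3 i * y i := by
          rw [← Finset.sum_sub_distrib, Finset.mul_sum, ← Finset.sum_add_distrib]
          refine Finset.sum_congr rfl fun i _ => ?_
          simp only [vsub_eq_sub, vadd_eq_add, Pi.add_apply, Pi.smul_apply, Pi.sub_apply, smul_eq_mul]; ring
        rw [this, h1, h2, h3]; ring }
  have : affineSpan ℝ S ≤ T := affineSpan_le.2 h
  exact this hv

lemma minnorm_inner {n : ℕ} {S : Set (Fin n → ℝ)} {v0 : Fin n → ℝ}
    (h : IsMinNormIn v0 (affineSpan ℝ S : Set (Fin n → ℝ))) {v : Fin n → ℝ} (hv : v ∈ S) :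
    ∑ i, v i * v0 i = eunorm v0 ^ 2 := by
  have hvA : v ∈ affineSpan ℝ S := subset_affineSpan ℝ S hv
  have key : ∀ t : ℝ, sqnorm v0 ≤ sqnorm (v0 - t • (v0 - v)) := by
    intro t
    have hm : v0 - t • (v0 - v) ∈ affineSpan ℝ S := by
      have := AffineMap.lineMap_mem t (h.1 : v0 ∈ affineSpan ℝ S) hvA
      convert this using 1
      rw [AffineMap.lineMap_apply]
      ext i
      simp only [vsub_eq_sub, vadd_eq_add, Pi.add_apply, Pi.smul_apply, Pi.sub_apply, smul_eq_mul]; ring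
    have h2 := pow_le_pow_left₀ (eunorm_nonneg _) (h.2 _ hm) 2
    rwa [eunorm_sq, eunorm_sq] at h2
  have a1 : ∑ i, v0 i * (v0 - v) i ≤ 0 := nonpos_of_quad (b := sqnorm (v0 - v)) fun t _ _ => by
    have := key t; rw [sqnorm_sub_smul] at this; linarith
  have a2 : -(∑ i, v0 i * (v0 - v) i) ≤ 0 := nonpos_of_quad (b := sqnorm (v0 - v)) fun t _ _ => by
    have := key (-t); rw [sqnorm_sub_smul] at this; nlinarith
  have e : ∑ i, v0 i * (v0 - v) i = eunorm v0 ^ 2 - ∑ i, v i * v0 i := by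
    rw [eunorm_sq, sqnorm, ← Finset.sum_sub_distrib]
    refine Finset.sum_congr rfl fun i _ => ?_
    simp only [Pi.sub_apply]; ring
  linarith

/-! ### estimator and assembly -/

lemma est_bound {n r : ℕ} {θ ξ e v x : Fin n → ℝ} {κ : ℝ} (hκ : 0 ≤ κ) (hx : x = θ + e)
    (hmin : 1 / 2 * sqnorm (θ + ξ - x) + κ * Dl1 r x ≤ 1 / 2 * sqnorm (θ + ξ - θ) + κ * Dl1 r θ)
    (hv : v ∈ subdiff (fun α => Dl1 r α) θ) : sqnorm e ≤ 4 * sqnorm (ξ - κ • v) := by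
  have h1 : Dl1 r θ + ∑ i, v i * (x i - θ i) ≤ Dl1 r x := hv x
  have e1 : θ + ξ - x = ξ - (1:ℝ) • e := by rw [hx, one_smul]; abel
  have e2 : θ + ξ - θ = ξ := by abel
  have e3 : ∑ i, v i * (x i - θ i) = ∑ i, v i * e i := by
    refine Finset.sum_congr rfl fun i _ => ?_
    rw [hx]; simp
  rw [e1, e2, sqnorm_sub_smul] at hmin
  rw [e3] at h1
  have h2 := mul_le_mul_of_nonneg_left h1 hκ
  have e4 : ∑ i, (ξ - κ • v) i * e i = ∑ i, ξ i * e i - κ * ∑ i, v i * e i := by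
    rw [Finset.mul_sum, ← Finset.sum_sub_distrib]
    refine Finset.sum_congr rfl fun i _ => ?_
    simp only [Pi.sub_apply, Pi.smul_apply, smul_eq_mul]; ring
  have h3 := inner_le_eunorm (ξ - κ • v) e
  rw [e4] at h3
  rw [← eunorm_sq, ← eunorm_sq]
  have h4 : 1 / 2 * eunorm e ^ 2 ≤ eunorm (ξ - κ • v) * eunorm e := by
    rw [eunorm_sq]; nlinarith
  have a1 := eunorm_nonneg e
  have a2 := eunorm_nonneg (ξ - κ • v)
  have h5 : eunorm e ≤ 2 * eunorm (ξ - κ • v) := by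
    by_contra hcon
    have hcon := not_le.1 hcon
    nlinarith
  nlinarith

lemma gv_scale (n : ℕ) (σ : ℝ) : gaussVec n σ = (gaussVec n 1).map (fun z => σ • z) := by
  rw [gv_eq, gaussVec]
  have h := Measure.pi_map_pi (μ := fun _ : Fin n => gaussianReal 0 1) (f := fun _ x => σ * x)
    (fun i => by fun_prop)
  have e : (fun z : Fin n → ℝ => σ • z) = fun x i => σ * x i := by
    ext z i; simp
  rw [e, h]
  congr 1
  funext i
  rw [gaussianReal_map_const_mul]
  congr 1
  · simp
  · ext; simp [sq_nonneg]

lemma risk_le {n : ℕ} {σ : ℝ} (hσ : 0 < σ) {est : (Fin n → ℝ) → Fin n → ℝ} {θ : Fin n → ℝ} {F : (Fin n → ℝ) → ℝ}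
    (hF : Integrable (fun z => F z ^ 2) (gaussVec n 1)) (hFc : ELip 1 F)
    (h : ∀ z, sqnorm (est (θ + σ • z) - θ) ≤ 4 * σ ^ 2 * F z ^ 2) :
    risk σ est θ ≤ 1 / (n:ℝ) * (4 * σ ^ 2 * ∫ z, F z ^ 2 ∂gaussVec n 1) := by
  unfold risk
  refine mul_le_mul_of_nonneg_left ?_ (by positivity)
  have hm : AEMeasurable (fun z : Fin n → ℝ => σ • z) (gaussVec n 1) := by fun_prop
  let e : (Fin n → ℝ) ≃ₜ (Fin n → ℝ) := Homeomorph.smulOfNeZero σ hσ.ne'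
  have hcomp : ∀ z : Fin n → ℝ, σ⁻¹ • (σ • z) = z := fun z => inv_smul_smul₀ hσ.ne' z
  have hg : Integrable (fun ξ => 4 * σ ^ 2 * F (σ⁻¹ • ξ) ^ 2) (gaussVec n σ) := by
    rw [gv_scale]
    have := (e.measurableEmbedding.integrable_map_iff (μ := gaussVec n 1)
      (g := fun ξ => 4 * σ ^ 2 * F (σ⁻¹ • ξ) ^ 2))
    refine this.2 ?_
    have e2 : (fun ξ => 4 * σ ^ 2 * F (σ⁻¹ • ξ) ^ 2) ∘ e = fun z => 4 * σ ^ 2 * F z ^ 2 := by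
      funext z; exact congrArg (fun x => 4 * σ ^ 2 * F x ^ 2) (hcomp z)
    rw [e2]; exact hF.const_mul _
  have h1 : ∫ ξ, sqnorm (est (θ + ξ) - θ) ∂gaussVec n σ ≤ ∫ ξ, 4 * σ ^ 2 * F (σ⁻¹ • ξ) ^ 2 ∂gaussVec n σ := by
    refine integral_mono_of_nonneg (Filter.Eventually.of_forall fun ξ => sqnorm_nonneg _) hg
      (Filter.Eventually.of_forall fun ξ => ?_)
    have := h (σ⁻¹ • ξ)
    rwa [smul_inv_smul₀ hσ.ne'] at this
  refine h1.trans (le_of_eq ?_)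
  rw [gv_scale]
  have := e.measurableEmbedding.integral_map (μ := gaussVec n 1) (fun ξ => 4 * σ ^ 2 * F (σ⁻¹ • ξ) ^ 2)
  refine this.trans ?_
  rw [← integral_const_mul]
  congr 1
  funext z; exact congrArg (fun x => 4 * σ ^ 2 * F x ^ 2) (hcomp z)

lemma v0_lower {n r : ℕ} (hr : 1 ≤ r) (hn : 0 < n) {θ v0 : Fin n → ℝ} (hθ : ∃ t < n - r, DD r θ t ≠ 0)
    (h : v0 ∈ (affineSpan ℝ (subdiff (fun α => Dl1 r α) θ) : Set (Fin n → ℝ))) :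
    0 < eunorm v0 ∧ 1 ≤ eunorm v0 ^ 2 * (n:ℝ) ^ (2 * r - 1) := by
  obtain ⟨y, hy, hyb⟩ := exists_dual r n hr θ
  have h1 := aff_const hy h
  have hf : 0 < Dl1 r θ := by
    obtain ⟨t, ht, hne⟩ := hθ
    refine Finset.sum_pos' (fun _ _ => abs_nonneg _) ⟨t, Finset.mem_range.2 ht, abs_pos.2 hne⟩
  have h2 := inner_le_eunorm v0 y
  rw [h1] at h2
  have h3 : eunorm y ^ 2 ≤ n * ((n:ℝ) ^ (r - 1) * Dl1 r θ) ^ 2 := by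
    rw [eunorm_sq, sqnorm]
    calc ∑ i, y i ^ 2 ≤ ∑ _i : Fin n, ((n:ℝ) ^ (r - 1) * Dl1 r θ) ^ 2 :=
          Finset.sum_le_sum fun i _ => by rw [← sq_abs]; exact pow_le_pow_left₀ (abs_nonneg _) (hyb i) 2
      _ = _ := by simp
  have hv := eunorm_nonneg v0
  have hp : 0 < eunorm v0 := by
    rcases hv.eq_or_lt with h0 | h0
    · rw [← h0, zero_mul] at h2; linarith
    · exact h0
  refine ⟨hp, ?_⟩
  have h4 : Dl1 r θ ^ 2 ≤ (eunorm v0 * eunorm y) ^ 2 := pow_le_pow_left₀ hf.le h2 2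
  rw [mul_pow] at h4
  have h5 : Dl1 r θ ^ 2 ≤ eunorm v0 ^ 2 * (n * ((n:ℝ) ^ (r - 1) * Dl1 r θ) ^ 2) :=
    h4.trans (mul_le_mul_of_nonneg_left h3 (sq_nonneg _))
  have e : eunorm v0 ^ 2 * (n * ((n:ℝ) ^ (r - 1) * Dl1 r θ) ^ 2) =
      (eunorm v0 ^ 2 * (n:ℝ) ^ (2 * r - 1)) * Dl1 r θ ^ 2 := by
    have : 2 * r - 1 = (r - 1) * 2 + 1 := by omega
    rw [this, pow_succ (n:ℝ), pow_mul (n:ℝ)]; ring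
  rw [e] at h5
  exact le_of_mul_le_mul_right (by linarith) (by positivity : 0 < Dl1 r θ ^ 2)

lemma F_le {n : ℕ} {S : Set (Fin n → ℝ)} (hconv : Convex ℝ S) {z v v1 : Fin n → ℝ} (hv : v ∈ S) (hv1 : v1 ∈ S)
    {l μ : ℝ} (hl : 0 ≤ l) (hlμ : l ≤ μ) :
    distSet z (scaleSet μ S) ≤ eunorm (z - l • v) + (μ - l) * eunorm v1 := by
  obtain ⟨w, hw, he⟩ : ∃ w ∈ S, μ • w = l • v + (μ - l) • v1 := by
    rcases (hl.trans hlμ).eq_or_lt with h0 | h0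
    · have : l = 0 := by linarith
      exact ⟨v, hv, by rw [this, ← h0]; simp⟩
    · refine ⟨(l / μ) • v + ((μ - l) / μ) • v1, hconv hv hv1 (by positivity) (div_nonneg (by linarith) h0.le)
        (by rw [← add_div, add_sub_cancel, div_self h0.ne']), ?_⟩
      rw [smul_add, smul_smul, smul_smul, mul_div_cancel₀ _ h0.ne', mul_div_cancel₀ _ h0.ne']
  refine (dist_le hw μ z).trans ?_
  rw [he]
  have e1 : z - (l • v + (μ - l) • v1) = (z - l • v) + (-(μ - l)) • v1 := by
    rw [neg_smul]; abel
  rw [e1]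
  refine (eunorm_add_le _ _).trans (le_of_eq ?_)
  rw [eunorm_smul, abs_neg, abs_of_nonneg (by linarith)]

lemma good_point {r n k : ℕ} (hr : 2 ≤ r) {θ : Fin n → ℝ}
    {j : Fin k → ℕ} {sg : Fin k → ℝ} (hK : IsKnotSeq r n θ k j sg) {μ : ℝ} (hμ : 0 ≤ μ) {U : ℕ → ℝ}
    (hU : GoodU r n k (tauK n r k j) (sgext k sg) μ U) (hne : (subdiff (fun α => Dl1 r α) θ).Nonempty) :
    ∃ w ∈ subdiff (fun α => Dl1 r α) θ, μ • w = fun i : Fin n => (-1) ^ r * dseq^[r] U i := by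
  rcases hμ.eq_or_lt with h0 | h0
  · obtain ⟨w, hw⟩ := hne
    refine ⟨w, hw, ?_⟩
    have hU0 : U = fun t => (0:ℝ) * U t := by
      funext t
      have := hU.bd t
      rw [← h0] at this
      rw [zero_mul]; exact abs_eq_zero.1 (le_antisymm this (abs_nonneg _))
    funext i
    rw [hU0, dseq_it_smul, ← h0]; simp
  · refine ⟨_, good_subdiff hr hK (U := fun t => μ⁻¹ * U t) ⟨?_, ?_, ?_, ?_⟩, ?_⟩
    · intro t ht; simp [hU.z0 t ht]
    · intro t ht; simp [hU.zn t ht]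
    · intro t
      rw [abs_mul, abs_of_pos (inv_pos.2 h0), inv_mul_le_iff₀ h0, mul_one]; exact hU.bd t
    · intro i h1 h2
      simp only [hU.kn i h1 h2]
      rw [inv_mul_cancel_left₀ h0.ne', one_mul]
    · funext i
      simp only [Pi.smul_apply, smul_eq_mul]
      rw [dseq_it_smul]
      field_simp

/-- Corollary: risk of the penalized estimator for `r ≥ 2` under the
minimum length condition.  Here `λ* = n^{1-r}(E λ_{θ*}(Z) + 2/‖v_0‖)` and `k = k_r(θ*)`. -/
theorem stmt9 (r : ℕ) (hr : 2 ≤ r) (c : ℝ) (hc0 : 0 < c) (hc1 : c ≤ 1) :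
    ∃ C : ℝ, 0 < C ∧
      ∀ (n : ℕ), 2 * r ≤ n → ∀ σ : ℝ, 0 < σ → ∀ θstar : Fin n → ℝ,
        (∃ t < n - r, DD r θstar t ≠ 0) →
        ∀ (k : ℕ) (j : Fin k → ℕ) (sg : Fin k → ℝ),
          IsKnotSeq r n θstar k j sg → MinLen n r k j sg c →
        ∀ v0 : Fin n → ℝ,
          IsMinNormIn v0
            ((affineSpan ℝ (subdiff (fun α => Dl1 r α) θstar) : Set (Fin n → ℝ))) →
        ∀ lamfun : (Fin n → ℝ) → ℝ, IsLamFun (subdiff (fun α => Dl1 r α) θstar) lamfun →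
        ∀ lamstar : ℝ,
          lamstar = (n : ℝ) ^ (1 - (r : ℤ)) *
            ((∫ z, lamfun z ∂gaussVec n 1) + 2 / eunorm v0) →
        ∀ lam : ℝ, lamstar ≤ lam →
        ∀ est : (Fin n → ℝ) → Fin n → ℝ, IsPenEst r σ lam est →
          risk σ est θstar ≤
            C * σ ^ 2 * (((k : ℝ) + 1) / (n : ℝ) *
                Real.log (Real.exp 1 * (n : ℝ) / ((k : ℝ) + 1)) +
              ((k : ℝ) + 1) ^ (2 * r) / (n : ℝ) +
              (lam - lamstar) ^ 2 * ((k : ℝ) + 1) ^ (2 * r) / (n : ℝ) ^ 2) := by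
  obtain ⟨C, hC, hcore⟩ := core_exists r c hc0
  refine ⟨4 * (56 + 12 * C + 36 * C + 288 * C), by positivity, ?_⟩
  intro n hn σ hσ θ hθ k j sg hK hM v0 hv0 lamf hlamf ls hls lam hlam est hest
  have hKD := kd_of_knots hr hn hc0 hK hM
  obtain ⟨⟨Q, hQi, hQz, hQb⟩, U1, hU1, hw⟩ := hcore n k _ _ hKD
  have hn0 : 0 < n := by omega
  have hnR : (0:ℝ) < n := by exact_mod_cast hn0
  have hkn : k + 1 ≤ n := by
    have : ∀ i ≤ k + 1, i ≤ tauK n r k j i := by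
      intro i
      induction i with
      | zero => intro _; exact Nat.zero_le _
      | succ i ih => intro hi; have := hKD.hlt i (by omega); have := ih (by omega); omega
    have := this (k + 1) le_rfl
    rwa [hKD.hn] at this
  set S := subdiff (fun α => Dl1 r α) θ with hS
  obtain ⟨v1, hv1e⟩ : ∃ v1 : Fin n → ℝ, v1 = fun i : Fin n => (-1) ^ r * dseq^[r] U1 i := ⟨_, rfl⟩
  have hv1 : v1 ∈ S := by rw [hv1e]; exact good_subdiff hr hK hU1
  have hne : S.Nonempty := ⟨v1, hv1⟩
  have hcl : IsClosed S := subdiff_closed _ _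
  have hconv : Convex ℝ S := subdiff_convex _ _
  obtain ⟨v0p, v0l⟩ := v0_lower (by omega) hn0 hθ hv0.1
  have hw2 : eunorm v1 ^ 2 ≤ C * ((k+1) * ((k + 1) / n : ℝ) ^ (2 * r - 1)) := by
    rw [eunorm_sq, hv1e]; exact hw
  have hl1 : ELip (1 / eunorm v0) lamf := lam_lip hcl hne hconv hlamf v0p fun v hv => minnorm_inner hv0 hv
  have hm0 : 0 ≤ ∫ z, lamf z ∂gaussVec n 1 := integral_nonneg fun z => (hlamf z).1
  set m := ∫ z, lamf z ∂gaussVec n 1 with hm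
  have hms : 0 ≤ m + 2 / eunorm v0 := by positivity
  obtain ⟨μ, hμe⟩ : ∃ μ : ℝ, μ = (n : ℝ) ^ ((r : ℤ) - 1) * lam := ⟨_, rfl⟩
  have hpp : (0:ℝ) < (n : ℝ) ^ ((r : ℤ) - 1) := by positivity
  have hμs : m + 2 / eunorm v0 = (n : ℝ) ^ ((r : ℤ) - 1) * ls := by
    rw [hls, ← mul_assoc, ← zpow_add₀ hnR.ne']; simp
  have hμ : m + 2 / eunorm v0 ≤ μ := by
    rw [hμs, hμe]; exact mul_le_mul_of_nonneg_left hlam hpp.le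
  have hμ0 : 0 ≤ μ := hms.trans hμ
  have hQ0 : ∀ z, 0 ≤ Q z := fun z => by
    obtain ⟨μ', U, _, _, h⟩ := hQz z
    exact le_trans (Finset.sum_nonneg fun _ _ => sq_nonneg _) h
  have hFd : ∀ z, lamf z ≤ μ → ∃ d, 0 ≤ d ∧ d ^ 2 ≤ Q z ∧
      distSet z (scaleSet μ S) ≤ d + (μ - lamf z) * eunorm v1 := by
    intro z hz
    obtain ⟨v, hv, hvm⟩ := lam_near hcl hne hlamf z
    refine ⟨eunorm (z - lamf z • v), eunorm_nonneg _, ?_, F_le hconv hv hv1 (hlamf z).1 hz⟩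
    obtain ⟨μ', U, h1, h2, h3⟩ := hQz z
    obtain ⟨w, hwS, hwe⟩ := good_point hr hK h1 h2 hne
    have h4 := pow_le_pow_left₀ (eunorm_nonneg _) (hvm μ' h1 w hwS) 2
    refine h4.trans ?_
    rw [eunorm_sq, hwe]; exact h3
  have hFl := dist_lip hcl hne hμ0
  obtain ⟨hFi, hFb⟩ := prob_main v0p (eunorm_nonneg v1) hl1 hFl (fun z => dS_nonneg _ z) hQi hμ hFd hQ0
  have hest2 : ∀ z, sqnorm (est (θ + σ • z) - θ) ≤ 4 * σ ^ 2 * distSet z (scaleSet μ S) ^ 2 := by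
    intro z
    obtain ⟨v, hv, hvd⟩ := exists_near hcl hne hμ0 z
    have hκ : σ * (n : ℝ) ^ ((r : ℤ) - 1) * lam = σ * μ := by rw [hμe]; ring
    have h1 := hest (θ + σ • z) θ
    rw [hκ] at h1
    have h2 := est_bound (e := est (θ + σ • z) - θ) (mul_nonneg hσ.le hμ0) (by abel) h1 hv
    refine h2.trans (le_of_eq ?_)
    rw [← hvd, eunorm_sq, ← smul_smul, ← smul_sub, sqnorm_smul]; ring
  refine (risk_le hσ hFi hFl hest2).trans ?_
  have hk1 : (1:ℝ) ≤ (k:ℝ) + 1 := by have := Nat.cast_nonneg (α := ℝ) k; linarith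
  have hP1 : (1:ℝ) ≤ ((k:ℝ) + 1) ^ (2 * r) := one_le_pow₀ hk1
  have hkn' : (k:ℝ) + 1 ≤ n := by exact_mod_cast hkn
  have hlog : 0 ≤ Real.log (Real.exp 1 * (n:ℝ) / ((k:ℝ) + 1)) := by
    apply Real.log_nonneg
    rw [le_div_iff₀ (by linarith), one_mul]
    have : (1:ℝ) ≤ Real.exp 1 := Real.one_le_exp zero_le_one
    nlinarith
  obtain ⟨L, hL⟩ : ∃ L, L = Real.log (Real.exp 1 * (n:ℝ) / ((k:ℝ) + 1)) := ⟨_, rfl⟩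
  rw [← hL] at hQb hlog ⊢
  obtain ⟨P, hP⟩ : ∃ P, P = ((k:ℝ) + 1) ^ (2 * r) := ⟨_, rfl⟩
  have hwP : eunorm v1 ^ 2 * (n:ℝ) ^ (2 * r - 1) ≤ C * P := by
    calc _ ≤ C * ((k+1) * ((k + 1) / n : ℝ) ^ (2 * r - 1)) * (n:ℝ) ^ (2 * r - 1) :=
          mul_le_mul_of_nonneg_right hw2 (by positivity)
      _ = C * P := by
        have : 2 * r = (2 * r - 1) + 1 := by omega
        rw [hP, div_pow, this]
        simp only [Nat.add_sub_cancel]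
        rw [pow_succ]; field_simp
  rw [← hP] at hQb hP1 ⊢
  have hwv : eunorm v1 ^ 2 / eunorm v0 ^ 2 ≤ C * P := by
    rw [div_le_iff₀ (by positivity)]
    have hN : (0:ℝ) < (n:ℝ) ^ (2 * r - 1) := by positivity
    have a0 : 0 ≤ C * P := by positivity
    have a1 : eunorm v1 ^ 2 ≤ C * P / (n:ℝ) ^ (2 * r - 1) := by rwa [le_div_iff₀ hN]
    refine a1.trans ?_
    rw [div_le_iff₀ hN]
    nlinarith
  have hwμ : eunorm v1 ^ 2 * (μ - (m + 2 / eunorm v0)) ^ 2 ≤ C * P * (lam - ls) ^ 2 / n := by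
    rw [hμs, hμe, ← mul_sub, mul_pow, le_div_iff₀ hnR]
    have e : ((n : ℝ) ^ ((r : ℤ) - 1)) ^ 2 * n = (n:ℝ) ^ (2 * r - 1) := by
      have : ((r:ℤ) - 1) = ((r - 1 : ℕ) : ℤ) := by omega
      rw [this, zpow_natCast, ← pow_mul, ← pow_succ]; congr 1; omega
    calc _ = (eunorm v1 ^ 2 * (((n : ℝ) ^ ((r : ℤ) - 1)) ^ 2 * n)) * (lam - ls) ^ 2 := by ring
      _ ≤ _ := by rw [e]; exact mul_le_mul_of_nonneg_right hwP (sq_nonneg _)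
  have hT : (56 + 12 * ∫ z, Q z ∂gaussVec n 1 +
      36 * (eunorm v1 ^ 2 * (μ - (m + 2 / eunorm v0)) ^ 2) + 288 * (eunorm v1 ^ 2 / eunorm v0 ^ 2)) ≤
      (56 + 12 * C + 36 * C + 288 * C) * ((k + 1) * L + P + P * (lam - ls) ^ 2 / n) := by
    have a1 : 0 ≤ ((k:ℝ) + 1) * L := by positivity
    have a2 : 0 ≤ P * (lam - ls) ^ 2 / n := by positivity
    have e3 : C * P * (lam - ls) ^ 2 / n = C * (P * (lam - ls) ^ 2 / n) := by ring
    rw [e3] at hwμ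
    have b1 := mul_nonneg hC.le a1
    have b2 := mul_nonneg hC.le a2
    have b3 : 0 ≤ C * P := by positivity
    linarith
  calc 1 / (n:ℝ) * (4 * σ ^ 2 * ∫ z, distSet z (scaleSet μ S) ^ 2 ∂gaussVec n 1)
      ≤ 1 / (n:ℝ) * (4 * σ ^ 2 * ((56 + 12 * C + 36 * C + 288 * C) * ((k + 1) * L + P + P * (lam - ls) ^ 2 / n))) := by
        refine mul_le_mul_of_nonneg_left ?_ (by positivity)
        exact mul_le_mul_of_nonneg_left (hFb.trans hT) (by positivity)
    _ = _ := by field_simp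

end
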